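/- Let F be an algebraically closed field of characteristic 0. If θ is an automorphism of order 4 of the simple Lie algebra 𝔢₈ of type E₈ over F such that the fixed subalgebra 𝔢₈^θ is semisimple, then 𝔢₈^θ is isomorphic either to 𝔰𝔩₂(F) ⊕ 𝔰𝔩₈(F) (so dim 𝔢₈^θ = 66; θ is said to be of type I) or to 𝔰𝔩₄(F) ⊕ 𝔰𝔬₁₀(F) (so dim 𝔢₈^θ = 60; θ is said to be of type II); in particular dim 𝔢₈^θ ∈ {66, 60}. -/

import Mathlib

open LieAlgebra

/-- The group of automorphisms of a Lie algebra, realized as the subgroup of the group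
of linear automorphisms consisting of those preserving the bracket. -/
def lieAut (R L : Type*) [CommRing R] [LieRing L] [LieAlgebra R L] :
    Subgroup (L ≃ₗ[R] L) where
  carrier := {e | ∀ x y : L, e ⁅x, y⁆ = ⁅e x, e y⁆}
  one_mem' := fun _ _ => rfl
  mul_mem' := by
    intro f g hf hg x y
    show f (g ⁅x, y⁆) = _
    rw [hg]
    exact hf _ _
  inv_mem' := by
    intro f hf x y
    apply f.injective
    show f (f.symm ⁅x, y⁆) = f ⁅f.symm x, f.symm y⁆
    rw [hf (f.symm x) (f.symm y), f.apply_symm_apply, f.apply_symm_apply, f.apply_symm_apply]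

/-- The subalgebra of fixed points of an automorphism of a Lie algebra. -/
def fixedSubalgebra {R L : Type*} [CommRing R] [LieRing L] [LieAlgebra R L]
    (θ : lieAut R L) : LieSubalgebra R L where
  carrier := {x | (θ : L ≃ₗ[R] L) x = x}
  add_mem' := by
    intro a b ha hb
    simp only [Set.mem_setOf_eq] at *
    rw [map_add, ha, hb]
  zero_mem' := map_zero _
  smul_mem' := by
    intro c a ha
    simp only [Set.mem_setOf_eq] at *
    rw [map_smul, ha]
  lie_mem' := by
    intro a b ha hb
    simp only [Set.mem_setOf_eq] at *
    rw [θ.2 a b, ha, hb]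

/-- A maximal finite abelian subgroup: a finite abelian subgroup which is maximal among
all abelian subgroups. -/
def IsMaximalFiniteAbelian {G : Type*} [Group G] (Q : Subgroup G) : Prop :=
  Finite Q ∧ (∀ a b, a ∈ Q → b ∈ Q → a * b = b * a) ∧
    ∀ Q' : Subgroup G, (∀ a b, a ∈ Q' → b ∈ Q' → a * b = b * a) → Q ≤ Q' → Q' = Q

/-- Two subgroups are conjugate. -/
def SubgroupIsConj {G : Type*} [Group G] (Q₁ Q₂ : Subgroup G) : Prop :=
  ∃ g : G, Q₂ = Q₁.map (MulAut.conj g).toMonoidHom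

/-- The direct sum (product) of two Lie rings. -/
instance prodLieRing {L M : Type*} [LieRing L] [LieRing M] : LieRing (L × M) where
  bracket x y := (⁅x.1, y.1⁆, ⁅x.2, y.2⁆)
  add_lie x y z := Prod.ext (add_lie x.1 y.1 z.1) (add_lie x.2 y.2 z.2)
  lie_add x y z := Prod.ext (lie_add x.1 y.1 z.1) (lie_add x.2 y.2 z.2)
  lie_self x := Prod.ext (lie_self x.1) (lie_self x.2)
  leibniz_lie x y z := Prod.ext (leibniz_lie x.1 y.1 z.1) (leibniz_lie x.2 y.2 z.2)

/-- The direct sum (product) of two Lie algebras. -/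
instance prodLieAlgebra {R L M : Type*} [CommRing R] [LieRing L] [LieRing M]
    [LieAlgebra R L] [LieAlgebra R M] : LieAlgebra R (L × M) where
  lie_smul t x y := Prod.ext (lie_smul t x.1 y.1) (lie_smul t x.2 y.2)

set_option linter.unusedSectionVars false
namespace E8P
open Matrix

section lattice
variable {ι : Type} [Fintype ι] [DecidableEq ι]

/-- The bilinear form attached to an integer matrix. -/
def bf (A : Matrix ι ι ℤ) (u v : ι → ℤ) : ℤ := u ⬝ᵥ (A *ᵥ v)

/-- The simple root with index `i`. -/
def sr (i : ι) : ι → ℤ := Pi.single i 1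

/-- Simply laced positive definite Cartan matrices. -/
structure SLPD (A : Matrix ι ι ℤ) : Prop where
  symm : ∀ i j, A i j = A j i
  diag : ∀ i, A i i = 2
  off : ∀ i j, i ≠ j → A i j = 0 ∨ A i j = -1
  pos : ∀ v, v ≠ 0 → 0 < bf A v v

variable {A : Matrix ι ι ℤ}

lemma bf_add_left (u v w : ι → ℤ) : bf A (u + v) w = bf A u w + bf A v w := by
  simp [bf, add_dotProduct]
lemma bf_add_right (u v w : ι → ℤ) : bf A u (v + w) = bf A u v + bf A u w := by
  simp [bf, mulVec_add, dotProduct_add]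
lemma bf_neg_left (u w : ι → ℤ) : bf A (-u) w = - bf A u w := by
  simp [bf, neg_dotProduct]
lemma bf_neg_right (u w : ι → ℤ) : bf A u (-w) = - bf A u w := by
  simp [bf, mulVec_neg]
lemma bf_sub_left (u v w : ι → ℤ) : bf A (u - v) w = bf A u w - bf A v w := by
  simp [bf, sub_dotProduct]
lemma bf_sub_right (u v w : ι → ℤ) : bf A u (v - w) = bf A u v - bf A u w := by
  simp [bf, mulVec_sub, dotProduct_sub]
lemma bf_smul_left (c : ℤ) (u w : ι → ℤ) : bf A (c • u) w = c * bf A u w := by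
  unfold bf; rw [smul_dotProduct, smul_eq_mul]
lemma bf_smul_right (c : ℤ) (u w : ι → ℤ) : bf A u (c • w) = c * bf A u w := by
  unfold bf; rw [mulVec_smul, dotProduct_smul, smul_eq_mul]
lemma bf_zero_left (w : ι → ℤ) : bf A 0 w = 0 := by simp [bf]
lemma bf_zero_right (w : ι → ℤ) : bf A w 0 = 0 := by simp [bf]
lemma bf_sum_left {κ : Type*} (s : Finset κ) (u : κ → ι → ℤ) (w : ι → ℤ) :
    bf A (∑ k ∈ s, u k) w = ∑ k ∈ s, bf A (u k) w := by
  simp [bf, sum_dotProduct]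

lemma bf_sr_left (i : ι) (v : ι → ℤ) : bf A (sr i) v = (A *ᵥ v) i := by
  simp [bf, sr]
lemma bf_sr_sr (i j : ι) : bf A (sr i) (sr j) = A i j := by
  rw [bf_sr_left]; simp [sr]

lemma bf_comm (hA : SLPD A) (u v : ι → ℤ) : bf A u v = bf A v u := by
  have : Aᵀ = A := by ext i j; exact hA.symm j i
  unfold bf
  rw [dotProduct_mulVec, ← mulVec_transpose, this, dotProduct_comm]

lemma bf_eq_sum (u v : ι → ℤ) : bf A u v = ∑ i, u i * (A *ᵥ v) i := rfl

lemma sum_sr (v : ι → ℤ) : v = ∑ i, v i • sr i := by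
  ext j
  simp [sr, Finset.sum_apply, Pi.single_apply]

lemma bf_even (hA : SLPD A) (v : ι → ℤ) : Even (bf A v v) := by
  have key : ∀ s : Finset ι, Even (bf A (∑ i ∈ s, v i • sr i) (∑ i ∈ s, v i • sr i)) := by
    intro s
    induction s using Finset.induction_on with
    | empty => simp [bf_zero_left]
    | insert a s ha ih =>
      rw [Finset.sum_insert ha]
      set w := ∑ i ∈ s, v i • sr i
      rw [bf_add_left, bf_add_right, bf_add_right, bf_comm hA w (v a • sr a)]
      obtain ⟨k, hk⟩ := ih
      rw [hk, bf_smul_left, bf_smul_right, bf_sr_sr, hA.diag]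
      exact ⟨v a * v a + bf A (v a • sr a) w + k, by rw [bf_smul_left]; ring⟩
  rw [sum_sr v]
  exact key Finset.univ

lemma bf_self_ge (hA : SLPD A) {v : ι → ℤ} (hv : v ≠ 0) : 2 ≤ bf A v v := by
  have := hA.pos v hv
  obtain ⟨k, hk⟩ := bf_even hA v
  omega

lemma bf_self_nonneg (hA : SLPD A) (v : ι → ℤ) : 0 ≤ bf A v v := by
  by_cases hv : v = 0
  · simp [hv, bf_zero_left]
  · exact (hA.pos v hv).le

lemma eq_of_bf_two (hA : SLPD A) {u v : ι → ℤ} (hu : bf A u u = 2) (hv : bf A v v = 2)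
    (h : 2 ≤ bf A u v) : u = v := by
  by_contra hne
  have := hA.pos (u - v) (sub_ne_zero.mpr hne)
  rw [bf_sub_left, bf_sub_right, bf_sub_right, bf_comm hA v u] at this
  omega

lemma bf_le_two (hA : SLPD A) {u v : ι → ℤ} (hu : bf A u u = 2) (hv : bf A v v = 2) :
    bf A u v ≤ 2 := by
  have := bf_self_nonneg hA (u - v)
  rw [bf_sub_left, bf_sub_right, bf_sub_right, bf_comm hA v u] at this
  omega

lemma eq_neg_of_bf_two (hA : SLPD A) {u v : ι → ℤ} (hu : bf A u u = 2) (hv : bf A v v = 2)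
    (h : bf A u v ≤ -2) : u = -v := by
  apply eq_of_bf_two hA hu
  · rw [bf_neg_left, bf_neg_right, hv]; rfl
  · rw [bf_neg_right]; omega

lemma neg_two_le_bf (hA : SLPD A) {u v : ι → ℤ} (hu : bf A u u = 2) (hv : bf A v v = 2) :
    -2 ≤ bf A u v := by
  have := bf_le_two hA (u := u) (v := -v) hu (by rw [bf_neg_left, bf_neg_right, hv]; rfl)
  rw [bf_neg_right] at this
  omega

lemma sr_norm (hA : SLPD A) (i : ι) : bf A (sr i) (sr i) = 2 := by rw [bf_sr_sr, hA.diag]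

lemma bf_add_sq (hA : SLPD A) (u v : ι → ℤ) :
    bf A (u + v) (u + v) = bf A u u + 2 * bf A u v + bf A v v := by
  rw [bf_add_left, bf_add_right, bf_add_right, bf_comm hA v u]; ring
lemma bf_sub_sq (hA : SLPD A) (u v : ι → ℤ) :
    bf A (u - v) (u - v) = bf A u u - 2 * bf A u v + bf A v v := by
  rw [bf_sub_left, bf_sub_right, bf_sub_right, bf_comm hA v u]; ring

lemma nonneg_or_nonpos (hA : SLPD A) {v : ι → ℤ} (hv : bf A v v = 2) : 0 ≤ v ∨ v ≤ 0 := by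
  set a : ι → ℤ := fun i => max (v i) 0 with ha
  set b : ι → ℤ := fun i => max (-v i) 0 with hb
  have hab : v = a - b := by
    ext i; simp only [ha, hb, Pi.sub_apply]; rcases le_total (v i) 0 with h | h
    · rw [max_eq_right h, max_eq_left (by omega)]; ring
    · rw [max_eq_left h, max_eq_right (by omega)]; ring
  have hle : bf A a b ≤ 0 := by
    rw [bf_eq_sum]
    apply Finset.sum_nonpos
    intro i _
    rw [mulVec, dotProduct, Finset.mul_sum]
    apply Finset.sum_nonpos
    intro j _
    by_cases hij : i = j
    · subst hij
      have : a i * b i = 0 := by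
        simp only [ha, hb]
        rcases le_total (v i) 0 with h | h
        · rw [max_eq_right h]; ring
        · rw [max_eq_right (a := - v i) (by omega)]; ring
      have h2 : a i * (A i i * b i) = A i i * (a i * b i) := by ring
      rw [h2, this, mul_zero]
    · have h1 : 0 ≤ a i := le_max_right _ _
      have h2 : 0 ≤ b j := le_max_right _ _
      have h3 : A i j ≤ 0 := by rcases hA.off i j hij with h | h <;> omega
      exact mul_nonpos_of_nonneg_of_nonpos h1 (mul_nonpos_of_nonpos_of_nonneg h3 h2)
  by_cases h0 : a = 0
  · right; rw [hab, h0]; intro i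
    have : 0 ≤ b i := le_max_right _ _
    simp only [Pi.sub_apply, Pi.zero_apply]; omega
  by_cases h1 : b = 0
  · left; rw [hab, h1]; intro i
    have : 0 ≤ a i := le_max_right _ _
    simp only [Pi.sub_apply, Pi.zero_apply]; omega
  exfalso
  have e1 := bf_self_ge hA h0
  have e2 := bf_self_ge hA h1
  rw [hab, bf_sub_sq hA] at hv
  omega

/-- Height. -/
def ht (v : ι → ℤ) : ℤ := ∑ i, v i

lemma ht_add (u v : ι → ℤ) : ht (u + v) = ht u + ht v := by simp [ht, Finset.sum_add_distrib]
lemma ht_sub (u v : ι → ℤ) : ht (u - v) = ht u - ht v := by simp [ht, Finset.sum_sub_distrib]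
lemma ht_neg (u : ι → ℤ) : ht (-u) = - ht u := by simp [ht]
lemma ht_sr (i : ι) : ht (sr i) = 1 := by simp [ht, sr]

lemma ht_pos {v : ι → ℤ} (h : 0 ≤ v) (h0 : v ≠ 0) : 0 < ht v := by
  refine Finset.sum_pos' (fun i _ => h i) ?_
  by_contra hc
  push Not at hc
  exact h0 (funext fun i => le_antisymm (hc i (Finset.mem_univ i)) (h i))

lemma exists_pos_index (hA : SLPD A) {v : ι → ℤ} (h : 0 ≤ v) (h0 : v ≠ 0) :
    ∃ i, 0 < v i ∧ 0 < bf A (sr i) v := by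
  by_contra hc
  push Not at hc
  have := hA.pos v h0
  rw [bf_eq_sum] at this
  refine absurd this (not_lt.mpr (Finset.sum_nonpos ?_))
  intro i _
  rcases (h i).lt_or_eq with hi | hi
  · have := hc i hi
    rw [bf_sr_left] at this
    exact mul_nonpos_of_nonneg_of_nonpos (h i) this
  · rw [← hi]; simp

/-- A positive root that is not simple can be lowered to a positive root. -/
lemma exists_lower (hA : SLPD A) {v : ι → ℤ} (h : 0 ≤ v) (h2 : bf A v v = 2) :
    (∃ i, v = sr i) ∨ ∃ i, bf A (sr i) v = 1 ∧ 0 ≤ v - sr i ∧ bf A (v - sr i) (v - sr i) = 2 := by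
  have h0 : v ≠ 0 := by rintro rfl; rw [bf_zero_left] at h2; omega
  obtain ⟨i, hi, hi2⟩ := exists_pos_index hA h h0
  by_cases hm : 2 ≤ bf A (sr i) v
  · left; exact ⟨i, (eq_of_bf_two hA (sr_norm hA i) h2 hm).symm⟩
  · right
    have h1 : bf A (sr i) v = 1 := by omega
    refine ⟨i, h1, ?_, ?_⟩
    · intro j
      by_cases hj : j = i
      · subst hj; simp [sr]; omega
      · simp [sr, hj]; exact h j
    · rw [bf_sub_sq hA, bf_comm hA v (sr i), h1, h2, sr_norm hA]; rfl

lemma mulVec_inj (hA : SLPD A) {u v : ι → ℤ} (h : A *ᵥ u = A *ᵥ v) : u = v := by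
  by_contra hne
  have := hA.pos (u - v) (sub_ne_zero.mpr hne)
  rw [bf, mulVec_sub, h, sub_self, dotProduct_zero] at this
  exact lt_irrefl _ this

lemma bf_cs (hA : SLPD A) (u v : ι → ℤ) : bf A u v ^ 2 ≤ bf A u u * bf A v v := by
  by_cases hv : v = 0
  · simp [hv, bf_zero_right]
  have hp := hA.pos v hv
  have := bf_self_nonneg hA (bf A v v • u - bf A u v • v)
  rw [bf_sub_sq hA, bf_smul_left, bf_smul_left, bf_smul_right, bf_smul_right, bf_smul_left,
    bf_smul_right] at this
  have h2 : 0 ≤ bf A v v * (bf A u u * bf A v v - bf A u v ^ 2) := by nlinarith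
  have := nonneg_of_mul_nonneg_right h2 hp
  omega

lemma det_ne (hA : SLPD A) : A.det ≠ 0 := by
  intro h
  obtain ⟨v, hv, h0⟩ := Matrix.exists_mulVec_eq_zero_iff.mpr h
  exact hv (mulVec_inj hA (by rw [h0, mulVec_zero]))

lemma finite_norm (hA : SLPD A) (C : ℤ) : {v : ι → ℤ | bf A v v ≤ C}.Finite := by
  set D : ι → ℤ := fun i => bf A (A.adjugate *ᵥ sr i) (A.adjugate *ᵥ sr i) * C
  apply (Set.finite_Icc (-D) D).subset
  intro v hv
  have hv : bf A v v ≤ C := hv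
  have key : ∀ i, |v i| ≤ D i := by
    intro i
    set w := A.adjugate *ᵥ sr i
    have h1 : bf A v w = A.det * v i := by
      have : A *ᵥ w = A.det • sr i := by
        simp only [w, mulVec_mulVec, mul_adjugate, smul_mulVec, one_mulVec]
      rw [bf, this, dotProduct_smul]
      simp [sr]
    have h2 := bf_cs hA v w
    rw [h1] at h2
    have h3 : bf A v v * bf A w w ≤ C * bf A w w :=
      mul_le_mul_of_nonneg_right hv (bf_self_nonneg hA w)
    have h4 : |v i| ≤ (A.det * v i) ^ 2 := by
      have d1 : 1 ≤ A.det ^ 2 := by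
        have := pow_pos (abs_pos.mpr (det_ne hA)) 2
        rw [sq_abs] at this; omega
      have d2 : |v i| ≤ v i ^ 2 := by
        rw [← sq_abs]
        nlinarith [abs_nonneg (v i), Int.one_le_abs (z := v i), eq_or_ne (v i) 0, Int.le_self_sq |v i|]
      nlinarith [sq_nonneg (v i)]
    show |v i| ≤ bf A w w * C
    nlinarith
  exact ⟨fun i => (abs_le.mp (key i)).1, fun i => (abs_le.mp (key i)).2⟩

lemma finite_roots (hA : SLPD A) : {v : ι → ℤ | bf A v v = 2}.Finite :=
  (finite_norm hA 2).subset fun _ h => le_of_eq h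

end lattice
end E8P

set_option linter.unusedSectionVars false
namespace E8P
open Matrix

section serre
variable {ι : Type} [Fintype ι] [DecidableEq ι] {F : Type} [Field F] [CharZero F]
  {S : Type} [LieRing S] [LieAlgebra F S]

/-- A system of elements satisfying the (simply laced) Serre relations. -/
structure SerreSys (F : Type) [Field F] {S : Type} [LieRing S] [LieAlgebra F S]
    (A : Matrix ι ι ℤ) (h e f : ι → S) : Prop where
  hh : ∀ i j, ⁅h i, h j⁆ = 0
  ef : ∀ i, ⁅e i, f i⁆ = h i
  ef0 : ∀ i j, i ≠ j → ⁅e i, f j⁆ = 0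
  he : ∀ i j, ⁅h i, e j⁆ = ((A i j : ℤ) : F) • e j
  hf : ∀ i j, ⁅h i, f j⁆ = -((A i j : ℤ) : F) • f j
  ee0 : ∀ i j, A i j = 0 → ⁅e i, e j⁆ = 0
  ee1 : ∀ i j, A i j = -1 → ⁅e i, ⁅e i, e j⁆⁆ = 0
  ff0 : ∀ i j, A i j = 0 → ⁅f i, f j⁆ = 0
  ff1 : ∀ i j, A i j = -1 → ⁅f i, ⁅f i, f j⁆⁆ = 0

variable {A : Matrix ι ι ℤ} {h e f : ι → S}

lemma SerreSys.symm (s : SerreSys F A h e f) : SerreSys F A (-h) f e where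
  hh i j := by simp [s.hh]
  ef i := by rw [← lie_skew, s.ef]; rfl
  ef0 i j hij := by rw [← lie_skew, s.ef0 j i hij.symm, neg_zero]
  he i j := by simp [s.hf]
  hf i j := by simp [s.he]
  ee0 := s.ff0
  ee1 := s.ff1
  ff0 := s.ee0
  ff1 := s.ee1

lemma SerreSys.fe (s : SerreSys F A h e f) (i : ι) : ⁅f i, e i⁆ = - h i := by
  rw [← lie_skew, s.ef]

lemma SerreSys.fe0 (s : SerreSys F A h e f) (i j : ι) (hij : i ≠ j) : ⁅f i, e j⁆ = 0 := by
  rw [← lie_skew, s.ef0 j i hij.symm, neg_zero]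

/-- Weight spaces. -/
def Wt (F : Type) [Field F] {S : Type} [LieRing S] [LieAlgebra F S]
    (A : Matrix ι ι ℤ) (h : ι → S) (v : ι → ℤ) : Submodule F S where
  carrier := {x | ∀ i, ⁅h i, x⁆ = (((A *ᵥ v) i : ℤ) : F) • x}
  add_mem' := by
    intro a b ha hb i
    rw [lie_add, ha i, hb i, smul_add]
  zero_mem' := by intro i; simp
  smul_mem' := by
    intro c a ha i
    rw [lie_smul, ha i, smul_comm]

lemma mem_Wt {v : ι → ℤ} {x : S} :
    x ∈ Wt F A h v ↔ ∀ i, ⁅h i, x⁆ = (((A *ᵥ v) i : ℤ) : F) • x := Iff.rfl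

lemma Wt_neg (v : ι → ℤ) : Wt F A (-h) v = Wt F A h (-v) := by
  ext x
  rw [mem_Wt, mem_Wt]
  refine forall_congr' fun i => ?_
  rw [mulVec_neg, Pi.neg_apply, Pi.neg_apply, neg_lie, Int.cast_neg, neg_smul, neg_eq_iff_eq_neg]

lemma lie_mem_Wt {u v : ι → ℤ} {x y : S} (hx : x ∈ Wt F A h u) (hy : y ∈ Wt F A h v) :
    ⁅x, y⁆ ∈ Wt F A h (u + v) := by
  intro i
  rw [leibniz_lie, hx i, hy i, smul_lie, lie_smul, mulVec_add, Pi.add_apply, Int.cast_add, add_smul]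

lemma SerreSys.e_mem (s : SerreSys F A h e f) (i : ι) : e i ∈ Wt F A h (sr i) := by
  intro j
  rw [s.he, ← bf_sr_left, bf_sr_sr]

lemma SerreSys.f_mem (s : SerreSys F A h e f) (i : ι) : f i ∈ Wt F A h (-sr i) := by
  rw [← Wt_neg]; exact s.symm.e_mem i

lemma SerreSys.h_mem (s : SerreSys F A h e f) (i : ι) : h i ∈ Wt F A h 0 := by
  intro j
  simp [s.hh]

/-- Monomials in the positive generators. -/
inductive Mono (e : ι → S) : (ι → ℤ) → S → Prop
  | base (i : ι) : Mono e (sr i) (e i)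
  | step (i : ι) {v : ι → ℤ} {x : S} : Mono e v x → Mono e (v + sr i) ⁅e i, x⁆

/-- The span of the monomials of given weight. -/
def Ns (F : Type) [Field F] {S : Type} [LieRing S] [LieAlgebra F S] (e : ι → S) (v : ι → ℤ) :
    Submodule F S := Submodule.span F {x | Mono e v x}

lemma Mono.mem {v : ι → ℤ} {x : S} (m : Mono e v x) : x ∈ Ns F e v := Submodule.subset_span m

lemma sr_nonneg (i : ι) : 0 ≤ sr i := by
  intro j; unfold sr; by_cases hj : j = i
  · subst hj; simp
  · simp [hj]

lemma sr_ne (i : ι) : sr i ≠ 0 := by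
  intro h; have := congrFun h i; simp [sr] at this

lemma Mono.nonneg {v : ι → ℤ} {x : S} (m : Mono e v x) : 0 ≤ v ∧ 1 ≤ ht v := by
  induction m with
  | base i => exact ⟨sr_nonneg i, (ht_sr i).ge⟩
  | step i m ih => exact ⟨add_nonneg ih.1 (sr_nonneg i), by rw [ht_add, ht_sr]; omega⟩

lemma Ns_induction {v : ι → ℤ} (P : S → Prop) (h0 : P 0) (ha : ∀ x y, P x → P y → P (x + y))
    (hs : ∀ (c : F) x, P x → P (c • x)) (hm : ∀ x, Mono e v x → P x) :
    ∀ x ∈ Ns F e v, P x := by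
  intro x hx
  induction hx using Submodule.span_induction with
  | mem x hx => exact hm x hx
  | zero => exact h0
  | add x y _ _ hx hy => exact ha x y hx hy
  | smul c x _ hx => exact hs c x hx

lemma Ns_ne {v : ι → ℤ} {x : S} (hx : x ∈ Ns F e v) (h0 : x ≠ 0) : 0 ≤ v ∧ 1 ≤ ht v := by
  by_contra hc
  apply h0
  refine Ns_induction (F := F) (e := e) (v := v) (fun x => x = 0) rfl (by rintro x y rfl rfl; simp)
    (by rintro c x rfl; simp) (fun x m => absurd m.nonneg hc) x hx

lemma e_Ns (i : ι) {v : ι → ℤ} {x : S} (hx : x ∈ Ns F e v) : ⁅e i, x⁆ ∈ Ns F e (v + sr i) := by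
  refine Ns_induction (F := F) (e := e) (v := v) (fun x => ⁅e i, x⁆ ∈ Ns F e (v + sr i))
    (by simp) ?_ ?_ ?_ x hx
  · intro x y hx hy; rw [lie_add]; exact add_mem hx hy
  · intro c x hx; rw [lie_smul]; exact Submodule.smul_mem _ _ hx
  · intro x m; exact (Mono.step i m).mem

lemma SerreSys.Ns_le (s : SerreSys F A h e f) (v : ι → ℤ) : Ns F e v ≤ Wt F A h v := by
  refine Submodule.span_le.mpr ?_
  intro x m'
  have m : Mono e v x := m'
  clear m'
  induction m with
  | base i => exact s.e_mem i
  | step i m ih => rw [add_comm]; exact lie_mem_Wt (s.e_mem i) ih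

lemma SerreSys.Ns_neg_le (s : SerreSys F A h e f) (v : ι → ℤ) : Ns F f v ≤ Wt F A h (-v) := by
  rw [← Wt_neg]; exact s.symm.Ns_le v

lemma Mono_sr {v : ι → ℤ} {x : S} (m : Mono e v x) : ∀ i, v = sr i → x = e i := by
  cases m with
  | base j =>
    intro i hi
    have := congrFun hi i
    by_cases hj : j = i
    · rw [hj]
    · simp [sr, Pi.single_apply, Ne.symm hj] at this
  | step j m =>
    intro i hi
    have := m.nonneg.2
    have h2 := congrArg ht hi
    rw [ht_add, ht_sr, ht_sr] at h2
    omega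

lemma Ns_sr {i : ι} {x : S} (hx : x ∈ Ns F e (sr i)) : ∃ c : F, x = c • e i := by
  refine Ns_induction (F := F) (e := e) (v := sr i) (fun x => ∃ c : F, x = c • e i)
    ⟨0, by simp⟩ ?_ ?_ ?_ x hx
  · rintro x y ⟨c, rfl⟩ ⟨d, rfl⟩; exact ⟨c + d, by rw [add_smul]⟩
  · rintro c x ⟨d, rfl⟩; exact ⟨c * d, by rw [mul_smul]⟩
  · intro x m; exact ⟨1, by rw [Mono_sr m i rfl, one_smul]⟩

lemma SerreSys.f_Mono (s : SerreSys F A h e f) (j : ι) {v : ι → ℤ} {x : S} (m : Mono e v x) :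
    (∃ i, v = sr i ∧ x = e i) ∨ ⁅f j, x⁆ ∈ Ns F e (v - sr j) := by
  induction m with
  | base i => left; exact ⟨i, rfl, rfl⟩
  | @step i v y m ih =>
    right
    rw [leibniz_lie]
    apply add_mem
    · by_cases hij : j = i
      · subst hij
        rw [s.fe, neg_lie, s.Ns_le v m.mem j, ← neg_smul, add_sub_cancel_right]
        exact Submodule.smul_mem _ _ m.mem
      · rw [s.fe0 j i hij, zero_lie]; exact zero_mem _
    · rcases ih with ⟨k, rfl, rfl⟩ | ih
      · by_cases hjk : j = k
        · subst hjk
          rw [s.fe, lie_neg, ← neg_lie, neg_lie, ← lie_skew, neg_neg, s.he, add_sub_cancel_left]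
          exact Submodule.smul_mem _ _ (Mono.base i).mem
        · rw [s.fe0 j k hjk, lie_zero]; exact zero_mem _
      · have := e_Ns i ih
        rwa [show v - sr j + sr i = v + sr i - sr j by abel] at this

lemma SerreSys.f_Ns (s : SerreSys F A h e f) (j : ι) {v : ι → ℤ} (hv : 2 ≤ ht v) {x : S}
    (hx : x ∈ Ns F e v) : ⁅f j, x⁆ ∈ Ns F e (v - sr j) := by
  refine Ns_induction (F := F) (e := e) (v := v) (fun x => ⁅f j, x⁆ ∈ Ns F e (v - sr j))
    (by simp) ?_ ?_ ?_ x hx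
  · intro x y hx hy; rw [lie_add]; exact add_mem hx hy
  · intro c x hx; rw [lie_smul]; exact Submodule.smul_mem _ _ hx
  · intro x m
    rcases s.f_Mono j m with ⟨i, rfl, rfl⟩ | hm
    · rw [ht_sr] at hv; omega
    · exact hm

/-- Local nilpotency. -/
lemma SerreSys.loc_nilp (hA : SLPD A) (s : SerreSys F A h e f) (i : ι) {v : ι → ℤ} {x : S}
    (hx : x ∈ Ns F e v) : ∃ n : ℕ, ((LieAlgebra.ad F S (e i)) ^ n) x = 0 := by
  rw [← LieSubalgebra.mem_engel_iff]
  have gen : ∀ j, e j ∈ LieSubalgebra.engel F (e i) := by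
    intro j
    rw [LieSubalgebra.mem_engel_iff]
    by_cases hij : i = j
    · subst hij; exact ⟨1, by simp⟩
    · rcases hA.off i j hij with h | h
      · exact ⟨1, by simp [s.ee0 i j h]⟩
      · exact ⟨2, by simp [pow_two, s.ee1 i j h]⟩
  refine Ns_induction (F := F) (e := e) (v := v) (fun x => x ∈ LieSubalgebra.engel F (e i))
    (zero_mem _) (fun x y hx hy => add_mem hx hy) (fun c x hx => SMulMemClass.smul_mem c hx) ?_ x hx
  intro y m
  clear hx x
  induction m with
  | base j => exact gen j
  | step j m ih => exact LieSubalgebra.lie_mem _ (gen j) ih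

/-- Elementary `sl₂` theory. -/
lemma sl2_low {H E G : S} (hH : ⁅E, G⁆ = H) (hE : ⁅H, E⁆ = (2 : F) • E)
    (hG : ⁅H, G⁆ = -(2 : F) • G) {x : S} {m : F}
    (hx : ⁅H, x⁆ = m • x) (hGx : ⁅G, x⁆ = 0) (hn : ∃ n : ℕ, ((LieAlgebra.ad F S E) ^ n) x = 0)
    (h0 : x ≠ 0) : ∃ n : ℕ, m = -(n : F) ∧ ((LieAlgebra.ad F S E) ^ (n + 1)) x = 0 := by
  set T := LieAlgebra.ad F S E
  have hw : ∀ n : ℕ, ⁅H, (T ^ n) x⁆ = (m + 2 * n) • (T ^ n) x := by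
    intro n
    induction n with
    | zero => simp [hx]
    | succ n ih =>
      rw [pow_succ', Module.End.mul_apply]
      show ⁅H, ⁅E, (T ^ n) x⁆⁆ = _ • ⁅E, (T ^ n) x⁆
      rw [leibniz_lie, ih, hE, smul_lie, lie_smul, ← add_smul]
      congr 1; push_cast; ring
  have hg : ∀ n : ℕ, ⁅G, (T ^ (n + 1)) x⁆ = (-(n + 1) * (m + n)) • (T ^ n) x := by
    intro n
    induction n with
    | zero =>
      simp only [zero_add, pow_one, pow_zero, Module.End.one_apply]
      show ⁅G, ⁅E, x⁆⁆ = _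
      rw [leibniz_lie, hGx, lie_zero, add_zero, ← lie_skew G E, hH, neg_lie, hx, ← neg_smul]
      congr 1; push_cast; ring
    | succ n ih =>
      rw [pow_succ', Module.End.mul_apply]
      show ⁅G, ⁅E, (T ^ (n + 1)) x⁆⁆ = _
      rw [leibniz_lie, ih, ← lie_skew G E, hH, neg_lie, hw, lie_smul, ← neg_smul]
      rw [show ⁅E, (T ^ n) x⁆ = (T ^ (n + 1)) x by rw [pow_succ', Module.End.mul_apply]; rfl, ← add_smul]
      congr 1; push_cast; ring
  classical
  obtain hN := Nat.find_spec hn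
  have hmin := fun k => Nat.find_min (H := hn) (m := k)
  generalize Nat.find hn = N at hN hmin
  cases N with
  | zero => exact absurd hN h0
  | succ N =>
    have h1 := hg N
    rw [hN, lie_zero] at h1
    have h2 := (smul_eq_zero.mp h1.symm).resolve_right (hmin N (Nat.lt_succ_self N))
    have h3 : (m + N : F) = 0 := by
      rcases mul_eq_zero.mp h2 with h | h
      · exfalso
        rw [neg_eq_zero] at h
        exact Nat.cast_add_one_ne_zero (R := F) N h
      · exact h
    exact ⟨N, eq_neg_of_add_eq_zero_left h3, hN⟩

end serre
end E8P

set_option linter.unusedSectionVars false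
namespace E8P
open Matrix

section serre
variable {ι : Type} [Fintype ι] [DecidableEq ι] {F : Type} [Field F] [CharZero F]
  {S : Type} [LieRing S] [LieAlgebra F S] {A : Matrix ι ι ℤ} {h e f : ι → S}

lemma eq_sr_of_ht_one {v : ι → ℤ} (h0 : 0 ≤ v) (h1 : ht v = 1) : ∃ k, v = sr k := by
  have hne : v ≠ 0 := by rintro rfl; simp [ht] at h1
  have : ∃ k, 0 < v k := by
    by_contra hc; push Not at hc
    exact hne (funext fun i => le_antisymm (hc i) (h0 i))
  obtain ⟨k, hk⟩ := this
  refine ⟨k, ?_⟩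
  have h2 : 0 ≤ v - sr k := by
    intro j
    by_cases hj : j = k
    · subst hj; simp [sr]; omega
    · simp [sr, hj]; exact h0 j
  by_contra hc
  have := ht_pos h2 (sub_ne_zero.mpr hc)
  rw [ht_sub, ht_sr] at this
  omega

lemma sr_inj {i j : ι} (hij : sr i = sr j) : i = j := by
  by_contra hc
  have := congrFun hij i
  simp [sr, Pi.single_apply, hc] at this

lemma SerreSys.f_kill_aux (s : SerreSys F A h e f) {n : ℤ}
    (IH : ∀ w : ι → ℤ, ht w < n → ∀ x ∈ Ns F e w, x ≠ 0 → bf A w w = 2)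
    {w : ι → ℤ} (hw : ht w ≤ n) (i : ι) (h1 : bf A (w - sr i) (w - sr i) ≠ 2) (h2 : w ≠ sr i)
    {z : S} (hz : z ∈ Ns F e w) : ⁅f i, z⁆ = 0 := by
  by_cases hz0 : z = 0
  · rw [hz0, lie_zero]
  obtain ⟨a, b⟩ := Ns_ne hz hz0
  by_cases hb : ht w = 1
  · obtain ⟨k, rfl⟩ := eq_sr_of_ht_one a hb
    obtain ⟨c, rfl⟩ := Ns_sr hz
    rw [lie_smul, s.fe0 i k (by rintro rfl; exact h2 rfl), smul_zero]
  · by_contra hne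
    exact h1 (IH (w - sr i) (by rw [ht_sub, ht_sr]; omega) _ (s.f_Ns i (by omega) hz) hne)

lemma SerreSys.triple (hA : SLPD A) (s : SerreSys F A h e f) (i : ι) :
    ⁅h i, e i⁆ = (2 : F) • e i ∧ ⁅h i, f i⁆ = -(2 : F) • f i := by
  rw [s.he, s.hf, hA.diag]; simp

lemma SerreSys.low (hA : SLPD A) (s : SerreSys F A h e f) (i : ι) {v : ι → ℤ} {x : S}
    (hx : x ∈ Ns F e v) (hf : ⁅f i, x⁆ = 0) (h0 : x ≠ 0) :
    ∃ n : ℕ, bf A (sr i) v = -(n : ℤ) ∧ ((LieAlgebra.ad F S (e i)) ^ (n + 1)) x = 0 := by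
  obtain ⟨n, h1, h2⟩ := sl2_low (F := F) (s.ef i) (s.triple hA i).1 (s.triple hA i).2
    (s.Ns_le v hx i) hf (s.loc_nilp hA i hx) h0
  refine ⟨n, ?_, h2⟩
  rw [bf_sr_left]
  exact_mod_cast h1

lemma SerreSys.norm_aux (hA : SLPD A) (s : SerreSys F A h e f) :
    ∀ n : ℕ, ∀ v : ι → ℤ, ht v < n → ∀ x ∈ Ns F e v, x ≠ 0 → bf A v v = 2 := by
  intro n
  induction n with
  | zero =>
    intro v hv x hx h0
    have := (Ns_ne hx h0).2
    push_cast at hv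
    omega
  | succ n IH =>
    intro v hv x hx h0
    push_cast at hv
    have : ∃ y, Mono e v y ∧ y ≠ 0 := by
      by_contra hc
      push Not at hc
      apply h0
      exact Ns_induction (F := F) (e := e) (v := v) (fun x => x = 0) rfl
        (by rintro x y rfl rfl; simp) (by rintro c x rfl; simp) hc x hx
    clear h0 hx x
    obtain ⟨y, m, hy⟩ := this
    cases m with
    | base i => exact sr_norm hA i
    | @step i u x m =>
      rw [ht_add, ht_sr] at hv
      have hx0 : x ≠ 0 := by rintro rfl; simp at hy
      have hxm : x ∈ Ns F e u := m.mem
      have hu := IH u (by omega) x hxm hx0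
      have hpos := Ns_ne hxm hx0
      rw [bf_add_sq hA, hu, sr_norm hA, bf_comm hA]
      have b1 := bf_le_two hA (sr_norm hA i) hu
      have b2 := neg_two_le_bf hA (sr_norm hA i) hu
      suffices bf A (sr i) u = -1 by rw [this]; rfl
      by_contra hm1
      have hcases : bf A (sr i) u = 2 ∨ bf A (sr i) u = -2 ∨ bf A (sr i) u = 0 ∨
        bf A (sr i) u = 1 := by omega
      rcases hcases with hm | hm | hm | hm
      · have := eq_of_bf_two hA (sr_norm hA i) hu hm.ge
        subst this
        obtain ⟨c, hc⟩ := Ns_sr hxm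
        rw [hc, lie_smul, lie_self, smul_zero] at hy
        exact hy rfl
      · have := eq_neg_of_bf_two hA (sr_norm hA i) hu hm.le
        have := congrArg ht this
        rw [ht_sr, ht_neg] at this
        omega
      · have hf : ⁅f i, x⁆ = 0 := by
          apply s.f_kill_aux IH (w := u) (by omega) i _ _ hxm
          · rw [bf_sub_sq hA, bf_comm hA u (sr i), hm, hu, sr_norm hA]; decide
          · rintro rfl; rw [sr_norm hA] at hm; omega
        obtain ⟨n, hn, h2⟩ := s.low hA i hxm hf hx0
        have : n = 0 := by omega
        subst this
        simp at h2
        exact hy h2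
      · have hht : 2 ≤ ht u := by
          by_contra hc
          obtain ⟨k, rfl⟩ := eq_sr_of_ht_one hpos.1 (by omega)
          rw [bf_sr_sr] at hm
          by_cases hik : i = k
          · subst hik; rw [hA.diag] at hm; omega
          · rcases hA.off i k hik with h | h <;> omega
        set z := ⁅f i, x⁆ with hz
        have hzm : z ∈ Ns F e (u - sr i) := s.f_Ns i hht hxm
        have hbz : bf A (sr i) (u - sr i) = -1 := by
          rw [bf_sub_right, sr_norm hA, hm]; rfl
        have hnz : bf A (u - sr i) (u - sr i) = 2 := by
          rw [bf_sub_sq hA, bf_comm hA u (sr i), hm, hu, sr_norm hA]; rfl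
        have hfz : ⁅f i, z⁆ = 0 := by
          apply s.f_kill_aux IH (w := u - sr i) (by rw [ht_sub, ht_sr]; omega) i _ _ hzm
          · rw [bf_sub_sq hA, bf_comm hA (u - sr i) (sr i), hbz, hnz, sr_norm hA]; decide
          · intro hc; rw [hc, sr_norm hA] at hbz; omega
        have hxe : x = ⁅e i, z⁆ := by
          by_contra hne
          have hmem : x - ⁅e i, z⁆ ∈ Ns F e u := by
            have := e_Ns i hzm
            rw [sub_add_cancel] at this
            exact sub_mem hxm this
          have hkill : ⁅f i, x - ⁅e i, z⁆⁆ = 0 := by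
            rw [lie_sub, leibniz_lie, hfz, lie_zero, add_zero, s.fe, neg_lie,
              s.Ns_le _ hzm i, ← bf_sr_left, hbz, ← hz]
            simp
          obtain ⟨n, hn, h2⟩ := s.low hA i hmem hkill (sub_ne_zero.mpr hne)
          omega
        have hz0 : z ≠ 0 := by intro hc; rw [hc, lie_zero] at hxe; exact hx0 hxe
        obtain ⟨n, hn, h2⟩ := s.low hA i hzm hfz hz0
        have : n = 1 := by omega
        subst this
        simp [pow_two] at h2
        apply hy
        rw [hxe]; exact h2

theorem SerreSys.norm_two (hA : SLPD A) (s : SerreSys F A h e f) {v : ι → ℤ} {x : S}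
    (hx : x ∈ Ns F e v) (h0 : x ≠ 0) : bf A v v = 2 :=
  s.norm_aux hA ((ht v).toNat + 1) v (by push_cast; omega) x hx h0

lemma SerreSys.f_kill (hA : SLPD A) (s : SerreSys F A h e f)
    {w : ι → ℤ} (i : ι) (h1 : bf A (w - sr i) (w - sr i) ≠ 2) (h2 : w ≠ sr i)
    {z : S} (hz : z ∈ Ns F e w) : ⁅f i, z⁆ = 0 :=
  s.f_kill_aux (n := ht w) (fun _ _ _ hx h0 => s.norm_two hA hx h0) le_rfl i h1 h2 hz

lemma SerreSys.e_kill (hA : SLPD A) (s : SerreSys F A h e f)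
    {w : ι → ℤ} (i : ι) (h1 : bf A (w + sr i) (w + sr i) ≠ 2)
    {z : S} (hz : z ∈ Ns F e w) : ⁅e i, z⁆ = 0 := by
  by_contra h0
  exact h1 (s.norm_two hA (e_Ns i hz) h0)

lemma SerreSys.ef_back (hA : SLPD A) (s : SerreSys F A h e f) {v : ι → ℤ} (hv : bf A v v = 2)
    {i : ι} (hi : bf A (sr i) v = 1) {x : S} (hx : x ∈ Ns F e v) : ⁅e i, ⁅f i, x⁆⁆ = x := by
  rw [leibniz_lie, s.e_kill hA i _ hx, lie_zero, add_zero, s.ef, s.Ns_le _ hx i, ← bf_sr_left, hi]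
  · simp
  · rw [bf_add_sq hA, bf_comm hA v (sr i), hi, hv, sr_norm hA]; decide

lemma SerreSys.fe_back (hA : SLPD A) (s : SerreSys F A h e f) {v : ι → ℤ} (hv : bf A v v = 2)
    {i : ι} (hi : bf A (sr i) v = -1) {x : S} (hx : x ∈ Ns F e v) : ⁅f i, ⁅e i, x⁆⁆ = x := by
  rw [leibniz_lie, s.f_kill hA i _ _ hx, lie_zero, add_zero, s.fe, neg_lie,
    s.Ns_le _ hx i, ← bf_sr_left, hi]
  · simp
  · rw [bf_sub_sq hA, bf_comm hA v (sr i), hi, hv, sr_norm hA]; decide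
  · rintro rfl; rw [sr_norm hA] at hi; omega

lemma root_lower_ind (hA : SLPD A) (P : (ι → ℤ) → Prop) (h1 : ∀ i, P (sr i))
    (h2 : ∀ v i, 0 ≤ v → bf A v v = 2 → bf A (sr i) v = 1 → 0 ≤ v - sr i →
      bf A (v - sr i) (v - sr i) = 2 → P (v - sr i) → P v)
    {v : ι → ℤ} (h0 : 0 ≤ v) (hv : bf A v v = 2) : P v := by
  have key : ∀ n : ℕ, ∀ v : ι → ℤ, ht v < n → 0 ≤ v → bf A v v = 2 → P v := by
    intro n
    induction n with
    | zero =>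
      intro v hn h0 hv
      have hne : v ≠ 0 := by rintro rfl; rw [bf_zero_left] at hv; omega
      have := ht_pos h0 hne
      push_cast at hn; omega
    | succ n ih =>
      intro v hn h0 hv
      rcases exists_lower hA h0 hv with ⟨i, rfl⟩ | ⟨i, a, b, c⟩
      · exact h1 i
      · exact h2 v i h0 hv a b c (ih _ (by rw [ht_sub, ht_sr]; push_cast at hn; omega) b c)
  exact key ((ht v).toNat + 1) v (by push_cast; omega) h0 hv

lemma SerreSys.dim_le (hA : SLPD A) (s : SerreSys F A h e f) {v : ι → ℤ} (h0 : 0 ≤ v)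
    (hv : bf A v v = 2) : ∃ g ∈ Ns F e v, ∀ x ∈ Ns F e v, ∃ c : F, x = c • g := by
  refine root_lower_ind hA (fun v => ∃ g ∈ Ns F e v, ∀ x ∈ Ns F e v, ∃ c : F, x = c • g) ?_ ?_ h0 hv
  · intro i; exact ⟨e i, (Mono.base i).mem, fun x hx => Ns_sr hx⟩
  · rintro v i h0 hv hi hp hr ⟨g, hg, hgx⟩
    refine ⟨⁅e i, g⁆, ?_, ?_⟩
    · have := e_Ns i hg; rwa [sub_add_cancel] at this
    · intro x hx
      have hht : 2 ≤ ht v := by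
        have hne : v - sr i ≠ 0 := by intro h; rw [h, bf_zero_left] at hr; omega
        have := ht_pos hp hne
        rw [ht_sub, ht_sr] at this; omega
      obtain ⟨c, hc⟩ := hgx _ (s.f_Ns i hht hx)
      exact ⟨c, by rw [← s.ef_back hA hv hi hx, hc, lie_smul]⟩

lemma SerreSys.exists_ne (hA : SLPD A) (s : SerreSys F A h e f) (he : ∀ i, e i ≠ 0)
    {v : ι → ℤ} (h0 : 0 ≤ v) (hv : bf A v v = 2) : ∃ x ∈ Ns F e v, x ≠ 0 := by
  refine root_lower_ind hA (fun v => ∃ x ∈ Ns F e v, x ≠ 0) ?_ ?_ h0 hv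
  · intro i; exact ⟨e i, (Mono.base i).mem, he i⟩
  · rintro v i h0 hv hi hp hr ⟨x, hx, hx0⟩
    refine ⟨⁅e i, x⁆, ?_, ?_⟩
    · have := e_Ns i hx; rwa [sub_add_cancel] at this
    · intro hc
      apply hx0
      rw [← s.fe_back hA hr _ hx, hc, lie_zero]
      rw [bf_sub_right, hi, sr_norm hA]; rfl

lemma SerreSys.descent (hA : SLPD A) (s : SerreSys F A h e f) (I : Submodule F S)
    (hI : ∀ i, ∀ x ∈ I, ⁅f i, x⁆ ∈ I)
    {v : ι → ℤ} {x : S} (hx : x ∈ Ns F e v) (hx0 : x ≠ 0) (hxI : x ∈ I) : ∃ j, e j ∈ I := by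
  have h0 := (Ns_ne hx hx0).1
  have hv := s.norm_two hA hx hx0
  refine root_lower_ind hA (fun v => ∀ x ∈ Ns F e v, x ≠ 0 → x ∈ I → ∃ j, e j ∈ I) ?_ ?_ h0 hv
    x hx hx0 hxI
  · intro i x hx hx0 hxI
    obtain ⟨c, rfl⟩ := Ns_sr hx
    have hc : c ≠ 0 := by rintro rfl; simp at hx0
    exact ⟨i, by simpa [smul_smul, hc] using I.smul_mem c⁻¹ hxI⟩
  · intro v i h0 hv hi hp hr ih x hx hx0 hxI
    have hht : 2 ≤ ht v := by
      have hne : v - sr i ≠ 0 := by intro h; rw [h, bf_zero_left] at hr; omega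
      have := ht_pos hp hne
      rw [ht_sub, ht_sr] at this; omega
    refine ih ⁅f i, x⁆ (s.f_Ns i hht hx) ?_ (hI i x hxI)
    intro hc
    apply hx0
    rw [← s.ef_back hA hv hi hx, hc, lie_zero]

end serre
end E8P

set_option linter.unusedSectionVars false
namespace E8P
open Matrix

section serre
variable {ι : Type} [Fintype ι] [DecidableEq ι] {F : Type} [Field F] [CharZero F]
  {S : Type} [LieRing S] [LieAlgebra F S] {A : Matrix ι ι ℤ} {h e f : ι → S}

/-- Components of an element of an `h`-stable subspace lie in the subspace. -/
lemma comp_mem (hA : SLPD A) (I : Submodule F S) (hI : ∀ i, ∀ x ∈ I, ⁅h i, x⁆ ∈ I)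
    (s : Finset (ι → ℤ)) : ∀ (x : (ι → ℤ) → S), (∀ v ∈ s, x v ∈ Wt F A h v) →
    ∑ v ∈ s, x v ∈ I → ∀ v ∈ s, x v ∈ I := by
  induction s using Finset.induction_on with
  | empty => simp
  | insert u s hu ih =>
    intro x hx hs
    rw [Finset.sum_insert hu] at hs
    have key : ∀ v ∈ s, x v ∈ I := by
      intro v hv
      have hne : A *ᵥ v ≠ A *ᵥ u := by
        intro hc; exact hu (mulVec_inj hA hc ▸ hv)
      obtain ⟨i, hi⟩ := Function.ne_iff.mp hne
      have h1 := I.sub_mem (hI i _ hs) (I.smul_mem ((((A *ᵥ u) i : ℤ) : F)) hs)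
      have h2 : ⁅h i, x u + ∑ v ∈ s, x v⁆ - (((A *ᵥ u) i : ℤ) : F) • (x u + ∑ v ∈ s, x v)
          = ∑ w ∈ s, ((((A *ᵥ w) i : ℤ) : F) - (((A *ᵥ u) i : ℤ) : F)) • x w := by
        rw [lie_add, smul_add, hx u (Finset.mem_insert_self _ _) i, add_sub_add_left_eq_sub,
          lie_sum, Finset.smul_sum, ← Finset.sum_sub_distrib]
        refine Finset.sum_congr rfl fun w hw => ?_
        rw [hx w (Finset.mem_insert_of_mem hw) i, sub_smul]
      rw [h2] at h1
      have h3 := ih (fun w => ((((A *ᵥ w) i : ℤ) : F) - (((A *ᵥ u) i : ℤ) : F)) • x w)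
        (fun w hw => Submodule.smul_mem _ _ (hx w (Finset.mem_insert_of_mem hw))) h1 v hv
      have h4 : ((((A *ᵥ v) i : ℤ) : F) - (((A *ᵥ u) i : ℤ) : F)) ≠ 0 := by
        rw [sub_ne_zero]; exact_mod_cast hi
      simpa [smul_smul, h4] using I.smul_mem (((((A *ᵥ v) i : ℤ) : F) - (((A *ᵥ u) i : ℤ) : F))⁻¹) h3
    intro v hv
    rcases Finset.mem_insert.mp hv with rfl | hv
    · have := I.sub_mem hs (I.sum_mem fun w hw => key w hw)
      rwa [add_sub_cancel_right] at this
    · exact key v hv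

/-- The candidate for the full weight space. -/
def Tot (F : Type) [Field F] {S : Type} [LieRing S] [LieAlgebra F S] (h e f : ι → S)
    (v : ι → ℤ) : Submodule F S :=
  Ns F e v ⊔ Ns F f (-v) ⊔ (⨆ (_ : v = 0), Submodule.span F (Set.range h))

lemma Tot_symm (v : ι → ℤ) : Tot F (-h) f e (-v) = Tot F h e f v := by
  unfold Tot
  rw [neg_neg, sup_comm (Ns F f (-v))]
  congr 1
  simp only [neg_eq_zero]
  congr 1
  ext _
  rw [show Set.range (-h) = - Set.range h by ext x; simp [neg_eq_iff_eq_neg], Submodule.span_neg]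

lemma SerreSys.Tot_le (s : SerreSys F A h e f) (v : ι → ℤ) : Tot F h e f v ≤ Wt F A h v := by
  refine sup_le (sup_le (s.Ns_le v) ?_) ?_
  · have := s.Ns_neg_le (-v); rwa [neg_neg] at this
  · refine iSup_le ?_
    rintro rfl
    rw [Submodule.span_le]
    rintro _ ⟨i, rfl⟩
    exact s.h_mem i

lemma SerreSys.e_Tot (s : SerreSys F A h e f) (i : ι) {v : ι → ℤ} {x : S}
    (hx : x ∈ Tot F h e f v) : ⁅e i, x⁆ ∈ Tot F h e f (v + sr i) := by
  have : Tot F h e f v ≤ (Tot F h e f (v + sr i)).comap (LieAlgebra.ad F S (e i)) := by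
    refine sup_le (sup_le ?_ ?_) ?_
    · intro y hy
      exact le_sup_left (α := Submodule F S) (le_sup_left (α := Submodule F S) (e_Ns i hy))
    · refine Submodule.span_le.mpr ?_
      intro y m
      have m : Mono f (-v) y := m
      rcases s.symm.f_Mono i m with ⟨k, hk, rfl⟩ | hm
      · show ⁅e i, f k⁆ ∈ Tot F h e f (v + sr i)
        by_cases hik : i = k
        · subst hik
          rw [s.ef]
          apply le_sup_right (α := Submodule F S)
          have : v + sr i = 0 := by rw [← hk]; simp
          rw [iSup_pos this]
          exact Submodule.subset_span ⟨i, rfl⟩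
        · rw [s.ef0 i k hik]; exact zero_mem _
      · apply le_sup_left (α := Submodule F S)
        apply le_sup_right (α := Submodule F S)
        rwa [neg_add, ← sub_eq_add_neg]
    · refine iSup_le ?_
      rintro rfl
      rw [Submodule.span_le]
      rintro _ ⟨k, rfl⟩
      show ⁅e i, h k⁆ ∈ Tot F h e f (0 + sr i)
      rw [← lie_skew, s.he, zero_add, ← neg_smul]
      apply Submodule.smul_mem
      exact le_sup_left (α := Submodule F S) (le_sup_left (α := Submodule F S) (Mono.base i).mem)
  exact this hx

lemma SerreSys.f_Tot (s : SerreSys F A h e f) (i : ι) {v : ι → ℤ} {x : S}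
    (hx : x ∈ Tot F h e f v) : ⁅f i, x⁆ ∈ Tot F h e f (v - sr i) := by
  rw [← Tot_symm] at hx ⊢
  have := s.symm.e_Tot i hx
  rwa [neg_sub', sub_neg_eq_add]

lemma SerreSys.iSup_Tot (s : SerreSys F A h e f)
    (gen : LieSubalgebra.lieSpan F S (Set.range e ∪ Set.range f) = ⊤) :
    ⨆ v, Tot F h e f v = ⊤ := by
  set V := ⨆ v, Tot F h e f v with hV
  have hT : ∀ v, Tot F h e f v ≤ V := fun v => le_iSup (fun v => Tot F h e f v) v
  let N : LieSubalgebra F S :=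
    { carrier := {y | ∀ x ∈ V, ⁅y, x⁆ ∈ V}
      add_mem' := by intro a b ha hb x hx; rw [add_lie]; exact add_mem (ha x hx) (hb x hx)
      zero_mem' := by intro x hx; rw [zero_lie]; exact zero_mem _
      smul_mem' := by intro c a ha x hx; rw [smul_lie]; exact V.smul_mem _ (ha x hx)
      lie_mem' := by
        intro a b ha hb x hx
        rw [lie_lie]
        exact sub_mem (ha _ (hb x hx)) (hb _ (ha x hx)) }
  have hN : N = ⊤ := by
    rw [eq_top_iff, ← gen, LieSubalgebra.lieSpan_le]
    rintro _ (⟨i, rfl⟩ | ⟨i, rfl⟩)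
    · have : V ≤ V.comap (LieAlgebra.ad F S (e i)) :=
        iSup_le fun v x hx => hT _ (s.e_Tot i hx)
      exact fun x hx => this hx
    · have : V ≤ V.comap (LieAlgebra.ad F S (f i)) :=
        iSup_le fun v x hx => hT _ (s.f_Tot i hx)
      exact fun x hx => this hx
  let V' : LieSubalgebra F S :=
    { V with
      lie_mem' := by
        intro a b _ hb
        have : a ∈ N := hN ▸ LieSubalgebra.mem_top a
        exact this b hb }
  have hV' : V' = ⊤ := by
    rw [eq_top_iff, ← gen, LieSubalgebra.lieSpan_le]
    rintro _ (⟨i, rfl⟩ | ⟨i, rfl⟩)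
    · exact hT (sr i) (le_sup_left (α := Submodule F S) (le_sup_left (α := Submodule F S)
        (Mono.base i).mem))
    · refine hT (-sr i) (le_sup_left (α := Submodule F S) (le_sup_right (α := Submodule F S) ?_))
      rw [neg_neg]; exact (Mono.base i).mem
  rw [eq_top_iff]
  intro x _
  have : x ∈ V' := hV' ▸ LieSubalgebra.mem_top x
  exact this

lemma SerreSys.decomp (s : SerreSys F A h e f)
    (gen : LieSubalgebra.lieSpan F S (Set.range e ∪ Set.range f) = ⊤) (x : S) :
    ∃ (t : Finset (ι → ℤ)) (y : (ι → ℤ) → S), (∀ v, y v ∈ Tot F h e f v) ∧ x = ∑ v ∈ t, y v := by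
  have : x ∈ ⨆ v, Tot F h e f v := by rw [s.iSup_Tot gen]; trivial
  rw [Submodule.mem_iSup_iff_exists_finsupp] at this
  obtain ⟨g, hg, rfl⟩ := this
  exact ⟨g.support, g, hg, rfl⟩

lemma SerreSys.Wt_eq (hA : SLPD A) (s : SerreSys F A h e f)
    (gen : LieSubalgebra.lieSpan F S (Set.range e ∪ Set.range f) = ⊤) (u : ι → ℤ) :
    Wt F A h u = Tot F h e f u := by
  refine le_antisymm ?_ (s.Tot_le u)
  intro x hx
  obtain ⟨t, y, hy, hxy⟩ := s.decomp gen x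
  by_cases hu : u ∈ t
  · have := comp_mem (h := h) hA (⊥ : Submodule F S) (by simp) t
      (fun v => y v - if v = u then x else 0) ?_ ?_ u hu
    · simp only [if_true, Submodule.mem_bot, sub_eq_zero] at this
      rw [← this]; exact hy u
    · intro v hv
      apply sub_mem (s.Tot_le v (hy v))
      split_ifs with hvu
      · rwa [hvu]
      · exact zero_mem _
    · rw [Finset.sum_sub_distrib, ← hxy, Finset.sum_ite_eq' t u]
      simp [hu]
  · have := comp_mem (h := h) hA (⊥ : Submodule F S) (by simp) (insert u t)
      (fun v => if v = u then -x else y v) ?_ ?_ u (Finset.mem_insert_self _ _)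
    · simp at this; rw [this]; exact zero_mem _
    · intro v hv
      split_ifs with hvu
      · rw [hvu]; exact neg_mem hx
      · exact s.Tot_le v (hy v)
    · rw [Finset.sum_insert hu]
      have : ∑ v ∈ t, (if v = u then -x else y v) = ∑ v ∈ t, y v := by
        refine Finset.sum_congr rfl fun v hv => if_neg ?_
        rintro rfl; exact hu hv
      rw [this, ← hxy]; simp

lemma Ns_eq_bot {v : ι → ℤ} (hv : ¬ (0 ≤ v ∧ 1 ≤ ht v)) : Ns F e v = ⊥ := by
  rw [eq_bot_iff]
  intro x hx
  by_contra hc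
  exact hv (Ns_ne hx hc)

lemma SerreSys.Wt_zero (hA : SLPD A) (s : SerreSys F A h e f)
    (gen : LieSubalgebra.lieSpan F S (Set.range e ∪ Set.range f) = ⊤) :
    Wt F A h 0 = Submodule.span F (Set.range h) := by
  rw [s.Wt_eq hA gen, Tot, neg_zero, Ns_eq_bot (by simp [ht]), Ns_eq_bot (by simp [ht]),
    iSup_pos rfl]
  simp

lemma SerreSys.Wt_nonneg (hA : SLPD A) (s : SerreSys F A h e f)
    (gen : LieSubalgebra.lieSpan F S (Set.range e ∪ Set.range f) = ⊤) {v : ι → ℤ}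
    (h0 : 0 ≤ v) (hv : v ≠ 0) : Wt F A h v = Ns F e v := by
  have := ht_pos h0 hv
  rw [s.Wt_eq hA gen, Tot, Ns_eq_bot (e := f) (by rw [ht_neg]; omega), iSup_neg hv]
  simp

lemma SerreSys.Wt_nonpos (hA : SLPD A) (s : SerreSys F A h e f)
    (gen : LieSubalgebra.lieSpan F S (Set.range e ∪ Set.range f) = ⊤) {v : ι → ℤ}
    (h0 : v ≤ 0) (hv : v ≠ 0) : Wt F A h v = Ns F f (-v) := by
  have := ht_pos (neg_nonneg.mpr h0) (neg_ne_zero.mpr hv)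
  rw [ht_neg] at this
  rw [s.Wt_eq hA gen, Tot, Ns_eq_bot (e := e) (by omega), iSup_neg hv]
  simp

lemma SerreSys.Wt_root (hA : SLPD A) (s : SerreSys F A h e f)
    (gen : LieSubalgebra.lieSpan F S (Set.range e ∪ Set.range f) = ⊤) {v : ι → ℤ}
    (hv : v ≠ 0) {x : S} (hx : x ∈ Wt F A h v) (hx0 : x ≠ 0) : bf A v v = 2 := by
  rw [s.Wt_eq hA gen, Tot, iSup_neg hv, sup_bot_eq] at hx
  obtain ⟨y, hy, z, hz, rfl⟩ := Submodule.mem_sup.mp hx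
  by_cases hy0 : y = 0
  · have hz0 : z ≠ 0 := by rintro rfl; simp [hy0] at hx0
    have := s.symm.norm_two hA hz hz0
    rwa [bf_neg_left, bf_neg_right, neg_neg] at this
  · exact s.norm_two hA hy hy0

lemma SerreSys.Wt_dim (hA : SLPD A) (s : SerreSys F A h e f)
    (gen : LieSubalgebra.lieSpan F S (Set.range e ∪ Set.range f) = ⊤) {v : ι → ℤ}
    (hv : bf A v v = 2) : ∃ g ∈ Wt F A h v, ∀ x ∈ Wt F A h v, ∃ c : F, x = c • g := by
  have hne : v ≠ 0 := by rintro rfl; rw [bf_zero_left] at hv; omega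
  rcases nonneg_or_nonpos hA hv with h0 | h0
  · rw [s.Wt_nonneg hA gen h0 hne]; exact s.dim_le hA h0 hv
  · rw [s.Wt_nonpos hA gen h0 hne]
    exact s.symm.dim_le hA (neg_nonneg.mpr h0) (by rwa [bf_neg_left, bf_neg_right, neg_neg])

lemma SerreSys.Wt_ne (hA : SLPD A) (s : SerreSys F A h e f) (he : ∀ i, e i ≠ 0)
    (hf : ∀ i, f i ≠ 0) {v : ι → ℤ}
    (hv : bf A v v = 2) : ∃ x ∈ Tot F h e f v, x ≠ 0 := by
  rcases nonneg_or_nonpos hA hv with h0 | h0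
  · obtain ⟨x, hx, h⟩ := s.exists_ne hA he h0 hv
    exact ⟨x, le_sup_left (α := Submodule F S) (le_sup_left (α := Submodule F S) hx), h⟩
  · obtain ⟨x, hx, h⟩ := s.symm.exists_ne hA hf (neg_nonneg.mpr h0)
      (by rwa [bf_neg_left, bf_neg_right, neg_neg])
    exact ⟨x, le_sup_left (α := Submodule F S) (le_sup_right (α := Submodule F S) hx), h⟩

/-- An ideal meeting the Cartan subalgebra trivially vanishes. -/
lemma SerreSys.ideal_bot (hA : SLPD A) (s : SerreSys F A h e f)
    (gen : LieSubalgebra.lieSpan F S (Set.range e ∪ Set.range f) = ⊤)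
    (I : LieIdeal F S) (hI : ∀ x ∈ Submodule.span F (Set.range h), x ∈ I → x = 0)
    (hh : ∀ i, h i ∉ I) : I = ⊥ := by
  rw [eq_bot_iff]
  intro x hxI
  obtain ⟨t, y, hy, hxy⟩ := s.decomp gen x
  have hst : ∀ (z : S), ∀ x ∈ (I : Submodule F S), ⁅z, x⁆ ∈ (I : Submodule F S) :=
    fun z x hx => lie_mem_right F S I z x hx
  have key := comp_mem (h := h) hA (I : Submodule F S) (fun i => hst (h i)) t y
    (fun v _ => s.Tot_le v (hy v)) (hxy ▸ hxI)
  suffices ∀ v ∈ t, y v = 0 by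
    rw [hxy, Finset.sum_eq_zero this]; simp
  intro v hv
  have hyI := key v hv
  have he : ∀ i, e i ∉ I := by
    intro i hi
    apply hh i
    have := hst (f i) _ hi
    rw [s.fe] at this
    exact neg_mem_iff.mp this
  have hf : ∀ i, f i ∉ I := by
    intro i hi
    apply hh i
    have := hst (e i) _ hi
    rwa [s.ef] at this
  by_cases hv0 : v = 0
  · subst hv0
    have h1 := s.Tot_le 0 (hy 0)
    rw [s.Wt_zero hA gen] at h1
    exact hI _ h1 hyI
  by_contra hne
  have h1 := s.Tot_le v (hy v)
  have hr := s.Wt_root hA gen hv0 h1 hne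
  rcases nonneg_or_nonpos hA hr with h0 | h0
  · rw [s.Wt_nonneg hA gen h0 hv0] at h1
    obtain ⟨j, hj⟩ := s.descent hA (I : Submodule F S) (fun i => hst (f i)) h1 hne hyI
    exact he j hj
  · rw [s.Wt_nonpos hA gen h0 hv0] at h1
    obtain ⟨j, hj⟩ := s.symm.descent hA (I : Submodule F S) (fun i => hst (e i)) h1 hne hyI
    exact hf j hj

lemma SerreSys.injective_of_linInd (hA : SLPD A) (s : SerreSys F A h e f)
    (gen : LieSubalgebra.lieSpan F S (Set.range e ∪ Set.range f) = ⊤)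
    {M : Type} [LieRing M] [LieAlgebra F M] (φ : S →ₗ⁅F⁆ M)
    (hφ : LinearIndependent F (fun i => φ (h i))) : Function.Injective φ := by
  rw [← LieHom.ker_eq_bot]
  apply s.ideal_bot hA gen
  · intro x hx hk
    rw [LieHom.mem_ker] at hk
    obtain ⟨c, rfl⟩ := (Submodule.mem_span_range_iff_exists_fun F).mp hx
    rw [map_sum] at hk
    have := Fintype.linearIndependent_iff.mp hφ c (by simpa using hk)
    simp [this]
  · intro i hi
    rw [LieHom.mem_ker] at hi
    exact hφ.ne_zero i hi

lemma SerreSys.finite (hA : SLPD A) (s : SerreSys F A h e f)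
    (gen : LieSubalgebra.lieSpan F S (Set.range e ∪ Set.range f) = ⊤) : Module.Finite F S := by
  have hfin : Set.Finite {v : ι → ℤ | bf A v v ≤ 2} := finite_norm hA 2
  have htop : ⨆ v ∈ {v : ι → ℤ | bf A v v ≤ 2}, Wt F A h v = ⊤ := by
    rw [eq_top_iff, ← s.iSup_Tot gen]
    refine iSup_le fun v => ?_
    by_cases hv : bf A v v ≤ 2
    · exact (s.Tot_le v).trans (le_iSup₂ (f := fun v (_ : v ∈ {v : ι → ℤ | bf A v v ≤ 2}) =>
        Wt F A h v) v hv)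
    · intro x hx
      have hx := s.Tot_le v hx
      by_cases hx0 : x = 0
      · rw [hx0]; exact zero_mem _
      · exfalso
        have hv0 : v ≠ 0 := by rintro rfl; rw [bf_zero_left] at hv; omega
        exact hv (s.Wt_root hA gen hv0 hx hx0).le
  have hfd : ∀ v ∈ {v : ι → ℤ | bf A v v ≤ 2}, (Wt F A h v).FG := by
    intro v hv
    by_cases hv0 : v = 0
    · rw [hv0, s.Wt_zero hA gen]
      exact Submodule.fg_span (Set.finite_range h)
    · have h2 : bf A v v = 2 := le_antisymm hv (bf_self_ge hA hv0)
      obtain ⟨g, hg, hgx⟩ := s.Wt_dim hA gen h2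
      have : Wt F A h v = Submodule.span F {g} := by
        apply le_antisymm
        · intro x hx
          obtain ⟨c, rfl⟩ := hgx x hx
          exact Submodule.smul_mem _ _ (Submodule.mem_span_singleton_self g)
        · rw [Submodule.span_le]; simpa using hg
      rw [this]; exact Submodule.fg_span_singleton g
  rw [Module.finite_def, ← htop]
  have := hfin.to_subtype
  rw [iSup_subtype']
  exact Submodule.fg_iSup _ fun v => hfd v.1 v.2

end serre
end E8P

set_option linter.unusedSectionVars false
namespace E8P
open Matrix

section serre
variable {ι : Type} [Fintype ι] [DecidableEq ι] {F : Type} [Field F] [CharZero F]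
  {A : Matrix ι ι ℤ}

open CartanMatrix

/-- The quotient map onto the Serre algebra. -/
noncomputable def mkS (F : Type) [Field F] (A : Matrix ι ι ℤ) :
    FreeLieAlgebra F (Generators ι) →ₗ⁅F⁆ A.ToLieAlgebra F where
  toFun x := (LieSubmodule.Quotient.mk x : FreeLieAlgebra F (Generators ι) ⧸ Relations.toIdeal F A)
  map_add' _ _ := rfl
  map_smul' _ _ := rfl
  map_lie' := rfl

lemma mkS_surj : Function.Surjective (mkS F A) := Quot.mk_surjective

lemma mkS_zero {x : FreeLieAlgebra F (Generators ι)} (hx : x ∈ Relations.toSet F A) :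
    mkS F A x = 0 := by
  have : x ∈ Relations.toIdeal F A := LieSubmodule.subset_lieSpan hx
  exact (LieSubmodule.Quotient.mk_eq_zero' (N := Relations.toIdeal F A)).mpr this

noncomputable def sH (F : Type) [Field F] (A : Matrix ι ι ℤ) (i : ι) : A.ToLieAlgebra F :=
  mkS F A (FreeLieAlgebra.of F (Generators.H i))
noncomputable def sE (F : Type) [Field F] (A : Matrix ι ι ℤ) (i : ι) : A.ToLieAlgebra F :=
  mkS F A (FreeLieAlgebra.of F (Generators.E i))
noncomputable def sF (F : Type) [Field F] (A : Matrix ι ι ℤ) (i : ι) : A.ToLieAlgebra F :=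
  mkS F A (FreeLieAlgebra.of F (Generators.F i))

lemma serreSys_std : SerreSys F A (sH F A) (sE F A) (sF F A) where
  hh i j := by
    have := mkS_zero (F := F) (A := A) (x := Relations.HH F (i, j)) (by simp [Relations.toSet])
    simpa [Relations.HH, sH] using this
  ef i := by
    have := mkS_zero (F := F) (A := A) (x := Relations.EF F (i, i)) (by simp [Relations.toSet])
    rw [Relations.EF] at this
    simp only [Function.uncurry_apply_pair, if_true, map_sub, LieHom.map_lie, sub_eq_zero] at this
    exact this
  ef0 i j hij := by
    have := mkS_zero (F := F) (A := A) (x := Relations.EF F (i, j)) (by simp [Relations.toSet])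
    rw [Relations.EF] at this
    simp only [Function.uncurry_apply_pair, hij, if_false, LieHom.map_lie] at this
    exact this
  he i j := by
    have := mkS_zero (F := F) (A := A) (x := Relations.HE F A (i, j)) (by simp [Relations.toSet])
    rw [Relations.HE] at this
    simp only [Function.uncurry_apply_pair, map_sub, LieHom.map_lie, sub_eq_zero, map_zsmul] at this
    rw [Int.cast_smul_eq_zsmul]
    exact this
  hf i j := by
    have := mkS_zero (F := F) (A := A) (x := Relations.HF F A (i, j)) (by simp [Relations.toSet])
    rw [Relations.HF] at this
    simp only [Function.uncurry_apply_pair, map_add, LieHom.map_lie, map_zsmul] at this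
    rw [neg_smul, Int.cast_smul_eq_zsmul]
    exact eq_neg_of_add_eq_zero_left this
  ee0 i j hij := by
    have := mkS_zero (F := F) (A := A) (x := Relations.adE F A (i, j)) (by simp [Relations.toSet])
    rw [Relations.adE] at this
    simpa [hij, sE, sF] using this
  ee1 i j hij := by
    have := mkS_zero (F := F) (A := A) (x := Relations.adE F A (i, j)) (by simp [Relations.toSet])
    rw [Relations.adE] at this
    simpa [hij, sE, sF] using this
  ff0 i j hij := by
    have := mkS_zero (F := F) (A := A) (x := Relations.adF F A (i, j)) (by simp [Relations.toSet])
    rw [Relations.adF] at this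
    simpa [hij, sE, sF] using this
  ff1 i j hij := by
    have := mkS_zero (F := F) (A := A) (x := Relations.adF F A (i, j)) (by simp [Relations.toSet])
    rw [Relations.adF] at this
    simpa [hij, sE, sF] using this

lemma free_gen (N : LieSubalgebra F (FreeLieAlgebra F (Generators ι)))
    (hN : ∀ g, FreeLieAlgebra.of F g ∈ N) : N = ⊤ := by
  let φ : FreeLieAlgebra F (Generators ι) →ₗ⁅F⁆ N :=
    FreeLieAlgebra.lift F (fun g => ⟨FreeLieAlgebra.of F g, hN g⟩)
  have : N.incl.comp φ = LieHom.id := by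
    apply FreeLieAlgebra.hom_ext
    intro g
    simp [φ]
  rw [eq_top_iff]
  intro x _
  have h2 : N.incl (φ x) = x := by
    have := congrArg (fun ψ : _ →ₗ⁅F⁆ _ => ψ x) this
    exact this
  rw [← h2]; exact (φ x).2

lemma gen_std : LieSubalgebra.lieSpan F (A.ToLieAlgebra F)
    (Set.range (sE F A) ∪ Set.range (sF F A)) = ⊤ := by
  set T := LieSubalgebra.lieSpan F (A.ToLieAlgebra F) (Set.range (sE F A) ∪ Set.range (sF F A))
  have hE : ∀ i, sE F A i ∈ T := fun i => LieSubalgebra.subset_lieSpan (Or.inl ⟨i, rfl⟩)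
  have hF : ∀ i, sF F A i ∈ T := fun i => LieSubalgebra.subset_lieSpan (Or.inr ⟨i, rfl⟩)
  have hH : ∀ i, sH F A i ∈ T := fun i => by
    rw [← serreSys_std.ef]; exact LieSubalgebra.lie_mem _ (hE i) (hF i)
  have := free_gen (T.comap (mkS F A)) (by
    rintro (i | i | i)
    · exact hH i
    · exact hE i
    · exact hF i)
  rw [eq_top_iff]
  intro x _
  obtain ⟨y, rfl⟩ := mkS_surj x
  have hy : y ∈ T.comap (mkS F A) := by rw [this]; exact LieSubalgebra.mem_top y
  exact hy

variable {M : Type} [LieRing M] [LieAlgebra F M]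

lemma exists_lift (hA : SLPD A) {h e f : ι → M} (s : SerreSys F A h e f) :
    ∃ φ : A.ToLieAlgebra F →ₗ⁅F⁆ M, (∀ i, φ (sH F A i) = h i) ∧ (∀ i, φ (sE F A i) = e i) ∧
      ∀ i, φ (sF F A i) = f i := by
  let g : Generators ι → M := fun g => match g with
    | .H i => h i
    | .E i => e i
    | .F i => f i
  let ψ := FreeLieAlgebra.lift F g
  have hψ : ∀ x, ψ (FreeLieAlgebra.of F x) = g x := fun x => FreeLieAlgebra.lift_of_apply g x
  have hcase : ∀ i j, i = j ∨ A i j = 0 ∨ A i j = -1 := fun i j => by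
    by_cases hij : i = j
    · exact Or.inl hij
    · exact Or.inr (hA.off i j hij)
  have hI : Relations.toIdeal F A ≤ ψ.ker := by
    rw [Relations.toIdeal, LieSubmodule.lieSpan_le]
    intro x hx
    show x ∈ ψ.ker
    rw [LieHom.mem_ker]
    rcases hx with ((((⟨⟨i, j⟩, rfl⟩ | ⟨⟨i, j⟩, rfl⟩) | ⟨⟨i, j⟩, rfl⟩) | ⟨⟨i, j⟩, rfl⟩) | ⟨⟨i, j⟩, rfl⟩) | ⟨⟨i, j⟩, rfl⟩
    · simp [Relations.HH, hψ, g, s.hh]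
    · simp only [Relations.EF, Function.uncurry_apply_pair]
      split_ifs with hij
      · simp [hψ, g, s.ef]
      · simp [hψ, g, s.ef0 i j hij]
    · simp [Relations.HE, hψ, g, s.he, Int.cast_smul_eq_zsmul]
    · simp [Relations.HF, hψ, g, s.hf, Int.cast_smul_eq_zsmul]
    · rcases hcase i j with rfl | hij | hij
      · simp [Relations.adE]
      · simp [Relations.adE, hij, hψ, g, s.ee0 i j hij]
      · simp [Relations.adE, hij, hψ, g, s.ee1 i j hij]
    · rcases hcase i j with rfl | hij | hij
      · simp [Relations.adF]
      · simp [Relations.adF, hij, hψ, g, s.ff0 i j hij]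
      · simp [Relations.adF, hij, hψ, g, s.ff1 i j hij]
  let φl : A.ToLieAlgebra F →ₗ[F] M :=
    Submodule.liftQ (Relations.toIdeal F A).toSubmodule (ψ : FreeLieAlgebra F (Generators ι) →ₗ[F] M)
      (fun x hx => by
        have := hI hx
        rw [LieHom.mem_ker] at this
        exact this)
  have hφl : ∀ x, φl (mkS F A x) = ψ x := fun x => rfl
  refine ⟨{ φl with
    map_lie' := by
      intro x y
      obtain ⟨x, rfl⟩ := mkS_surj x
      obtain ⟨y, rfl⟩ := mkS_surj y
      show φl ⁅mkS F A x, mkS F A y⁆ = ⁅φl (mkS F A x), φl (mkS F A y)⁆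
      rw [← LieHom.map_lie, hφl, hφl, hφl, LieHom.map_lie] }, ?_, ?_, ?_⟩
  · intro i; exact hψ (.H i)
  · intro i; exact hψ (.E i)
  · intro i; exact hψ (.F i)

theorem serre_equiv (hA : SLPD A) {h e f : ι → M} (s : SerreSys F A h e f)
    (gen : LieSubalgebra.lieSpan F M (Set.range e ∪ Set.range f) = ⊤)
    (li : LinearIndependent F h) : Nonempty (A.ToLieAlgebra F ≃ₗ⁅F⁆ M) := by
  obtain ⟨φ, h1, h2, h3⟩ := exists_lift hA s
  have inj : Function.Injective φ := by
    apply serreSys_std.injective_of_linInd hA gen_std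
    simpa only [h1] using li
  have surj : Function.Surjective φ := by
    have : φ.range = ⊤ := by
      rw [eq_top_iff, ← gen, LieSubalgebra.lieSpan_le]
      rintro _ (⟨i, rfl⟩ | ⟨i, rfl⟩)
      · exact ⟨sE F A i, h2 i⟩
      · exact ⟨sF F A i, h3 i⟩
    exact LieHom.range_eq_top _ |>.mp this
  exact ⟨LieEquiv.ofBijective φ ⟨inj, surj⟩⟩

end serre
end E8P

set_option linter.unusedSectionVars false
namespace E8P
open Matrix

section serre
variable {ι : Type} [Fintype ι] [DecidableEq ι] {F : Type} [Field F] [CharZero F]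
  {S : Type} [LieRing S] [LieAlgebra F S] {A : Matrix ι ι ℤ} {h e f : ι → S}

lemma cast_ker (hA : SLPD A) {c : ι → F} (hc : ∀ j, ∑ i, c i * ((A i j : ℤ) : F) = 0) : c = 0 := by
  have hd : (A.map (Int.castRingHom F)).det ≠ 0 := by
    rw [← RingHom.mapMatrix_apply, ← RingHom.map_det]
    simpa using det_ne hA
  apply Matrix.eq_zero_of_vecMul_eq_zero hd
  ext j
  simpa [Matrix.vecMul, dotProduct] using hc j

lemma SerreSys.span_lie_e (s : SerreSys F A h e f) (c : ι → F) (j : ι) :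
    ⁅∑ i, c i • h i, e j⁆ = (∑ i, c i * ((A i j : ℤ) : F)) • e j := by
  rw [sum_lie, Finset.sum_smul]
  exact Finset.sum_congr rfl fun i _ => by rw [smul_lie, s.he, smul_smul]

lemma SerreSys.linInd (hA : SLPD A) (s : SerreSys F A h e f) (he : ∀ i, e i ≠ 0) :
    LinearIndependent F h := by
  rw [Fintype.linearIndependent_iff]
  intro c hc
  have : c = 0 := by
    apply cast_ker hA
    intro j
    have := s.span_lie_e c j
    rw [hc, zero_lie] at this
    exact (smul_eq_zero.mp this.symm).resolve_right (he j)
  simp [this]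

lemma SerreSys.no_abelian (hA : SLPD A) (s : SerreSys F A h e f)
    (gen : LieSubalgebra.lieSpan F S (Set.range e ∪ Set.range f) = ⊤) (he : ∀ i, e i ≠ 0)
    (I : LieIdeal F S) (hab : IsLieAbelian I) : I = ⊥ := by
  have li := s.linInd hA he
  have ab : ∀ x ∈ I, ∀ y ∈ I, ⁅x, y⁆ = 0 := by
    intro x hx y hy
    have := hab.trivial ⟨x, hx⟩ ⟨y, hy⟩
    simpa using congrArg Subtype.val this
  have hst : ∀ (z : S), ∀ x ∈ I, ⁅z, x⁆ ∈ I :=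
    fun z x hx => lie_mem_right F S I z x hx
  have key : ∀ x ∈ Submodule.span F (Set.range h), x ∈ I → x = 0 := by
    intro x hx hI
    obtain ⟨c, rfl⟩ := (Submodule.mem_span_range_iff_exists_fun F).mp hx
    suffices c = 0 by simp [this]
    apply cast_ker hA
    intro j
    by_contra hne
    have h1 := hst (e j) _ hI
    rw [← lie_skew, s.span_lie_e, neg_mem_iff] at h1
    have h2 : e j ∈ I := by
      have := I.smul_mem (∑ i, c i * ((A i j : ℤ) : F))⁻¹ h1
      rwa [smul_smul, inv_mul_cancel₀ hne, one_smul] at this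
    have h3 : h j ∈ I := by
      have := hst (f j) _ h2
      rwa [s.fe, neg_mem_iff] at this
    have := ab _ h3 _ h2
    rw [s.he, hA.diag] at this
    exact he j ((smul_eq_zero.mp this).resolve_left (by norm_num))
  exact s.ideal_bot hA gen I key fun i hi =>
    li.ne_zero i (key _ (Submodule.subset_span ⟨i, rfl⟩) hi)

lemma SerreSys.isKilling (hA : SLPD A) (s : SerreSys F A h e f)
    (gen : LieSubalgebra.lieSpan F S (Set.range e ∪ Set.range f) = ⊤) (he : ∀ i, e i ≠ 0) :
    LieAlgebra.IsKilling F S := by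
  have := s.finite hA gen
  have : LieAlgebra.HasTrivialRadical F S :=
    LieAlgebra.hasTrivialRadical_iff_no_abelian_ideals F S |>.mpr (s.no_abelian hA gen he)
  infer_instance

lemma SerreSys.span_lie_Wt (v : ι → ℤ) (c : ι → F) {x : S}
    (hx : x ∈ Wt F A h v) :
    ⁅∑ i, c i • h i, x⁆ = (∑ i, c i * (((A *ᵥ v) i : ℤ) : F)) • x := by
  rw [sum_lie, Finset.sum_smul]
  exact Finset.sum_congr rfl fun i _ => by rw [smul_lie, hx i, smul_smul]

/-- The standard Cartan subalgebra. -/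
def Hst (F : Type) [Field F] {S : Type} [LieRing S] [LieAlgebra F S]
    (A : Matrix ι ι ℤ) (h : ι → S) : LieSubalgebra F S where
  __ := Wt F A h 0
  lie_mem' := by
    intro x y hx hy i
    have hx := hx i
    have hy := hy i
    simp only [mulVec_zero, Pi.zero_apply, Int.cast_zero, zero_smul] at *
    rw [leibniz_lie, hx, hy]; simp

lemma mem_Hst {x : S} : x ∈ Hst F A h ↔ x ∈ Wt F A h 0 := Iff.rfl

lemma SerreSys.mem_Hst_iff (hA : SLPD A) (s : SerreSys F A h e f)
    (gen : LieSubalgebra.lieSpan F S (Set.range e ∪ Set.range f) = ⊤) {x : S} :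
    x ∈ Hst F A h ↔ ∃ c : ι → F, ∑ i, c i • h i = x := by
  rw [mem_Hst, s.Wt_zero hA gen, Submodule.mem_span_range_iff_exists_fun]

lemma SerreSys.hst_abelian (hA : SLPD A) (s : SerreSys F A h e f)
    (gen : LieSubalgebra.lieSpan F S (Set.range e ∪ Set.range f) = ⊤) {x y : S}
    (hx : x ∈ Hst F A h) (hy : y ∈ Hst F A h) : ⁅x, y⁆ = 0 := by
  obtain ⟨c, rfl⟩ := (s.mem_Hst_iff hA gen).mp hx
  rw [SerreSys.span_lie_Wt 0 c hy]
  simp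

lemma SerreSys.hst_cartan (hA : SLPD A) (s : SerreSys F A h e f)
    (gen : LieSubalgebra.lieSpan F S (Set.range e ∪ Set.range f) = ⊤) :
    (Hst F A h).IsCartanSubalgebra where
  nilpotent := by
    have : IsLieAbelian (Hst F A h) := ⟨fun x y => Subtype.ext (s.hst_abelian hA gen x.2 y.2)⟩
    infer_instance
  self_normalizing := by
    apply le_antisymm _ (LieSubalgebra.le_normalizer _)
    intro x hx
    rw [LieSubalgebra.mem_normalizer_iff] at hx
    have hh : ∀ i, h i ∈ Hst F A h := fun i => (s.h_mem i)
    intro i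
    simp only [mulVec_zero, Pi.zero_apply, Int.cast_zero, zero_smul]
    obtain ⟨t, y, hy, hxy⟩ := s.decomp gen x
    -- [h i, x] lies in weight zero, and every component with nonzero weight vanishes
    have hz : ⁅h i, x⁆ ∈ Hst F A h := by
      rw [← lie_skew]; exact neg_mem (hx _ (hh i))
    have key := comp_mem (h := h) hA (Wt F A h 0) (fun j z hz => by
      rw [s.hst_abelian hA gen (hh j) hz]; exact zero_mem _) t (fun v => ⁅h i, y v⁆)
      (fun v _ => by
        have := s.Tot_le v (hy v) i
        rw [this]
        exact Submodule.smul_mem _ _ (s.Tot_le v (hy v))) (by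
        rw [← lie_sum, ← hxy]; exact hz)
    rw [hxy, lie_sum]
    apply Finset.sum_eq_zero
    intro v hv
    have h1 := key v hv i
    have h2 := s.Tot_le v (hy v) i
    simp only [mulVec_zero, Pi.zero_apply, Int.cast_zero, zero_smul] at h1
    rw [h2, lie_smul, h2, smul_smul] at h1
    rw [h2]
    rcases smul_eq_zero.mp h1 with h3 | h3
    · rw [mul_self_eq_zero.mp h3, zero_smul]
    · rw [h3, smul_zero]

end serre

section e8
variable {F : Type} [Field F] [CharZero F]

lemma e8_bf (v : Fin 8 → ℤ) : 60 * bf CartanMatrix.E₈ v v = 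
    60 * (v 0 * (2 * v 0 - v 2) + v 1 * (2 * v 1 - v 3) + v 2 * (2 * v 2 - v 0 - v 3) +
     v 3 * (2 * v 3 - v 1 - v 2 - v 4) + v 4 * (2 * v 4 - v 3 - v 5) + v 5 * (2 * v 5 - v 4 - v 6) +
     v 6 * (2 * v 6 - v 5 - v 7) + v 7 * (2 * v 7 - v 6)) := by
  simp [bf, CartanMatrix.E₈, mulVec, dotProduct, Fin.sum_univ_eight]
  ring

lemma e8_slpd : SLPD CartanMatrix.E₈ where
  symm := by intro i j; fin_cases i <;> fin_cases j <;> rfl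
  diag := by decide
  off := by intro i j; fin_cases i <;> fin_cases j <;> decide
  pos := by
    intro v hv
    have h := e8_bf v
    have key : 60 * bf CartanMatrix.E₈ v v = 30*(2*v 0-v 2)^2+10*(3*v 2-2*v 3)^2+30*(2*v 1-v 3)^2
      +2*(5*v 3-6*v 4)^2+3*(4*v 4-5*v 5)^2+5*(3*v 5-4*v 6)^2+10*(2*v 6-3*v 7)^2+30*v 7^2 := by
      rw [h]; ring
    by_contra hle
    have hle : 60 * bf CartanMatrix.E₈ v v ≤ 0 := by omega
    rw [key] at hle
    have n0 := sq_nonneg (2*v 0-v 2)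
    have n1 := sq_nonneg (3*v 2-2*v 3)
    have n2 := sq_nonneg (2*v 1-v 3)
    have n3 := sq_nonneg (5*v 3-6*v 4)
    have n4 := sq_nonneg (4*v 4-5*v 5)
    have n5 := sq_nonneg (3*v 5-4*v 6)
    have n6 := sq_nonneg (2*v 6-3*v 7)
    have n7 := sq_nonneg (v 7)
    have m0 : 2*v 0-v 2 = 0 := pow_eq_zero_iff (two_ne_zero) |>.mp (by linarith)
    have m1 : 3*v 2-2*v 3 = 0 := pow_eq_zero_iff (two_ne_zero) |>.mp (by linarith)
    have m2 : 2*v 1-v 3 = 0 := pow_eq_zero_iff (two_ne_zero) |>.mp (by linarith)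
    have m3 : 5*v 3-6*v 4 = 0 := pow_eq_zero_iff (two_ne_zero) |>.mp (by linarith)
    have m4 : 4*v 4-5*v 5 = 0 := pow_eq_zero_iff (two_ne_zero) |>.mp (by linarith)
    have m5 : 3*v 5-4*v 6 = 0 := pow_eq_zero_iff (two_ne_zero) |>.mp (by linarith)
    have m6 : 2*v 6-3*v 7 = 0 := pow_eq_zero_iff (two_ne_zero) |>.mp (by linarith)
    have m7 : v 7 = 0 := pow_eq_zero_iff (two_ne_zero) |>.mp (by linarith)
    apply hv
    ext i
    fin_cases i <;> simp <;> omega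

/-- If the algebra is nontrivial, no generator vanishes. -/
lemma e8_e_ne (hnt : Nontrivial (LieAlgebra.e₈ F)) (i : Fin 8) : sE F CartanMatrix.E₈ i ≠ 0 := by
  have s := serreSys_std (F := F) (A := CartanMatrix.E₈)
  have step : ∀ i j, CartanMatrix.E₈ i j = -1 → sE F CartanMatrix.E₈ i = 0 →
      sE F CartanMatrix.E₈ j = 0 := by
    intro i j hij h0
    have h1 : sH F CartanMatrix.E₈ i = 0 := by rw [← s.ef, h0, zero_lie]
    have h2 := s.he i j
    rw [h1, zero_lie, hij] at h2
    simpa using h2.symm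
  intro h0
  have h3 : sE F CartanMatrix.E₈ 3 = 0 := by
    have a01 := step 0 2 (by decide)
    have a02 := step 2 3 (by decide)
    have a03 := step 1 3 (by decide)
    have a04 := step 7 6 (by decide)
    have a05 := step 6 5 (by decide)
    have a06 := step 5 4 (by decide)
    have a07 := step 4 3 (by decide)
    fin_cases i
    · exact a02 (a01 h0)
    · exact a03 h0
    · exact a02 h0
    · exact h0
    · exact a07 h0
    · exact a07 (a06 h0)
    · exact a07 (a06 (a05 h0))
    · exact a07 (a06 (a05 (a04 h0)))
  have all : ∀ i, sE F CartanMatrix.E₈ i = 0 := by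
    have a01 := step 2 0 (by decide)
    have a02 := step 3 2 (by decide)
    have a03 := step 3 1 (by decide)
    have a04 := step 6 7 (by decide)
    have a05 := step 5 6 (by decide)
    have a06 := step 4 5 (by decide)
    have a07 := step 3 4 (by decide)
    intro i
    fin_cases i
    · exact a01 (a02 h3)
    · exact a03 h3
    · exact a02 h3
    · exact h3
    · exact a07 h3
    · exact a06 (a07 h3)
    · exact a05 (a06 (a07 h3))
    · exact a04 (a05 (a06 (a07 h3)))
  have hall : ∀ i, sH F CartanMatrix.E₈ i = 0 := fun i => by rw [← s.ef, all, zero_lie]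
  have fall : ∀ i, sF F CartanMatrix.E₈ i = 0 := fun i => by
    have h2 := s.hf i i
    rw [hall, zero_lie, e8_slpd.diag] at h2
    exact (smul_eq_zero.mp h2.symm).resolve_left (by norm_num)
  have g := gen_std (F := F) (A := CartanMatrix.E₈)
  have : (⊤ : LieSubalgebra F (LieAlgebra.e₈ F)) ≤ ⊥ := by
    refine (le_of_eq (Eq.symm g)).trans ?_
    rw [LieSubalgebra.lieSpan_le]
    rintro _ (⟨i, rfl⟩ | ⟨i, rfl⟩)
    · rw [all]; exact zero_mem _
    · rw [fall]; exact zero_mem _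
  obtain ⟨x, hx⟩ := exists_ne (0 : LieAlgebra.e₈ F)
  exact hx ((LieSubalgebra.mem_bot x).mp (this (LieSubalgebra.mem_top x)))

end e8
end E8P

set_option linter.unusedSectionVars false
namespace E8P
open Matrix

section dominant
open MvPolynomial
variable {F : Type} [Field F] [IsAlgClosed F] {κ : Type} [Fintype κ] [DecidableEq κ]

/-- Any prime ideal of a finitely generated algebra over an algebraically closed field is contained
in the kernel of a point. -/
lemma exists_point (B : Type) [CommRing B] [Algebra F B] [Algebra.FiniteType F B]
    (P : Ideal B) (hP : P ≠ ⊤) : ∃ g : B →ₐ[F] F, ∀ b ∈ P, g b = 0 := by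
  obtain ⟨M, hM, hPM⟩ := Ideal.exists_le_maximal P hP
  letI : Field (B ⧸ M) := Ideal.Quotient.field M
  have : Algebra.FiniteType F (B ⧸ M) := inferInstance
  have : Module.Finite F (B ⧸ M) := finite_of_finite_type_of_isJacobsonRing F (B ⧸ M)
  have hb : Function.Bijective (algebraMap F (B ⧸ M)) :=
    IsAlgClosed.algebraMap_bijective_of_isIntegral
  let e : F ≃ₐ[F] (B ⧸ M) := AlgEquiv.ofBijective (Algebra.ofId F (B ⧸ M)) hb
  refine ⟨(e.symm : (B ⧸ M) →ₐ[F] F).comp (Ideal.Quotient.mkₐ F M), fun b hb => ?_⟩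
  have : Ideal.Quotient.mkₐ F M b = 0 := by
    rw [Ideal.Quotient.mkₐ_eq_mk]; exact Ideal.Quotient.eq_zero_iff_mem.mpr (hPM hb)
  rw [AlgHom.comp_apply, this, map_zero]

lemma dom_aux {R S : Type} [CommRing R] [CommRing S] [Algebra R S]
    (P : Algebra.PreSubmersivePresentation R S κ κ) (r : S) :
    IsUnit (algebraMap S (Localization.Away (P.jacobian * r)) r) ∧
    Algebra.FiniteType R (Localization.Away (P.jacobian * r)) ∧
    IsOpenMap (PrimeSpectrum.comap (algebraMap R (Localization.Away (P.jacobian * r)))) := by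
  let Q := Algebra.PreSubmersivePresentation.localizationAway
    (Localization.Away (P.jacobian * r)) (P.jacobian * r)
  have hd : IsUnit (algebraMap S (Localization.Away (P.jacobian * r)) (P.jacobian * r)) :=
    IsLocalization.Away.algebraMap_isUnit (P.jacobian * r)
  have hd' := hd
  rw [map_mul] at hd'
  have hu := isUnit_of_mul_isUnit_left hd'
  have hu' := isUnit_of_mul_isUnit_right hd'
  have hjac : IsUnit (Q.comp P).jacobian := by
    rw [Algebra.PreSubmersivePresentation.comp_jacobian_eq_jacobian_smul_jacobian,
      Algebra.smul_def, Algebra.PreSubmersivePresentation.localizationAway_jacobian]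
    exact hu.mul hd
  have hsm : Algebra.IsStandardSmooth R (Localization.Away (P.jacobian * r)) :=
    Algebra.SubmersivePresentation.isStandardSmooth ⟨Q.comp P, hjac⟩
  exact ⟨hu', inferInstance,
    PrimeSpectrum.isOpenMap_comap_of_hasGoingDown_of_finitePresentation⟩

/-- The relations defining the graph of a polynomial map. -/
noncomputable abbrev grel (φ : κ → MvPolynomial κ F) : κ → MvPolynomial κ (MvPolynomial κ F) :=
  fun j => map C (φ j) - C (X j)

/-- The coordinate ring of the graph of a polynomial map. -/
abbrev Graph (φ : κ → MvPolynomial κ F) : Type :=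
  MvPolynomial κ (MvPolynomial κ F) ⧸ (Ideal.span <| Set.range (grel φ))

lemma dominant_abs (φ : κ → MvPolynomial κ F) (r : MvPolynomial κ F)
    (S : Type) [CommRing S] [Algebra (MvPolynomial κ F) S]
    (P : Algebra.PreSubmersivePresentation (MvPolynomial κ F) S κ κ)
    (gm : MvPolynomial κ (MvPolynomial κ F) →+* S)
    (hC : ∀ a, gm (C a) = algebraMap (MvPolynomial κ F) S a)
    (hv : ∀ j, gm (grel φ j) = 0) (ev' : S →+* F)
    (hdev : ev' (P.jacobian * gm (map C r)) ≠ 0) :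
    ∃ q : MvPolynomial κ F, q ≠ 0 ∧ ∀ y, eval y q ≠ 0 →
      ∃ x, eval x r ≠ 0 ∧ ∀ j, eval x (φ j) = y j := by
  obtain ⟨hu', hfp, hopen⟩ := dom_aux P (gm (map C r))
  have hT : Nontrivial (Localization.Away (P.jacobian * gm (map C r))) :=
    (IsLocalization.Away.lift (S := (Localization.Away (P.jacobian * gm (map C r)))) (P.jacobian * gm (map C r)) (g := ev') (IsUnit.mk0 _ hdev)).domain_nontrivial
  obtain ⟨P0⟩ : Nonempty (PrimeSpectrum (Localization.Away (P.jacobian * gm (map C r)))) := inferInstance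
  have hro := hopen.isOpen_range
  obtain ⟨U, ⟨q, rfl⟩, hq1, hq2⟩ := (PrimeSpectrum.isTopologicalBasis_basic_opens (R := MvPolynomial κ F)).exists_subset_of_mem_open
    (⟨P0, rfl⟩ : PrimeSpectrum.comap (algebraMap (MvPolynomial κ F) (Localization.Away (P.jacobian * gm (map C r)))) P0 ∈ Set.range _) hro
  refine ⟨q, ?_, fun y hy => ?_⟩
  · rintro rfl
    simp at hq1
  · let my : PrimeSpectrum (MvPolynomial κ F) := ⟨RingHom.ker (eval y), RingHom.ker_isPrime _⟩
    have hmy : my ∈ (PrimeSpectrum.basicOpen q : Set (PrimeSpectrum (MvPolynomial κ F))) := by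
      show q ∉ RingHom.ker (eval y)
      simpa [RingHom.mem_ker] using hy
    obtain ⟨N, hN⟩ := hq2 hmy
    have hNR : ∀ a : (MvPolynomial κ F), eval y a = 0 → algebraMap (MvPolynomial κ F) (Localization.Away (P.jacobian * gm (map C r))) a ∈ N.asIdeal := by
      intro a ha
      have : a ∈ my.asIdeal := ha
      rw [← hN] at this
      exact this
    have : Algebra.FiniteType (MvPolynomial κ F) (Localization.Away (P.jacobian * gm (map C r))) := inferInstance
    letI : Algebra F (Localization.Away (P.jacobian * gm (map C r))) :=
      ((algebraMap (MvPolynomial κ F) (Localization.Away (P.jacobian * gm (map C r)))).comp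
        C).toAlgebra
    have : IsScalarTower F (MvPolynomial κ F) (Localization.Away (P.jacobian * gm (map C r))) :=
      IsScalarTower.of_algebraMap_eq fun _ => rfl
    have : Algebra.FiniteType F (Localization.Away (P.jacobian * gm (map C r))) := Algebra.FiniteType.trans (S := MvPolynomial κ F) inferInstance inferInstance
    obtain ⟨g, hg⟩ := exists_point (F := F) (Localization.Away (P.jacobian * gm (map C r))) N.asIdeal N.isPrime.ne_top
    let ψ : MvPolynomial κ (MvPolynomial κ F) →+* F := (g : (Localization.Away (P.jacobian * gm (map C r))) →+* F).comp ((algebraMap S (Localization.Away (P.jacobian * gm (map C r)))).comp gm)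
    let x : κ → F := fun i => ψ (X i)
    have hψC : ∀ a : (MvPolynomial κ F), ψ (C a) = eval y a := by
      intro a
      have h1 : ψ (C (a - C (eval y a))) = 0 := by
        show g (algebraMap S _ (gm (C (a - C (eval y a))))) = 0
        rw [hC, ← IsScalarTower.algebraMap_apply (MvPolynomial κ F) S]
        exact hg _ (hNR _ (by simp))
      rw [map_sub, map_sub, sub_eq_zero] at h1
      rw [h1]
      show g (algebraMap S _ (gm (C (C (eval y a))))) = eval y a
      rw [hC, ← IsScalarTower.algebraMap_apply (MvPolynomial κ F) S]
      exact g.commutes _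
    have hψ : ∀ a : MvPolynomial κ F, ψ (map C a) = eval x a := by
      intro a
      have : ψ.comp (map C) = eval x := by
        apply MvPolynomial.ringHom_ext
        · intro c; simp [hψC]
        · intro i; simp [x]
      exact congrArg (fun f : MvPolynomial κ F →+* F => f a) this
    refine ⟨x, ?_, fun j => ?_⟩
    · rw [← hψ]
      exact (hu'.map (g : (Localization.Away (P.jacobian * gm (map C r))) →+* F)).ne_zero
    · have h0 : ψ (grel φ j) = 0 := by
        show g (algebraMap S (Localization.Away (P.jacobian * gm (map C r))) (gm (grel φ j))) = 0
        rw [hv, map_zero, map_zero]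
      rw [map_sub, hψ, hψC, sub_eq_zero] at h0
      simpa using h0

theorem dominant (φ : κ → MvPolynomial κ F) (r : MvPolynomial κ F) (p : κ → F)
    (hr : eval p r ≠ 0)
    (hJ : (Matrix.of fun i j => eval p (pderiv i (φ j))).det ≠ 0) :
    ∃ q : MvPolynomial κ F, q ≠ 0 ∧ ∀ y, eval y q ≠ 0 →
      ∃ x, eval x r ≠ 0 ∧ ∀ j, eval x (φ j) = y j := by
  let P : Algebra.PreSubmersivePresentation (MvPolynomial κ F) (Graph φ) κ κ :=
    Algebra.PreSubmersivePresentation.naive (v := grel φ) id Function.injective_id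
  let gm : MvPolynomial κ (MvPolynomial κ F) →+* Graph φ := Ideal.Quotient.mk _
  -- the evaluation at `p`
  let ev : MvPolynomial κ (MvPolynomial κ F) →+* F := eval₂Hom (eval fun j => eval p (φ j)) p
  have evm : ∀ a : MvPolynomial κ F, ev (map C a) = eval p a := by
    intro a
    simp only [ev, coe_eval₂Hom, eval₂_map]
    rw [show (eval fun j => eval p (φ j)).comp C = RingHom.id F by ext; simp]
    simp [eval₂_id]
  have hker : ∀ a ∈ Ideal.span (Set.range (grel φ)), ev a = 0 := by
    intro a ha
    have : Ideal.span (Set.range (grel φ)) ≤ RingHom.ker ev := by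
      rw [Ideal.span_le]
      rintro _ ⟨j, rfl⟩
      show ev (grel φ j) = 0
      rw [map_sub, evm]
      simp [ev]
    exact this ha
  let ev' : (Graph φ) →+* F := Ideal.Quotient.lift _ ev hker
  have hdev : ev' (P.jacobian * gm (map C r)) ≠ 0 := by
    rw [map_mul]
    refine mul_ne_zero ?_ ?_
    · rw [Algebra.PreSubmersivePresentation.jacobian_eq_jacobiMatrix_det]
      have h1 : ev' (algebraMap P.Ring (Graph φ) P.jacobiMatrix.det) = ev P.jacobiMatrix.det := rfl
      rw [h1, RingHom.map_det]
      convert hJ using 2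
      ext i j
      rw [RingHom.mapMatrix_apply, Matrix.map_apply]
      have h2 : P.jacobiMatrix i j = pderiv i (grel φ j) :=
        Algebra.PreSubmersivePresentation.jacobiMatrix_naive _ _ _ _ i j
      rw [h2]
      have h3 : pderiv i (grel φ j) = map C (pderiv i (φ j)) := by
        simp only [grel, map_sub, pderiv_map, pderiv_C, sub_zero]
      rw [h3, evm]; rfl
    · show ev (map C r) ≠ 0
      rw [evm]; exact hr
  exact dominant_abs φ r (Graph φ) P gm (fun a => rfl)
    (fun j => Ideal.Quotient.eq_zero_iff_mem.mpr (Ideal.subset_span ⟨j, rfl⟩)) ev' hdev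

end dominant
end E8P

set_option linter.unusedSectionVars false
namespace E8P
open Matrix

section cartan
variable {F : Type} [Field F] [CharZero F] {L : Type} [LieRing L] [LieAlgebra F L]

lemma exists_exp (x : L) (N : ℕ) (hN : (LieAlgebra.ad F L x) ^ N = 0) :
    ∃ g : L ≃ₗ⁅F⁆ L, ∀ y, g y = ∑ m ∈ Finset.range N,
      ((m.factorial : F)⁻¹) • ((LieAlgebra.ad F L x) ^ m) y := by
  letI : Module ℚ L := Module.compHom L (algebraMap ℚ F)
  have hsm : ∀ (q : ℚ) (y : L), q • y = (q : F) • y := fun q y => by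
    show (algebraMap ℚ F q) • y = _
    simp
  letI : LieAlgebra ℚ L := { lie_smul := fun t x y => by rw [hsm, hsm, lie_smul] }
  have hh : (LieDerivation.ad F L x).toLinearMap = LieAlgebra.ad F L x := by
    ext y
    exact LieDerivation.ad_apply_apply F L x y
  have hn : IsNilpotent (LieDerivation.ad F L x).toLinearMap := ⟨N, by rw [hh, hN]⟩
  refine ⟨(LieDerivation.ad F L x).exp hn, fun y => ?_⟩
  rw [LieDerivation.exp_map_apply, hh, IsNilpotent.exp_eq_sum (k := N) hN]
  rw [LinearMap.sum_apply]
  refine Finset.sum_congr rfl fun m _ => ?_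
  rw [LinearMap.smul_apply, hsm]
  push_cast
  rfl

/-- A basis adapted to a Cartan subalgebra. -/
structure Adapted (H : LieSubalgebra F L) {κ : Type} (b : Module.Basis κ F L)
    (s : κ → Prop) (α : κ → H →ₗ[F] F) : Prop where
  lie : ∀ k (x : H), ⁅(x : L), b k⁆ = α k x • b k
  mem : ∀ k, s k → b k ∈ H
  nil : ∀ k, ¬ s k → IsNilpotent (LieAlgebra.ad F L (b k))
  ne : ∀ k, ¬ s k → ∃ x, α k x ≠ 0
  z : ∀ k, s k → α k = 0

lemma exists_adapted [IsAlgClosed F] [Module.Finite F L] [LieAlgebra.IsKilling F L]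
    (H : LieSubalgebra F L) [H.IsCartanSubalgebra] :
    ∃ (κ : Type) (_ : Fintype κ) (b : Module.Basis κ F L) (s : κ → Prop) (α : κ → H →ₗ[F] F),
      Adapted H b s α := by
  let S : Set L := {x | ∃ χ : LieModule.Weight F H L, x ∈ LieAlgebra.rootSpace H χ}
  have hS : ⊤ ≤ Submodule.span F S := by
    have := LieModule.iSup_genWeightSpace_eq_top' F H L
    rw [← LieSubmodule.toSubmodule_inj, LieSubmodule.iSup_toSubmodule,
      LieSubmodule.top_toSubmodule] at this
    rw [← this]
    exact iSup_le fun χ => fun x hx => Submodule.subset_span ⟨χ, hx⟩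
  let b := Module.Basis.ofSpan hS
  have hb : ∀ k, ∃ χ : LieModule.Weight F H L, b k ∈ LieAlgebra.rootSpace H χ :=
    fun k => Module.Basis.ofSpan_subset hS ⟨k, rfl⟩
  choose χ hχ using hb
  have : Finite ((linearIndepOn_empty F (id : L → L)).extend (Set.empty_subset S)) :=
    Module.Finite.finite_basis b
  refine ⟨_, Fintype.ofFinite _, b, fun k => (χ k).IsZero, fun k => (χ k).toLinear, ?_, ?_, ?_, ?_, ?_⟩
  · intro k x
    exact LieAlgebra.IsKilling.lie_eq_smul_of_mem_rootSpace (hχ k) x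
  · intro k hk
    have := hχ k
    rw [hk] at this
    rw [LieAlgebra.rootSpace_zero_eq] at this
    exact this
  · intro k hk
    exact LieAlgebra.isNilpotent_ad_of_mem_rootSpace H hk (hχ k)
  · intro k hk
    by_contra hc
    push Not at hc
    exact hk (funext hc)
  · intro k hk
    ext x
    exact congrFun hk x

variable {H : LieSubalgebra F L} {κ : Type} [Fintype κ] {b : Module.Basis κ F L}
    {s : κ → Prop} {α : κ → H →ₗ[F] F}

lemma Adapted.lie_eq (ad : Adapted H b s α) (x : H) (z : L) :
    ⁅(x : L), z⁆ = ∑ k, (α k x * b.repr z k) • b k := by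
  conv_lhs => rw [← b.sum_repr z]
  rw [lie_sum]
  refine Finset.sum_congr rfl fun k _ => ?_
  rw [lie_smul, ad.lie, smul_smul, mul_comm]

lemma Adapted.lie_repr (ad : Adapted H b s α) (x : H) (z : L) (k : κ) :
    b.repr ⁅(x : L), z⁆ k = α k x * b.repr z k := by
  rw [ad.lie_eq]
  classical
  simp [Finsupp.single_apply]

lemma Adapted.mem_of (ad : Adapted H b s α) {z : L} (hz : ∀ k, ¬ s k → b.repr z k = 0) :
    z ∈ H := by
  rw [← b.sum_repr z]
  refine sum_mem fun k _ => ?_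
  by_cases hk : s k
  · exact H.smul_mem _ (ad.mem k hk)
  · rw [hz k hk, zero_smul]; exact zero_mem _

lemma Adapted.exists_reg (ad : Adapted H b s α) : ∃ x : H, ∀ k, ¬ s k → α k x ≠ 0 := by
  obtain ⟨x, hx⟩ := Module.Dual.exists_forall_ne_zero_of_forall_exists
    (fun k : {k // ¬ s k} => (α k : Module.Dual F H)) (fun k => ad.ne k k.2)
  exact ⟨x, fun k hk => hx ⟨k, hk⟩⟩

lemma Adapted.reg_iff (ad : Adapted H b s α) (hab : ∀ x ∈ H, ∀ y ∈ H, ⁅x, y⁆ = 0)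
    (x : H) (hx : ∀ k, ¬ s k → α k x ≠ 0) (z : L) : ⁅(x : L), z⁆ = 0 ↔ z ∈ H := by
  refine ⟨fun h => ad.mem_of fun k hk => ?_, fun h => hab _ x.2 _ h⟩
  have := ad.lie_repr x z k
  rw [h] at this
  simpa [hx k hk] using this.symm

lemma Adapted.repr_eq_zero (ad : Adapted H b s α) (hab : ∀ x ∈ H, ∀ y ∈ H, ⁅x, y⁆ = 0)
    {z : L} (hz : z ∈ H) (k : κ) (hk : ¬ s k) : b.repr z k = 0 := by
  obtain ⟨x, hx⟩ := ad.ne k hk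
  have := ad.lie_repr x z k
  rw [hab _ x.2 _ hz] at this
  simpa [hx] using this.symm


section poly
open MvPolynomial
variable [DecidableEq κ]

/-- Polynomial matrix of the exponential. -/
noncomputable def Ek (M : Matrix κ κ F) (N : ℕ) (k : κ) : Matrix κ κ (MvPolynomial κ F) :=
  Matrix.of fun i j => ∑ m ∈ Finset.range N, C ((m.factorial : F)⁻¹ * (M ^ m) i j) * X k ^ m

lemma eval_Ek (M : Matrix κ κ F) (N : ℕ) (k : κ) (v : κ → F) (i j : κ) :
    eval v (Ek M N k i j) = ∑ m ∈ Finset.range N, (m.factorial : F)⁻¹ * (M ^ m) i j * v k ^ m := by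
  simp [Ek]

lemma eval_Ek_zero (M : Matrix κ κ F) (N : ℕ) (k : κ) (v : κ → F) (hv : v k = 0) (i j : κ) :
    eval v (Ek M (N + 2) k i j) = (1 : Matrix κ κ F) i j := by
  rw [eval_Ek, Finset.sum_eq_single 0]
  · simp
  · intro m _ hm; simp [hv, hm]
  · simp

lemma pderiv_Ek_zero (M : Matrix κ κ F) (N : ℕ) (k : κ) (v : κ → F) (hv : v k = 0) (l i j : κ) :
    eval v (pderiv l (Ek M (N + 2) k i j)) = if l = k then M i j else 0 := by
  rw [Ek, Matrix.of_apply, map_sum, map_sum, Finset.sum_eq_single 1]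
  · by_cases h : l = k
    · subst h; simp
    · simp [h, pderiv_X_of_ne (Ne.symm h)]
  · intro m _ hm
    rw [pderiv_C_mul, pderiv_pow]
    by_cases hm0 : m = 0
    · simp [hm0]
    · have : m - 1 ≠ 0 := by omega
      simp [hv, this]
  · intro h; simp at h

/-- The coordinates of the polynomial map. -/
noncomputable def wv (M : κ → Matrix κ κ F) (N : ℕ) (w0 : κ → MvPolynomial κ F) :
    List κ → κ → MvPolynomial κ F
  | [] => w0
  | k :: l => Ek (M k) N k *ᵥ wv M N w0 l

lemma eval_wv (M : κ → Matrix κ κ F) (N : ℕ) (w0 : κ → MvPolynomial κ F) (p : κ → F)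
    (l : List κ) (hl : ∀ k ∈ l, p k = 0) (j : κ) :
    eval p (wv M (N + 2) w0 l j) = eval p (w0 j) := by
  induction l generalizing j with
  | nil => rfl
  | cons k l ih =>
    have ih := ih fun k hk => hl k (List.mem_cons_of_mem _ hk)
    simp only [wv, mulVec, dotProduct, map_sum, map_mul, ih,
      eval_Ek_zero (M k) N k p (hl k List.mem_cons_self)]
    simp [Matrix.one_apply]

lemma pderiv_wv (M : κ → Matrix κ κ F) (N : ℕ) (w0 : κ → MvPolynomial κ F) (p : κ → F)
    (l : List κ) (hl : ∀ k ∈ l, p k = 0) (hn : l.Nodup) (i j : κ) :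
    eval p (pderiv i (wv M (N + 2) w0 l j)) = eval p (pderiv i (w0 j)) +
      if i ∈ l then (M i *ᵥ fun t => eval p (w0 t)) j else 0 := by
  induction l generalizing j with
  | nil => simp [wv]
  | cons k l ih =>
    have hl' : ∀ k ∈ l, p k = 0 := fun k hk => hl k (List.mem_cons_of_mem _ hk)
    have ih := ih hl' hn.of_cons
    simp only [wv, mulVec, dotProduct, map_sum, Derivation.leibniz, smul_eq_mul, map_add, map_mul,
      eval_wv M N w0 p l hl', eval_Ek_zero (M k) N k p (hl k List.mem_cons_self),
      pderiv_Ek_zero (M k) N k p (hl k List.mem_cons_self), ih]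
    rw [Finset.sum_add_distrib]
    have h1 : ∑ t, (1 : Matrix κ κ F) j t * (eval p (pderiv i (w0 t)) + 
        if i ∈ l then (∑ x, M i t x * eval p (w0 x)) else 0) = eval p (pderiv i (w0 j)) + 
        if i ∈ l then (∑ x, M i j x * eval p (w0 x)) else 0 := by
      simp [Matrix.one_apply]
    rw [h1, add_assoc]
    congr 1
    by_cases hik : i = k
    · subst hik
      have : i ∉ l := (List.nodup_cons.mp hn).1
      simp [this, mul_comm]
    · simp [hik]

lemma exists_wv (b : Module.Basis κ F L) (N : ℕ) (w0 : κ → MvPolynomial κ F) (v : κ → F)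
    (l : List κ) (hl : ∀ k ∈ l, (LieAlgebra.ad F L (b k)) ^ N = 0) :
    ∃ g : L ≃ₗ⁅F⁆ L, ∀ j, eval v (wv (fun k => LinearMap.toMatrix b b (LieAlgebra.ad F L (b k)))
      N w0 l j) = b.repr (g (∑ k, eval v (w0 k) • b k)) j := by
  induction l with
  | nil =>
    refine ⟨LieEquiv.refl, fun j => ?_⟩
    show eval v (w0 j) = b.repr (∑ k, eval v (w0 k) • b k) j
    rw [b.repr_sum_self]
  | cons k l ih =>
    obtain ⟨g, hg⟩ := ih fun k hk => hl k (List.mem_cons_of_mem _ hk)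
    have hk := hl k List.mem_cons_self
    obtain ⟨g', hg'⟩ := exists_exp (v k • b k) N (by rw [map_smul, smul_pow, hk, smul_zero])
    refine ⟨g.trans g', fun j => ?_⟩
    rw [LieEquiv.trans_apply, hg']
    generalize g (∑ k, eval v (w0 k) • b k) = y at hg ⊢
    rw [map_sum b.repr]
    simp only [wv, mulVec, dotProduct, map_sum (eval v), map_mul, eval_Ek, hg]
    simp only [Finset.sum_mul]
    rw [Finset.sum_comm, Finsupp.finset_sum_apply]
    refine Finset.sum_congr rfl fun m _ => ?_
    rw [map_smul, map_smul, smul_pow, LinearMap.smul_apply, map_smul, Finsupp.smul_apply,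
      Finsupp.smul_apply, ← LinearMap.toMatrix_mulVec_repr b b, LinearMap.toMatrix_pow]
    simp only [mulVec, dotProduct, smul_eq_mul, Finset.mul_sum]
    exact Finset.sum_congr rfl fun t _ => by ring

end poly

open MvPolynomial in
/-- Generic elements are conjugate to regular elements of a given Cartan subalgebra. -/
lemma cartan_open [IsAlgClosed F] [Module.Finite F L] [LieAlgebra.IsKilling F L]
    (H : LieSubalgebra F L) [H.IsCartanSubalgebra] {κ₀ : Type} [Fintype κ₀]
    (b₀ : Module.Basis κ₀ F L) : ∃ Q : MvPolynomial κ₀ F, Q ≠ 0 ∧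
      ∀ y : L, eval (b₀.repr y) Q ≠ 0 → ∃ g : L ≃ₗ⁅F⁆ L, ∃ x : L,
        (∀ z, ⁅x, z⁆ = 0 ↔ z ∈ H) ∧ g x = y := by
  classical
  obtain ⟨κ, _, b, s, α, ad⟩ := exists_adapted H
  have hab : ∀ x ∈ H, ∀ y ∈ H, ⁅x, y⁆ = 0 := by
    intro x hx y hy
    have : IsLieAbelian H := inferInstance
    simpa using congrArg Subtype.val (this.trivial ⟨x, hx⟩ ⟨y, hy⟩)
  obtain ⟨h0, hh0⟩ := ad.exists_reg
  let w0 : κ → MvPolynomial κ F := fun k => if s k then X k else 0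
  let l : List κ := (Finset.univ.filter fun k => ¬ s k).toList
  have hmem : ∀ k, k ∈ l ↔ ¬ s k := by intro k; simp [l]
  have hnil : ∃ N : ℕ, ∀ k ∈ l, (LieAlgebra.ad F L (b k)) ^ (N + 2) = 0 := by
    have : ∀ k : κ, ∃ n : ℕ, k ∈ l → (LieAlgebra.ad F L (b k)) ^ n = 0 := by
      intro k
      by_cases hk : k ∈ l
      · obtain ⟨n, hn⟩ := ad.nil k ((hmem k).mp hk)
        exact ⟨n, fun _ => hn⟩
      · exact ⟨0, fun h => absurd h hk⟩
    choose n hn using this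
    refine ⟨∑ k, n k, fun k hk => pow_eq_zero_of_le ?_ (hn k hk)⟩
    have := Finset.single_le_sum (f := n) (fun _ _ => Nat.zero_le _) (Finset.mem_univ k)
    omega
  obtain ⟨N, hN⟩ := hnil
  let M : κ → Matrix κ κ F := fun k => LinearMap.toMatrix b b (LieAlgebra.ad F L (b k))
  let φ := wv M (N + 2) w0 l
  let p : κ → F := b.repr (h0 : L)
  have hp : ∀ k ∈ l, p k = 0 := fun k hk => ad.repr_eq_zero hab h0.2 k ((hmem k).mp hk)
  have hw0 : ∀ k, eval p (w0 k) = p k := by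
    intro k
    by_cases hk : s k
    · simp [w0, hk]
    · simp [w0, hk, hp k ((hmem k).mpr hk)]
  let xr : (κ → F) → L := fun v => ∑ k, eval v (w0 k) • b k
  have hxr : ∀ v, xr v ∈ H := by
    intro v
    refine sum_mem fun k _ => ?_
    by_cases hk : s k
    · exact H.smul_mem _ (ad.mem k hk)
    · simp [w0, hk]
  -- the regularity polynomial
  let r : MvPolynomial κ F := ∏ k ∈ Finset.univ.filter (fun k => ¬ s k),
    ∑ t, if ht : s t then C (α k ⟨b t, ad.mem t ht⟩) * X t else 0
  have hr : ∀ v, eval v r = ∏ k ∈ Finset.univ.filter (fun k => ¬ s k), α k ⟨xr v, hxr v⟩ := by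
    intro v
    simp only [r, map_prod, map_sum]
    refine Finset.prod_congr rfl fun k _ => ?_
    have : (⟨xr v, hxr v⟩ : H) = ∑ t, if ht : s t then v t • (⟨b t, ad.mem t ht⟩ : H) else 0 := by
      apply Subtype.ext
      rw [AddSubmonoidClass.coe_finset_sum]
      refine Finset.sum_congr rfl fun t _ => ?_
      by_cases ht : s t <;> simp [w0, ht]
    rw [this, map_sum]
    refine Finset.sum_congr rfl fun t _ => ?_
    by_cases ht : s t
    · rw [dif_pos ht, dif_pos ht, map_smul, map_mul, eval_C, eval_X, smul_eq_mul, mul_comm]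
    · simp [ht]
  have hxp : xr p = h0 := by
    simp only [xr, hw0]
    exact b.sum_repr _
  have hrp : eval p r ≠ 0 := by
    rw [hr, Finset.prod_ne_zero_iff]
    intro k hk
    have : (⟨xr p, hxr p⟩ : H) = h0 := Subtype.ext hxp
    rw [this]
    exact hh0 k (by simpa using hk)
  have hJ : (Matrix.of fun i j => eval p (pderiv i (φ j))).det ≠ 0 := by
    have : (Matrix.of fun i j => eval p (pderiv i (φ j))) =
        Matrix.diagonal (fun i => if s i then 1 else - α i h0) := by
      ext i j
      rw [Matrix.of_apply, pderiv_wv M N w0 p l hp (Finset.nodup_toList _)]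
      by_cases hi : s i
      · rw [if_neg (by rw [hmem]; simpa using hi), add_zero]
        by_cases hij : i = j
        · subst hij; simp [w0, hi]
        · rw [Matrix.diagonal_apply_ne _ hij]
          by_cases hj : s j
          · simp [w0, hj, pderiv_X_of_ne (Ne.symm hij)]
          · simp [w0, hj]
      · rw [if_pos ((hmem i).mpr hi)]
        have h1 : eval p (pderiv i (w0 j)) = 0 := by
          by_cases hj : s j
          · have hij : j ≠ i := by rintro rfl; exact hi hj
            simp [w0, hj, pderiv_X_of_ne hij]
          · simp [w0, hj]
        rw [h1, zero_add]
        simp only [hw0]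
        have h2 : (M i *ᵥ fun t => p t) = b.repr ⁅b i, (h0 : L)⁆ := by
          exact LinearMap.toMatrix_mulVec_repr b b (LieAlgebra.ad F L (b i)) (h0 : L)
        rw [h2, ← lie_skew, ad.lie]
        by_cases hij : i = j
        · subst hij; simp [hi]
        · rw [Matrix.diagonal_apply_ne _ hij]; simp [hij]
    rw [this, Matrix.det_diagonal, Finset.prod_ne_zero_iff]
    intro i _
    by_cases hi : s i
    · simp [hi]
    · simp [hi, hh0 i hi]
  obtain ⟨q, hq0, hq⟩ := dominant φ r p hrp hJ
  have e1 : ∀ y, eval (b₀.repr y) (bind₁ (fun i => ∑ j, C (b.repr (b₀ j) i) * X j) q) =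
      eval (b.repr y) q := by
    intro y
    rw [eval, eval₂Hom_bind₁]
    have : (fun i => eval₂Hom (RingHom.id F) (b₀.repr y) (∑ j, C (b.repr (b₀ j) i) * X j)) =
        b.repr y := by
      funext i
      conv_rhs => rw [← b₀.sum_repr y, map_sum, Finsupp.finset_sum_apply]
      simp [mul_comm]
    rw [this]
    rfl
  refine ⟨bind₁ (fun i => ∑ j, C (b.repr (b₀ j) i) * X j) q, ?_, ?_⟩
  · intro h
    apply hq0
    apply MvPolynomial.funext
    intro x
    have := e1 (∑ i, x i • b i)
    rw [h, map_zero, b.repr_sum_self] at this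
    rw [← this, map_zero]
  · intro y hy
    rw [e1] at hy
    obtain ⟨v, hv1, hv2⟩ := hq _ hy
    obtain ⟨g, hg⟩ := exists_wv b (N + 2) w0 v l hN
    refine ⟨g, xr v, ad.reg_iff hab ⟨xr v, hxr v⟩ ?_, ?_⟩
    · intro k hk
      rw [hr, Finset.prod_ne_zero_iff] at hv1
      exact hv1 k (by simpa using hk)
    · apply b.repr.injective
      ext j
      rw [← hg, ← hv2]

open MvPolynomial in
/-- Conjugacy of Cartan subalgebras. -/
theorem cartan_conj [IsAlgClosed F] [Module.Finite F L] [LieAlgebra.IsKilling F L]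
    (H₁ H₂ : LieSubalgebra F L) [H₁.IsCartanSubalgebra] [H₂.IsCartanSubalgebra] :
    ∃ g : L ≃ₗ⁅F⁆ L, ∀ z, z ∈ H₁ ↔ g z ∈ H₂ := by
  let b₀ := Module.finBasis F L
  obtain ⟨Q₁, h₁, hQ₁⟩ := cartan_open H₁ b₀
  obtain ⟨Q₂, h₂, hQ₂⟩ := cartan_open H₂ b₀
  have : ∃ v, eval v (Q₁ * Q₂) ≠ 0 := by
    by_contra hc
    push Not at hc
    exact mul_ne_zero h₁ h₂ (MvPolynomial.funext fun v => by rw [hc, map_zero])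
  obtain ⟨v, hv⟩ := this
  have hy : b₀.repr (∑ i, v i • b₀ i) = v := b₀.repr_sum_self v
  rw [map_mul, ← hy] at hv
  obtain ⟨g₁, x₁, hx₁, hg₁⟩ := hQ₁ _ (left_ne_zero_of_mul hv)
  obtain ⟨g₂, x₂, hx₂, hg₂⟩ := hQ₂ _ (right_ne_zero_of_mul hv)
  refine ⟨g₁.trans g₂.symm, fun z => ?_⟩
  rw [← hx₁, ← hx₂]
  have e : x₂ = (g₁.trans g₂.symm) x₁ := by
    rw [LieEquiv.trans_apply, hg₁, ← hg₂, LieEquiv.symm_apply_apply]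
  rw [e, ← LieEquiv.map_lie]
  constructor
  · intro h; rw [h]; exact map_zero (g₁.trans g₂.symm : L →ₗ[F] L)
  · intro h
    apply (g₁.trans g₂.symm).injective
    exact h.trans (map_zero (g₁.trans g₂.symm : L →ₗ[F] L)).symm

end cartan
end E8P

set_option linter.unusedSectionVars false
namespace E8P
open Matrix

section jordan
variable {F : Type} [Field F] [CharZero F] [IsAlgClosed F] {L : Type} [LieRing L] [LieAlgebra F L]
  [Module.Finite F L]

open Module.End in
/-- Jordan decomposition inside a Killing Lie algebra. -/
lemma exists_jordan [LieAlgebra.IsKilling F L] (x : L) :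
    ∃ s : L, LieAlgebra.ad F L s ∈ Algebra.adjoin F {LieAlgebra.ad F L x} ∧
      (LieAlgebra.ad F L s).IsSemisimple ∧ IsNilpotent (LieAlgebra.ad F L (x - s)) := by
  obtain ⟨N, -, S, hS₁, hN, hS, hSN⟩ := (LieAlgebra.ad F L x).exists_isNilpotent_isSemisimple
  have hS₀ : Commute (LieAlgebra.ad F L x) S := Algebra.commute_of_mem_adjoin_self hS₁
  rw [eq_sub_of_add_eq hSN.symm] at hN
  have aux {α : F} {y : L} (hy : y ∈ (LieAlgebra.ad F L x).maxGenEigenspace α) : S y = α • y := by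
    rw [maxGenEigenspace_eq] at hy
    rw [apply_eq_of_mem_of_comm_of_isFinitelySemisimple_of_isNil hy hS₀ hS.isFinitelySemisimple hN]
  have htop : ∀ y : L, y ∈ ⨆ α : F, (LieAlgebra.ad F L x).maxGenEigenspace α := by
    intro y
    rw [iSup_maxGenEigenspace_eq_top]
    trivial
  have h_der1 (y z : L) : S ⁅y, z⁆ = ⁅S y, z⁆ + ⁅y, S z⁆ := by
    induction htop y using Submodule.iSup_induction' with
    | mem α y hy =>
      induction htop z using Submodule.iSup_induction' with
      | mem β z hz =>
        have hyz : ⁅y, z⁆ ∈ (LieAlgebra.ad F L x).maxGenEigenspace (α + β) :=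
          LieModule.lie_mem_maxGenEigenspace_toEnd hy hz
        rw [aux hy, aux hz, aux hyz, smul_lie, lie_smul, ← add_smul]
      | zero => simp
      | add _ _ _ _ h h' => simp only [lie_add, map_add, h, h']; abel
    | zero => simp
    | add _ _ _ _ h h' => simp only [add_lie, map_add, h, h']; abel
  have h_der : ∀ y z : L, S ⁅y, z⁆ = ⁅y, S z⁆ - ⁅z, S y⁆ := by
    simp_rw [← lie_skew (S _) _, add_comm, ← sub_eq_add_neg] at h_der1; assumption
  let S' : LieDerivation F L L := ⟨S, h_der⟩
  obtain ⟨y, hy⟩ := LieDerivation.IsKilling.exists_eq_ad S'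
  replace hy : S = LieAlgebra.ad F L y := by
    rw [← LieDerivation.coe_ad_apply_eq_ad_apply y, hy]
  refine ⟨y, ?_, ?_, ?_⟩
  · rw [← hy]; exact hS₁
  · rw [← hy]; exact hS
  · rw [map_sub, ← hy]; exact hN

open Module.End in
lemma nilp_of_comm {V : Type} [AddCommGroup V] [Module F V] [Module.Finite F V]
    (U A W : Module.End F V) (h : U * A - A * U = W) (hU : W * U = U * W) (hA : W * A = A * W) :
    IsNilpotent W := by
  have key : ∀ μ : F, μ ≠ 0 → W.eigenspace μ = ⊥ := by
    intro μ hμ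
    have st : ∀ B : Module.End F V, W * B = B * W →
        ∀ v ∈ W.eigenspace μ, B v ∈ W.eigenspace μ := by
      intro B hB v hv
      rw [mem_eigenspace_iff] at hv ⊢
      have := LinearMap.congr_fun hB v
      simp only [Module.End.mul_apply] at this
      rw [this, hv, map_smul]
    have h1 : (U.restrict (st U hU)) * (A.restrict (st A hA)) -
        (A.restrict (st A hA)) * (U.restrict (st U hU)) = μ • 1 := by
      ext v
      have h2 := LinearMap.congr_fun h v
      have h3 := mem_eigenspace_iff.mp v.2
      simp only [LinearMap.sub_apply, Module.End.mul_apply] at h2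
      simp only [LinearMap.sub_apply, Module.End.mul_apply]
      show U (A v) - A (U v) = μ • (v : V)
      rw [h2, h3]
    have h4 := congrArg (LinearMap.trace F _) h1
    rw [map_sub, LinearMap.trace_mul_comm, sub_self, map_smul, LinearMap.trace_one, smul_eq_mul,
      eq_comm, mul_eq_zero, or_iff_right hμ] at h4
    exact Submodule.finrank_eq_zero.mp (by exact_mod_cast h4)
  have h0 : W.maxGenEigenspace 0 = ⊤ := by
    rw [← iSup_maxGenEigenspace_eq_top W]
    apply le_antisymm
    · exact le_iSup (fun μ => W.maxGenEigenspace μ) 0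
    · refine iSup_le fun μ => ?_
      by_cases hμ : μ = 0
      · rw [hμ]
      · have : W.maxGenEigenspace μ = ⊥ := by
          by_contra hc
          rw [maxGenEigenspace_eq] at hc
          have := hasEigenvalue_of_hasGenEigenvalue (f := W) (μ := μ) hc
          exact this (key μ hμ)
        rw [this]; exact bot_le
  rw [maxGenEigenspace_eq] at h0
  refine ⟨W.maxGenEigenspaceIndex 0, ?_⟩
  ext v
  have : v ∈ W.genEigenspace 0 (W.maxGenEigenspaceIndex 0) := by rw [h0]; trivial
  rw [mem_genEigenspace_nat] at this
  simpa using this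

end jordan
end E8P

set_option linter.unusedSectionVars false
namespace E8P
open Matrix

section stable
variable {F : Type} [Field F] [CharZero F] [IsAlgClosed F] {L : Type} [LieRing L] [LieAlgebra F L]
  [Module.Finite F L] [LieAlgebra.IsKilling F L]

lemma kf_zero {z : L} (h : ∀ w, killingForm F L z w = 0) : z = 0 :=
  (LieAlgebra.IsKilling.killingForm_nondegenerate F L).1 z h

lemma kf_lie (x y z : L) : killingForm F L ⁅x, y⁆ z = killingForm F L x ⁅y, z⁆ :=
  LieModule.traceForm_apply_lie_apply F L L x y z

lemma ad_inj {x y : L} (h : LieAlgebra.ad F L x = LieAlgebra.ad F L y) : x = y := by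
  rw [← sub_eq_zero]
  apply kf_zero (F := F)
  intro w
  rw [killingForm_apply_apply, map_sub, h, sub_self]
  simp

/-- elements of a Cartan subalgebra of the fixed algebra are semisimple. -/
lemma fix_semisimple (θ : L ≃ₗ⁅F⁆ L) (K : LieSubalgebra F L) (hK : ∀ x, x ∈ K ↔ θ x = x)
    [LieAlgebra.IsKilling F K] (t : LieSubalgebra F K) [t.IsCartanSubalgebra]
    (x : K) (hx : x ∈ t) : (LieAlgebra.ad F L (x : L)).IsSemisimple := by
  obtain ⟨s, hs1, hs2, hs3⟩ := exists_jordan (F := F) (x : L)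
  have comm : ∀ T : Module.End F L, Commute T (LieAlgebra.ad F L (x : L)) →
      Commute T (LieAlgebra.ad F L s) := by
    intro T hT
    have : Algebra.adjoin F {LieAlgebra.ad F L (x : L)} ≤ Subalgebra.centralizer F {T} := by
      rw [Algebra.adjoin_le_iff, Set.singleton_subset_iff]
      intro g hg
      rw [Set.mem_singleton_iff.mp hg]
      exact hT
    exact this hs1 T rfl
  have hsK : s ∈ K := by
    rw [hK]
    apply ad_inj (F := F)
    have h1 : Commute (θ.toLinearEquiv : L →ₗ[F] L) (LieAlgebra.ad F L (x : L)) := by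
      ext y
      show θ ⁅(x : L), y⁆ = ⁅(x : L), θ y⁆
      rw [LieEquiv.map_lie, (hK x).mp x.2]
    have h2 := comm _ h1
    ext y
    have h3 := LinearMap.congr_fun h2 (θ.symm y)
    have h4 : θ ⁅s, θ.symm y⁆ = ⁅s, θ (θ.symm y)⁆ := h3
    rw [LieEquiv.map_lie, LieEquiv.apply_symm_apply] at h4
    exact h4
  have hcomm : ∀ y : K, ⁅y, x⁆ = 0 → ⁅y, (⟨s, hsK⟩ : K)⁆ = 0 := by
    intro y hy
    have hy' : ⁅(y : L), (x : L)⁆ = 0 := by simpa using congrArg Subtype.val hy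
    have h1 : Commute (LieAlgebra.ad F L (y : L)) (LieAlgebra.ad F L (x : L)) := by
      ext z
      show ⁅(y : L), ⁅(x : L), z⁆⁆ = ⁅(x : L), ⁅(y : L), z⁆⁆
      rw [leibniz_lie, hy', zero_lie, zero_add]
    have h2 := comm _ h1
    apply Subtype.ext
    show ⁅(y : L), s⁆ = 0
    apply ad_inj (F := F)
    ext z
    have h3 : ⁅(y : L), ⁅s, z⁆⁆ = ⁅s, ⁅(y : L), z⁆⁆ := LinearMap.congr_fun h2 z
    show ⁅⁅(y : L), s⁆, z⁆ = LieAlgebra.ad F L 0 z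
    rw [lie_lie, h3, sub_self, map_zero]
    rfl
  have hst : (⟨s, hsK⟩ : K) ∈ t := by
    suffices (⟨s, hsK⟩ : K) ∈ t.normalizer by
      rwa [LieSubalgebra.IsCartanSubalgebra.self_normalizing] at this
    refine (t.mem_normalizer_iff _).mpr fun z hz => ?_
    have hab : IsLieAbelian t := inferInstance
    have : ⁅z, x⁆ = 0 := by
      simpa using congrArg Subtype.val (hab.trivial ⟨z, hz⟩ ⟨x, hx⟩)
    rw [← lie_skew, hcomm z this, neg_zero]
    exact t.zero_mem
  have : x - ⟨s, hsK⟩ = 0 := by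
    apply LieAlgebra.IsKilling.eq_zero_of_isNilpotent_ad_of_mem_isCartanSubalgebra F K t
      (t.sub_mem hx hst)
    obtain ⟨n, hn⟩ := hs3
    refine ⟨n, ?_⟩
    have pw : ∀ (m : ℕ) (z : K), (((LieAlgebra.ad F K (x - ⟨s, hsK⟩)) ^ m) z : L) =
        ((LieAlgebra.ad F L ((x : L) - s)) ^ m) (z : L) := by
      intro m
      induction m with
      | zero => intro z; rfl
      | succ m ih =>
        intro z
        rw [pow_succ, pow_succ, Module.End.mul_apply, Module.End.mul_apply, ih]
        rfl
    ext z
    rw [pw, hn]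
    rfl
  have e : (x : L) = s := by
    have := congrArg Subtype.val this
    simpa [sub_eq_zero] using this
  rw [e]; exact hs2

lemma ss_ker {V : Type} [AddCommGroup V] [Module F V] [Module.Finite F V] {T : Module.End F V}
    (hT : T.IsSemisimple) (v : V) (k : ℕ) (h : (T ^ k) v = 0) : T v = 0 := by
  have := hT.isFinitelySemisimple.genEigenspace_eq_eigenspace 0 (k := (k + 1 : ℕ)) (by simp)
  have hv : v ∈ T.genEigenspace 0 (k + 1 : ℕ) := by
    rw [Module.End.mem_genEigenspace_nat]
    simp only [zero_smul, sub_zero, LinearMap.mem_ker]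
    rw [pow_succ', Module.End.mul_apply, h, map_zero]
  rw [this, Module.End.mem_eigenspace_iff, zero_smul] at hv
  exact hv

/-- A Cartan subalgebra stable under an automorphism of order four, with enough fixed points. -/
theorem exists_stable (θ : L ≃ₗ⁅F⁆ L) (h4 : ∀ x, θ (θ (θ (θ x))) = x)
    (K : LieSubalgebra F L) (hK : ∀ x, x ∈ K ↔ θ x = x) [LieAlgebra.IsKilling F K] :
    ∃ c : LieSubalgebra F L, c.IsCartanSubalgebra ∧ (∀ z, z ∈ c ↔ θ z ∈ c) ∧
      (∀ z, (∀ x ∈ c, θ x = x → ⁅x, z⁆ = 0) → z ∈ c) := by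
  obtain ⟨x₀, hx₀⟩ := LieAlgebra.exists_isCartanSubalgebra_engel F K
  set t := LieSubalgebra.engel F x₀ with ht
  have hss := fix_semisimple θ K hK t
  have htab : ∀ x ∈ t, ∀ y ∈ t, ⁅(x : L), (y : L)⁆ = 0 := by
    intro x hx y hy
    have hab : IsLieAbelian t := inferInstance
    simpa using congrArg (fun z : t => ((z : K) : L)) (hab.trivial ⟨x, hx⟩ ⟨y, hy⟩)
  let T : LieSubalgebra F L := t.map K.incl
  have hT : ∀ x, x ∈ T ↔ ∃ y ∈ t, (y : L) = x := fun x => LieSubalgebra.mem_map _ _ _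
  have hTab : IsLieAbelian T := ⟨by
    rintro ⟨x, hx⟩ ⟨y, hy⟩
    obtain ⟨x', hx', rfl⟩ := (hT _).mp hx
    obtain ⟨y', hy', rfl⟩ := (hT _).mp hy
    exact Subtype.ext (htab x' hx' y' hy')⟩
  let c := LieAlgebra.zeroRootSubalgebra F L T
  have hc : ∀ z, z ∈ c ↔ ∀ x ∈ t, ⁅(x : L), z⁆ = 0 := by
    intro z
    rw [LieAlgebra.mem_zeroRootSubalgebra]
    constructor
    · intro h x hx
      obtain ⟨k, hk⟩ := h ⟨x, (hT _).mpr ⟨x, hx, rfl⟩⟩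
      exact ss_ker (hss x hx) z k hk
    · rintro h ⟨x, hx⟩
      obtain ⟨x', hx', rfl⟩ := (hT _).mp hx
      exact ⟨1, by rw [pow_one]; exact h x' hx'⟩
  have htK : ∀ x : K, θ x = x := fun x => (hK x).mp x.2
  have hst : ∀ z, z ∈ c → θ z ∈ c := by
    intro z hz
    rw [hc] at hz ⊢
    intro x hx
    rw [← htK x, ← LieEquiv.map_lie, hz x hx]
    exact map_zero (θ : L →ₗ[F] L)
  have hst' : ∀ z, z ∈ c ↔ θ z ∈ c := by
    intro z
    refine ⟨hst z, fun h => ?_⟩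
    rw [← h4 z]; exact hst _ (hst _ (hst _ h))
  have htc : ∀ x ∈ t, (x : L) ∈ c := by
    intro x hx
    rw [hc]
    exact fun y hy => htab y hy x hx
  have hnd : ∀ z ∈ c, (∀ w ∈ c, killingForm F L z w = 0) → z = 0 := by
    intro z hz h
    apply kf_zero (F := F)
    intro w
    have h1 := (LieModule.isCompl_genWeightSpace_zero_posFittingComp F T L).codisjoint
    have hw : w ∈ (⊤ : LieSubmodule F T L) := trivial
    rw [← codisjoint_iff.mp h1, LieSubmodule.mem_sup] at hw
    obtain ⟨w0, hw0, w1, hw1, rfl⟩ := hw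
    rw [map_add, h w0 hw0,
      killingForm_eq_zero_of_mem_zeroRoot_mem_posFitting F L T hz hw1, add_zero]
  have kfθ : ∀ x y, killingForm F L (θ x) (θ y) = killingForm F L x y :=
    fun x y => LieAlgebra.killingForm_of_equiv_apply θ x y
  -- eigenvectors
  let E : F → L → Prop := fun μ x => x ∈ c ∧ θ x = μ • x
  have θadd : ∀ x y, θ (x + y) = θ x + θ y := fun x y => map_add (θ : L →ₗ[F] L) x y
  have θsmul : ∀ (a : F) x, θ (a • x) = a • θ x := fun a x => map_smul (θ : L →ₗ[F] L) a x
  have hproj : ∀ (μ : F), μ ^ 4 = 1 → ∀ w ∈ c,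
      E μ (w + μ ^ 3 • θ w + μ ^ 2 • θ (θ w) + μ • θ (θ (θ w))) := by
    intro μ hμ w hw
    refine ⟨?_, ?_⟩
    · have h1 := hst _ hw
      have h2 := hst _ h1
      have h3 := hst _ h2
      exact c.add_mem (c.add_mem (c.add_mem hw (c.smul_mem _ h1)) (c.smul_mem _ h2))
        (c.smul_mem _ h3)
    · simp only [θadd, θsmul, h4, smul_add, smul_smul]
      rw [show μ * μ ^ 3 = 1 by rw [← hμ]; ring, one_smul, show μ * μ ^ 2 = μ ^ 3 by ring,
        show μ * μ = μ ^ 2 by ring]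
      abel
  have hne : ∀ μ : F, μ ^ 4 = 1 → μ ≠ 0 := by
    rintro μ h rfl; simp at h
  have nd : ∀ (μ ν : F), μ ^ 4 = 1 → μ * ν = 1 → ∀ x, E μ x →
      (∀ z, E ν z → killingForm F L x z = 0) → x = 0 := by
    intro μ ν hμ hμν x hx h
    apply hnd x hx.1
    intro w hw
    have hν : ν ^ 4 = 1 := by
      have : (μ * ν) ^ 4 = 1 := by rw [hμν, one_pow]
      rwa [mul_pow, hμ, one_mul] at this
    have h1 := h _ (hproj ν hν w hw)
    have e1 : ∀ y, killingForm F L x (θ y) = ν * killingForm F L x y := by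
      intro y
      rw [← kfθ x y, hx.2, map_smul, LinearMap.smul_apply, smul_eq_mul, ← mul_assoc, mul_comm ν,
        hμν, one_mul]
    simp only [map_add, map_smul, e1, smul_eq_mul] at h1
    have h2 : (4 : F) * killingForm F L x w = 0 := by
      rw [← h1]
      linear_combination (-3 * killingForm F L x w) * hν
    simpa using h2
  have Elie : ∀ μ ν x y, E μ x → E ν y → E (μ * ν) ⁅x, y⁆ := by
    intro μ ν x y hx hy
    refine ⟨c.lie_mem hx.1 hy.1, ?_⟩
    rw [LieEquiv.map_lie, hx.2, hy.2, smul_lie, lie_smul, smul_smul]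
  have skew : ∀ x y : L, ⁅x, y⁆ = 0 → ⁅y, x⁆ = 0 := by
    intro x y h; rw [← lie_skew, h, neg_zero]
  have stepA : ∀ x, E 1 x → ∀ z ∈ c, ⁅x, z⁆ = 0 := by
    intro x hx z hz
    have hxK : x ∈ K := by rw [hK, hx.2, one_smul]
    have : (⟨x, hxK⟩ : K) ∈ t := by
      suffices (⟨x, hxK⟩ : K) ∈ t.normalizer by
        rwa [LieSubalgebra.IsCartanSubalgebra.self_normalizing] at this
      refine (t.mem_normalizer_iff _).mpr fun y hy => ?_
      have : ⁅(⟨x, hxK⟩ : K), y⁆ = 0 := Subtype.ext (skew _ _ ((hc x).mp hx.1 y hy))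
      rw [this]; exact t.zero_mem
    exact (hc z).mp hz _ this
  have stepB : ∀ μ ν, μ * ν = 1 → ∀ x y, E μ x → E ν y → ⁅x, y⁆ = 0 := by
    intro μ ν h x y hx hy
    refine nd 1 1 (by simp) (by simp) _ (h ▸ Elie _ _ _ _ hx hy) fun z hz => ?_
    rw [kf_lie, skew _ _ (stepA z hz y hy.1), map_zero]
  obtain ⟨i, hi⟩ : ∃ i : F, i ^ 2 = -1 := IsAlgClosed.exists_pow_nat_eq (-1) (by norm_num)
  have hi4 : ∀ μ : F, μ ^ 2 = -1 → μ ^ 4 = 1 := by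
    intro μ h; rw [show μ ^ 4 = (μ ^ 2) ^ 2 by ring, h]; ring
  have dec : ∀ μ : F, μ ^ 2 = -1 → ∀ x ∈ c, (∀ z, E 1 z → ⁅x, z⁆ = 0) → (∀ z, E μ z → ⁅x, z⁆ = 0) →
      (∀ z, E (-1) z → ⁅x, z⁆ = 0) → (∀ z, E (-μ) z → ⁅x, z⁆ = 0) → ∀ z ∈ c, ⁅x, z⁆ = 0 := by
    intro μ hμ x hx h1 h2 h3 h4 z hz
    have k1 := h1 _ (hproj 1 (by simp) z hz)
    have k2 := h2 _ (hproj μ (hi4 μ hμ) z hz)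
    have k3 := h3 _ (hproj (-1) (by norm_num) z hz)
    have k4 := h4 _ (hproj (-μ) (hi4 _ (by rw [neg_sq, hμ])) z hz)
    simp only [lie_add, lie_smul] at k1 k2 k3 k4
    have : (4 : F) • ⁅x, z⁆ = 0 := by
      have e : μ ^ 3 = - μ := by rw [pow_succ, hμ]; ring
      have e' : (-μ) ^ 3 = μ := by rw [Odd.neg_pow (by decide), e, neg_neg]
      rw [e, hμ] at k2
      rw [e', neg_sq, hμ] at k4
      rw [← add_zero (0 : L)]
      nth_rewrite 1 [← k1]
      rw [← add_zero (0 : L)]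
      nth_rewrite 1 [← k2]
      rw [← add_zero (0 : L)]
      nth_rewrite 1 [← k3]
      rw [← k4]
      module
    simpa using this
  have lemN : ∀ u ∈ c, ∀ a ∈ c, (∀ z ∈ c, ⁅⁅u, a⁆, z⁆ = 0) → ⁅u, a⁆ = 0 := by
    intro u hu a ha h
    have hcm : ∀ z ∈ c, LieAlgebra.ad F L ⁅u, a⁆ * LieAlgebra.ad F L z =
        LieAlgebra.ad F L z * LieAlgebra.ad F L ⁅u, a⁆ := by
      intro z hz
      ext y
      show ⁅⁅u, a⁆, ⁅z, y⁆⁆ = ⁅z, ⁅⁅u, a⁆, y⁆⁆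
      rw [leibniz_lie ⁅u, a⁆, h z hz, zero_lie, zero_add]
    have hn : IsNilpotent (LieAlgebra.ad F L ⁅u, a⁆) := by
      refine nilp_of_comm (LieAlgebra.ad F L u) (LieAlgebra.ad F L a) _ ?_ (hcm u hu) (hcm a ha)
      ext y
      show ⁅u, ⁅a, y⁆⁆ - ⁅a, ⁅u, y⁆⁆ = ⁅⁅u, a⁆, y⁆
      rw [lie_lie]
    apply hnd _ (c.lie_mem hu ha)
    intro w hw
    rw [killingForm_apply_apply]
    have : IsNilpotent (LieAlgebra.ad F L ⁅u, a⁆ * LieAlgebra.ad F L w) :=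
      Commute.isNilpotent_mul_right (hcm w hw) hn
    exact (LinearMap.isNilpotent_trace_of_isNilpotent this).eq_zero
  have stepC : ∀ μ : F, μ ^ 2 = -1 → ∀ a a', E μ a → E μ a' → ⁅a, a'⁆ = 0 := by
    intro μ hμ a₁ a₂ ha₁ ha₂
    have hu : E (-1) ⁅a₁, a₂⁆ := by rw [← hμ, sq]; exact Elie _ _ _ _ ha₁ ha₂
    have hmm : μ * -μ = 1 := by rw [mul_neg, ← sq, hμ, neg_neg]
    have hmm' : -μ * μ = 1 := by rw [mul_comm, hmm]
    have u1 : ∀ z, E 1 z → ⁅⁅a₁, a₂⁆, z⁆ = 0 := fun z hz => skew _ _ (stepA z hz _ hu.1)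
    have u2 : ∀ z, E (-1) z → ⁅⁅a₁, a₂⁆, z⁆ = 0 := fun z hz =>
      stepB (-1) (-1) (by norm_num) _ _ hu hz
    have u3 : ∀ z, E (-μ) z → ⁅⁅a₁, a₂⁆, z⁆ = 0 := by
      intro z hz
      rw [lie_lie, stepB _ _ hmm _ _ ha₂ hz, stepB _ _ hmm _ _ ha₁ hz, lie_zero, lie_zero, sub_zero]
    have u4 : ∀ a, E μ a → ⁅⁅a₁, a₂⁆, a⁆ = 0 := by
      intro a ha
      have hw : E (-μ) ⁅⁅a₁, a₂⁆, a⁆ := by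
        have := Elie _ _ _ _ hu ha
        rwa [neg_one_mul] at this
      apply lemN _ hu.1 _ ha.1
      apply dec μ hμ _ hw.1
      · exact fun z hz => skew _ _ (stepA z hz _ hw.1)
      · exact fun z hz => stepB _ _ hmm' _ _ hw hz
      · intro z hz
        have : E (-μ) ⁅a, z⁆ := by
          have := Elie _ _ _ _ ha hz
          rwa [mul_neg_one] at this
        rw [lie_lie, u3 _ this, u2 z hz, lie_zero, sub_zero]
      · intro z hz
        rw [lie_lie, stepB _ _ hmm _ _ ha hz, u3 z hz, lie_zero, lie_zero, sub_zero]
    exact lemN _ ha₁.1 _ ha₂.1 (dec μ hμ _ hu.1 u1 u4 u2 u3)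
  have stepD : ∀ μ : F, μ ^ 2 = -1 → ∀ a b, E μ a → E (-1) b → ⁅b, a⁆ = 0 := by
    intro μ hμ a b ha hb
    have h1 : E (-μ) ⁅b, a⁆ := by
      have := Elie _ _ _ _ hb ha
      rwa [neg_one_mul] at this
    refine nd (-μ) μ (hi4 _ (by rw [neg_sq, hμ])) (by rw [neg_mul, ← sq, hμ, neg_neg]) _ h1
      fun z hz => ?_
    rw [kf_lie, stepC μ hμ a z ha hz, map_zero]
  have hni : (-i) ^ 2 = -1 := by rw [neg_sq, hi]
  have cab : ∀ x ∈ c, ∀ z ∈ c, ⁅x, z⁆ = 0 := by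
    have hii : i * -i = 1 := by rw [mul_neg, ← sq, hi, neg_neg]
    have hii' : -i * i = 1 := by rw [mul_comm, hii]
    have q1 : ∀ x, E i x → ∀ z ∈ c, ⁅x, z⁆ = 0 := fun x hx => dec i hi x hx.1
      (fun z hz => skew _ _ (stepA z hz _ hx.1)) (fun z hz => stepC i hi _ _ hx hz)
      (fun z hz => skew _ _ (stepD i hi _ _ hx hz)) (fun z hz => stepB _ _ hii _ _ hx hz)
    have q3 : ∀ x, E (-i) x → ∀ z ∈ c, ⁅x, z⁆ = 0 := fun x hx => dec i hi x hx.1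
      (fun z hz => skew _ _ (stepA z hz _ hx.1)) (fun z hz => stepB _ _ hii' _ _ hx hz)
      (fun z hz => skew _ _ (stepD (-i) hni _ _ hx hz)) (fun z hz => stepC (-i) hni _ _ hx hz)
    have q2 : ∀ x, E (-1) x → ∀ z ∈ c, ⁅x, z⁆ = 0 := fun x hx => dec i hi x hx.1
      (fun z hz => skew _ _ (stepA z hz _ hx.1)) (fun z hz => stepD i hi _ _ hz hx)
      (fun z hz => stepB _ _ (by norm_num) _ _ hx hz) (fun z hz => stepD (-i) hni _ _ hz hx)
    intro x hx
    exact dec i hi x hx (fun z hz => skew _ _ (stepA z hz _ hx)) (fun z hz => skew _ _ (q1 z hz _ hx))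
      (fun z hz => skew _ _ (q2 z hz _ hx)) (fun z hz => skew _ _ (q3 z hz _ hx))
  refine ⟨c, ?_, hst', ?_⟩
  · have hab : IsLieAbelian c := ⟨by
      rintro ⟨x, hx⟩ ⟨y, hy⟩
      exact Subtype.ext (cab x hx y hy)⟩
    exact ⟨inferInstance, LieAlgebra.zeroRootSubalgebra_normalizer_eq_self F L T⟩
  · intro z hz
    rw [hc]
    exact fun x hx => hz x (htc x hx) (htK x)

end stable
end E8P

set_option linter.unusedSectionVars false
namespace E8P
open Matrix

section serre
variable {ι : Type} [Fintype ι] [DecidableEq ι] {F : Type} [Field F] [CharZero F]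
  {S : Type} [LieRing S] [LieAlgebra F S] {A : Matrix ι ι ℤ} {h e f : ι → S}

/-- The coroot attached to a lattice vector. -/
def hvec (F : Type) [Field F] {S : Type} [LieRing S] [LieAlgebra F S] (h : ι → S) (v : ι → ℤ) : S :=
  ∑ i, ((v i : ℤ) : F) • h i

lemma hvec_add (u v : ι → ℤ) : hvec F h (u + v) = hvec F h u + hvec F h v := by
  simp [hvec, add_smul, Finset.sum_add_distrib]

lemma hvec_neg (u : ι → ℤ) : hvec F h (-u) = - hvec F h u := by
  simp [hvec]

lemma hvec_sr (i : ι) : hvec F h (sr i) = h i := by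
  simp [hvec, sr, Pi.single_apply, ite_smul]

lemma hvec_zsmul (c : ℤ) (u : ι → ℤ) : hvec F h (c • u) = (c : F) • hvec F h u := by
  simp [hvec, Finset.smul_sum, smul_smul]

lemma hvec_lie (w : ι → ℤ) {v : ι → ℤ} {x : S} (hx : x ∈ Wt F A h v) :
    ⁅hvec F h w, x⁆ = ((bf A w v : ℤ) : F) • x := by
  rw [hvec, SerreSys.span_lie_Wt v _ hx]
  congr 1
  rw [bf, dotProduct]; push_cast; rfl

lemma hvec_hvec (s : SerreSys F A h e f) (u w : ι → ℤ) : ⁅hvec F h u, hvec F h w⁆ = 0 := by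
  rw [hvec, hvec, sum_lie]
  refine Finset.sum_eq_zero fun i _ => ?_
  rw [lie_sum]
  refine Finset.sum_eq_zero fun j _ => ?_
  rw [smul_lie, lie_smul, s.hh]; simp

lemma SerreSys.Wt_eq_zero (hA : SLPD A) (s : SerreSys F A h e f)
    (gen : LieSubalgebra.lieSpan F S (Set.range e ∪ Set.range f) = ⊤) {v : ι → ℤ}
    (hv : 2 < bf A v v) {x : S} (hx : x ∈ Wt F A h v) : x = 0 := by
  by_contra h0
  have := s.Wt_root hA gen (v := v) (by rintro rfl; simp [bf_zero_left] at hv) hx h0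
  omega

lemma SerreSys.coroot_pos (hA : SLPD A) (s : SerreSys F A h e f)
    (gen : LieSubalgebra.lieSpan F S (Set.range e ∪ Set.range f) = ⊤) {v : ι → ℤ}
    (h0 : 0 ≤ v) (hv : bf A v v = 2) :
    ∃ x ∈ Wt F A h v, ∃ y ∈ Wt F A h (-v), ⁅x, y⁆ = hvec F h v := by
  refine root_lower_ind hA (fun v => ∃ x ∈ Wt F A h v, ∃ y ∈ Wt F A h (-v), ⁅x, y⁆ = hvec F h v)
    ?_ ?_ h0 hv
  · intro i
    exact ⟨e i, s.e_mem i, f i, s.f_mem i, by rw [hvec_sr, s.ef]⟩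
  · rintro v i - hv hi - hu ⟨x, hx, y, hy, hxy⟩
    obtain ⟨u, rfl⟩ : ∃ u, v = u + sr i := ⟨v - sr i, by simp⟩
    rw [add_sub_cancel_right] at hx hy hxy hu
    have hi2 : bf A (sr i) u = -1 := by
      rw [bf_add_right, sr_norm hA] at hi; omega
    have hi3 : bf A u (sr i) = -1 := by rw [bf_comm hA]; exact hi2
    have z1 : ⁅f i, x⁆ = 0 := by
      apply s.Wt_eq_zero hA gen (v := -sr i + u) _ (lie_mem_Wt (s.f_mem i) hx)
      simp only [bf_add_left, bf_add_right, bf_neg_left, bf_neg_right, sr_norm hA, hi2, hi3, hu]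
      norm_num
    have z2 : ⁅e i, y⁆ = 0 := by
      apply s.Wt_eq_zero hA gen (v := sr i + -u) _ (lie_mem_Wt (s.e_mem i) hy)
      simp only [bf_add_left, bf_add_right, bf_neg_left, bf_neg_right, sr_norm hA, hi2, hi3, hu]
      norm_num
    refine ⟨⁅e i, x⁆, ?_, -⁅f i, y⁆, ?_, ?_⟩
    · rw [add_comm]; exact lie_mem_Wt (s.e_mem i) hx
    · rw [neg_add, add_comm]; exact neg_mem (lie_mem_Wt (s.f_mem i) hy)
    · have a1 : ⁅x, ⁅f i, y⁆⁆ = - f i := by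
        rw [leibniz_lie, ← lie_skew x, z1, hxy, ← lie_skew (f i), hvec_lie u (s.f_mem i),
          bf_neg_right, hi3]
        simp
      have a2 : ⁅e i, ⁅f i, y⁆⁆ = y := by
        rw [leibniz_lie, z2, s.ef, ← hvec_sr (F := F) (h := h) i, hvec_lie (sr i) hy, bf_neg_right,
          hi2]
        simp
      rw [lie_neg, lie_lie, a1, a2, hxy, lie_neg, s.ef, hvec_add, hvec_sr]
      abel

lemma SerreSys.coroot (hA : SLPD A) (s : SerreSys F A h e f)
    (gen : LieSubalgebra.lieSpan F S (Set.range e ∪ Set.range f) = ⊤) {v : ι → ℤ}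
    (hv : bf A v v = 2) :
    ∃ x ∈ Wt F A h v, ∃ y ∈ Wt F A h (-v), ⁅x, y⁆ = hvec F h v := by
  rcases nonneg_or_nonpos hA hv with h0 | h0
  · exact s.coroot_pos hA gen h0 hv
  · obtain ⟨x, hx, y, hy, hxy⟩ := s.coroot_pos hA gen (v := -v) (by simpa using h0)
      (by simpa [bf_neg_left, bf_neg_right] using hv)
    refine ⟨y, by simpa using hy, x, hx, ?_⟩
    rw [← lie_skew, hxy, hvec_neg, neg_neg]

variable {κ : Type} [Fintype κ] [DecidableEq κ] {A' : Matrix κ κ ℤ}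

theorem SerreSys.newsys (hA : SLPD A) (s : SerreSys F A h e f)
    (gen : LieSubalgebra.lieSpan F S (Set.range e ∪ Set.range f) = ⊤)
    (hA' : SLPD A') (w : κ → (ι → ℤ)) (hw : ∀ a b, bf A (w a) (w b) = A' a b) :
    ∃ e' f' : κ → S, SerreSys F A' (fun a => hvec F h (w a)) e' f' ∧
      (∀ a, e' a ∈ Wt F A h (w a)) ∧ (∀ a, f' a ∈ Wt F A h (-w a)) := by
  have hd : ∀ a, bf A (w a) (w a) = 2 := fun a => by rw [hw, hA'.diag]
  choose x hx y hy hxy using fun a => s.coroot hA gen (hd a)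
  have hsym : ∀ a b, A' a b = A' b a := fun a b => by rw [← hw, ← hw, bf_comm hA]
  have hoff : ∀ a b, a ≠ b → A' a b ≤ 0 := fun a b hab => by
    rcases hA'.off a b hab with h | h <;> omega
  refine ⟨x, y, ⟨?_, hxy, ?_, ?_, ?_, ?_, ?_, ?_, ?_⟩, hx, hy⟩
  · intro a b; exact hvec_hvec s _ _
  · intro a b hab
    apply s.Wt_eq_zero hA gen _ (lie_mem_Wt (hx a) (hy b))
    simp only [bf_add_left, bf_add_right, bf_neg_left, bf_neg_right, hw, hA'.diag]
    have := hoff a b hab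
    have := hsym a b
    omega
  · intro a b; rw [hvec_lie _ (hx b), hw]
  · intro a b; rw [hvec_lie _ (hy b), bf_neg_right, hw]; push_cast; rfl
  · intro a b hab
    apply s.Wt_eq_zero hA gen _ (lie_mem_Wt (hx a) (hx b))
    simp only [bf_add_left, bf_add_right, bf_neg_left, bf_neg_right, hw, hA'.diag]
    have := hsym a b
    omega
  · intro a b hab
    apply s.Wt_eq_zero hA gen _ (lie_mem_Wt (hx a) (lie_mem_Wt (hx a) (hx b)))
    simp only [bf_add_left, bf_add_right, bf_neg_left, bf_neg_right, hw, hA'.diag]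
    have := hsym a b
    omega
  · intro a b hab
    apply s.Wt_eq_zero hA gen _ (lie_mem_Wt (hy a) (hy b))
    simp only [bf_add_left, bf_add_right, bf_neg_left, bf_neg_right, hw, hA'.diag]
    have := hsym a b
    omega
  · intro a b hab
    apply s.Wt_eq_zero hA gen _ (lie_mem_Wt (hy a) (lie_mem_Wt (hy a) (hy b)))
    simp only [bf_add_left, bf_add_right, bf_neg_left, bf_neg_right, hw, hA'.diag]
    have := hsym a b
    omega

lemma SerreSys.e_ne_of (hA : SLPD A) (s : SerreSys F A h e f) (hh : ∀ i, h i ≠ 0) (i : ι) :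
    e i ≠ 0 := by
  intro h0
  have := s.ef i
  rw [h0, zero_lie] at this
  exact hh i this.symm

lemma SerreSys.f_ne_of (hA : SLPD A) (s : SerreSys F A h e f) (hh : ∀ i, h i ≠ 0) (i : ι) :
    f i ≠ 0 := by
  intro h0
  have := s.ef i
  rw [h0, lie_zero] at this
  exact hh i this.symm

lemma hvec_ne (li : LinearIndependent F h) {v : ι → ℤ} (hv : v ≠ 0) : hvec F h v ≠ 0 := by
  intro h0
  apply hv
  ext i
  have := Fintype.linearIndependent_iff.mp li _ h0 i
  simpa using this

/-- Change of base inside the same Cartan subalgebra. -/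
theorem SerreSys.rebase (hA : SLPD A) (s : SerreSys F A h e f)
    (gen : LieSubalgebra.lieSpan F S (Set.range e ∪ Set.range f) = ⊤) (he : ∀ i, e i ≠ 0)
    (g : ι → (ι → ℤ)) (hg : ∀ a b, bf A (g a) (g b) = A a b) :
    ∃ e' f' : ι → S, SerreSys F A (fun a => hvec F h (g a)) e' f' ∧
      LieSubalgebra.lieSpan F S (Set.range e' ∪ Set.range f') = ⊤ ∧
      (∀ a, e' a ∈ Wt F A h (g a)) ∧ (∀ a, e' a ≠ 0) ∧
      (∀ x, x ∈ Hst F A (fun a => hvec F h (g a)) ↔ x ∈ Hst F A h) := by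
  obtain ⟨e', f', s', h1, h2⟩ := s.newsys hA gen hA g hg
  have li := s.linInd hA he
  have hne : ∀ a, hvec F h (g a) ≠ 0 := fun a => hvec_ne li (by
    intro h0; have := hg a a; rw [h0, bf_zero_left, hA.diag] at this; omega)
  have he' := s'.e_ne_of hA hne
  have li' := s'.linInd hA he'
  have fin := s.finite hA gen
  have gen' : LieSubalgebra.lieSpan F S (Set.range e' ∪ Set.range f') = ⊤ := by
    obtain ⟨Φ⟩ := serre_equiv hA s gen li
    obtain ⟨φ, p1, p2, p3⟩ := exists_lift hA s'
    have inj : Function.Injective φ := by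
      apply serreSys_std.injective_of_linInd hA gen_std
      simpa only [p1] using li'
    have fin2 : Module.Finite F (A.ToLieAlgebra F) := serreSys_std.finite hA gen_std
    have surj : Function.Surjective φ := by
      have := (LinearMap.injective_iff_surjective_of_finrank_eq_finrank
        (f := (φ : A.ToLieAlgebra F →ₗ[F] S)) (Φ.toLinearEquiv.finrank_eq)).mp inj
      exact this
    rw [eq_top_iff]
    intro y _
    obtain ⟨x, rfl⟩ := surj y
    have hx : x ∈ (LieSubalgebra.lieSpan F S (Set.range e' ∪ Set.range f')).comap φ := by
      have : x ∈ LieSubalgebra.lieSpan F (A.ToLieAlgebra F)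
        (Set.range (sE F A) ∪ Set.range (sF F A)) := by rw [gen_std]; exact LieSubalgebra.mem_top x
      refine (LieSubalgebra.lieSpan_le.mpr ?_) this
      rintro _ (⟨i, rfl⟩ | ⟨i, rfl⟩)
      · show φ (sE F A i) ∈ LieSubalgebra.lieSpan F S (Set.range e' ∪ Set.range f')
        rw [p2]; exact LieSubalgebra.subset_lieSpan (Or.inl ⟨i, rfl⟩)
      · show φ (sF F A i) ∈ LieSubalgebra.lieSpan F S (Set.range e' ∪ Set.range f')
        rw [p3]; exact LieSubalgebra.subset_lieSpan (Or.inr ⟨i, rfl⟩)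
    exact hx
  refine ⟨e', f', s', gen', h1, he', ?_⟩
  have hin : ∀ a, hvec F h (g a) ∈ Hst F A h := fun a =>
    (s.mem_Hst_iff hA gen).mpr ⟨_, rfl⟩
  intro x
  constructor
  · intro hx
    obtain ⟨c, rfl⟩ := (s'.mem_Hst_iff hA gen').mp hx
    exact sum_mem fun i _ => (Hst F A h).smul_mem _ (hin i)
  · intro hx
    rw [mem_Hst]
    intro a
    rw [s.hst_abelian hA gen (hin a) hx]
    simp

end serre
end E8P

set_option linter.unusedSectionVars false
namespace E8P
open Matrix

section lattice2
variable {ι : Type} [Fintype ι] [DecidableEq ι] {A : Matrix ι ι ℤ}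

/-- Every additive functional is dominant for some base. -/
theorem exists_dom (hA : SLPD A) (r : ι → ℤ) (hr : ∀ i, (A *ᵥ r) i = 1) (φ : (ι → ℤ) →+ ℚ) :
    ∃ g : ι → (ι → ℤ), (∀ i j, bf A (g i) (g j) = A i j) ∧ ∀ i, 0 ≤ φ (g i) := by
  set T : Set (ι → (ι → ℤ)) := {g | ∀ i j, bf A (g i) (g j) = A i j} with hT
  have hfin : T.Finite := by
    apply (Set.Finite.pi' (fun _ : ι => finite_roots hA)).subset
    intro g hg i
    show bf A (g i) (g i) = 2
    rw [hg i i, hA.diag]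
  have hne : T.Nonempty := ⟨sr, fun i j => bf_sr_sr i j⟩
  obtain ⟨g, hg, hmax⟩ := Set.exists_max_image T (fun g => ∑ j, (r j : ℚ) * φ (g j)) hfin hne
  refine ⟨g, hg, fun i => ?_⟩
  have hg' : (fun j => g j - A i j • g i) ∈ T := by
    intro j k
    simp only [bf_sub_left, bf_sub_right, bf_smul_left, bf_smul_right]
    rw [hg, hg, hg, hg, hA.symm j i, hA.diag]
    ring
  have := hmax _ hg'
  have e1 : ∑ j, (r j : ℚ) * φ (g j - A i j • g i) = ∑ j, (r j : ℚ) * φ (g j) - φ (g i) := by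
    have h1 : ∑ j, (r j : ℚ) * (A i j : ℚ) = 1 := by
      have := hr i
      rw [mulVec, dotProduct] at this
      have h2 : ((∑ j, A i j * r j : ℤ) : ℚ) = 1 := by rw [this]; norm_num
      push_cast at h2
      rw [← h2]
      exact Finset.sum_congr rfl fun j _ => mul_comm _ _
    have h2 : ∀ j, (r j : ℚ) * φ (g j - A i j • g i) =
        (r j : ℚ) * φ (g j) - ((r j : ℚ) * (A i j : ℚ)) * φ (g i) := by
      intro j
      rw [map_sub, map_zsmul, zsmul_eq_mul]; ring
    simp_rw [h2]
    rw [Finset.sum_sub_distrib, ← Finset.sum_mul, h1, one_mul]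
  simp only [e1] at this
  linarith

end lattice2
end E8P

set_option linter.unusedSectionVars false
namespace E8P
open Matrix

section P5
variable {ι : Type} [Fintype ι] [DecidableEq ι] {F : Type} [Field F] [CharZero F]
  {S : Type} [LieRing S] [LieAlgebra F S] {A : Matrix ι ι ℤ} {h e f : ι → S}

lemma Wt_inter (hA : SLPD A) {u v : ι → ℤ} {x : S} (hu : x ∈ Wt F A h u) (hv : x ∈ Wt F A h v)
    (hx : x ≠ 0) : u = v := by
  apply mulVec_inj hA
  ext i
  have := (hu i).symm.trans (hv i)
  rw [← sub_eq_zero, ← sub_smul] at this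
  have := (smul_eq_zero.mp this).resolve_right hx
  exact_mod_cast sub_eq_zero.mp this

lemma SerreSys.joint_eigen (hA : SLPD A) (s : SerreSys F A h e f)
    (gen : LieSubalgebra.lieSpan F S (Set.range e ∪ Set.range f) = ⊤) {x : S} (hx : x ≠ 0)
    (hj : ∀ i, ∃ c : F, ⁅h i, x⁆ = c • x) : ∃ w, x ∈ Wt F A h w := by
  obtain ⟨t, y, hy, hxy⟩ := s.decomp gen x
  have key := comp_mem (h := h) hA (Submodule.span F {x}) (by
    intro i z hz
    obtain ⟨c, rfl⟩ := Submodule.mem_span_singleton.mp hz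
    obtain ⟨d, hd⟩ := hj i
    rw [lie_smul, hd]
    exact Submodule.smul_mem _ _ (Submodule.smul_mem _ _ (Submodule.mem_span_singleton_self x)))
    t y (fun v _ => s.Tot_le v (hy v)) (by rw [← hxy]; exact Submodule.mem_span_singleton_self x)
  have : ∃ v ∈ t, y v ≠ 0 := by
    by_contra hc
    push Not at hc
    exact hx (hxy.trans (Finset.sum_eq_zero hc))
  obtain ⟨v, hv, hne⟩ := this
  obtain ⟨c, hc⟩ := Submodule.mem_span_singleton.mp (key v hv)
  have hc0 : c ≠ 0 := by rintro rfl; exact hne (by rw [← hc, zero_smul])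
  refine ⟨v, ?_⟩
  have : x = c⁻¹ • y v := by rw [← hc, smul_smul, inv_mul_cancel₀ hc0, one_smul]
  rw [this]
  exact Submodule.smul_mem _ _ (s.Tot_le v (hy v))

/-- An automorphism preserving the Cartan subalgebra and the dominance of a base fixes the base
up to scalars. -/
theorem SerreSys.diag_of_dom (hA : SLPD A) (s : SerreSys F A h e f)
    (gen : LieSubalgebra.lieSpan F S (Set.range e ∪ Set.range f) = ⊤) (he : ∀ i, e i ≠ 0)
    (r : ι → ℤ) (hr : ∀ i, (A *ᵥ r) i = 1) (hri : Function.Injective r)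
    (θ : S ≃ₗ⁅F⁆ S) (h4 : ∀ x, θ (θ (θ (θ x))) = x) (hst : ∀ z, z ∈ Hst F A h ↔ θ z ∈ Hst F A h)
    (y : S) (hy : y ∈ Hst F A h) (hyf : θ y = y) (μ : ι → F) (hμ : ∀ i, ⁅y, e i⁆ = μ i • e i)
    (l : F →ₗ[ℚ] ℚ) (hl : ∀ i, 0 < l (μ i)) :
    (∀ i, θ (h i) = h i) ∧ ∀ i, ∃ c : F, θ (e i) = c • e i := by
  have hhm : ∀ i, h i ∈ Hst F A h := fun i => s.h_mem i
  have hsm : ∀ (c : F) x, θ (c • x) = c • θ x := fun c x => map_smul (θ : S →ₗ[F] S) c x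
  have hlie : ∀ x z, θ ⁅x, z⁆ = ⁅θ x, θ z⁆ := fun x z => LieEquiv.map_lie θ x z
  have hne0 : ∀ x, x ≠ 0 → θ x ≠ 0 := by
    intro x hx h0
    apply hx
    rw [← h4 x, h0]
    have h00 : θ (0 : S) = 0 := map_zero (θ : S →ₗ[F] S)
    rw [h00, h00, h00]
  -- preimages of the Cartan elements
  have hpre : ∀ j, ∃ c : ι → F, θ (∑ k, c k • h k) = h j := by
    intro j
    have h1 : θ (θ (θ (h j))) ∈ Hst F A h := by
      rw [← hst, ← hst, ← hst]; exact hhm j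
    obtain ⟨c, hc⟩ := (s.mem_Hst_iff hA gen).mp h1
    exact ⟨c, by rw [hc, h4]⟩
  choose C hC using hpre
  have heig : ∀ v x, x ∈ Wt F A h v → ∀ j,
      ⁅h j, θ x⁆ = (∑ k, C j k * (((A *ᵥ v) k : ℤ) : F)) • θ x := by
    intro v x hx j
    rw [← hC j, ← hlie, SerreSys.span_lie_Wt v _ hx, hsm]
  have hw : ∀ i, ∃ w, θ (e i) ∈ Wt F A h w := fun i =>
    s.joint_eigen hA gen (hne0 _ (he i)) (fun j => ⟨_, heig _ _ (s.e_mem i) j⟩)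
  choose w hw using hw
  have hCw : ∀ i j, ∑ k, C j k * ((A k i : ℤ) : F) = (((A *ᵥ w i) j : ℤ) : F) := by
    intro i j
    have h1 := heig _ _ (s.e_mem i) j
    rw [hw i j] at h1
    rw [← sub_eq_zero, ← sub_smul] at h1
    have h2 := sub_eq_zero.mp ((smul_eq_zero.mp h1).resolve_right (hne0 _ (he i)))
    rw [h2]
    refine Finset.sum_congr rfl fun k _ => ?_
    simp [sr]
  set W : (ι → ℤ) → (ι → ℤ) := fun v => ∑ i, v i • w i with hW
  have hWt : ∀ v x, x ∈ Wt F A h v → θ x ∈ Wt F A h (W v) := by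
    intro v x hx j
    rw [heig v x hx j]
    congr 1
    have : (A *ᵥ W v) j = ∑ i, v i * (A *ᵥ w i) j := by
      simp only [hW]
      rw [mulVec_sum, Finset.sum_apply]
      refine Finset.sum_congr rfl fun i _ => ?_
      rw [mulVec_smul, Pi.smul_apply, smul_eq_mul]
    rw [this]
    push_cast
    simp_rw [← hCw]
    have h2 : ∀ k, (((A *ᵥ v) k : ℤ) : F) = ∑ i, (v i : F) * (A k i : F) := by
      intro k; rw [mulVec, dotProduct]; push_cast
      exact Finset.sum_congr rfl fun i _ => mul_comm _ _
    simp_rw [h2, Finset.mul_sum]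
    rw [Finset.sum_comm]
    exact Finset.sum_congr rfl fun i _ => Finset.sum_congr rfl fun k _ => by ring
  have hWsr : ∀ i, W (sr i) = w i := by
    intro i; simp [hW, sr, Pi.single_apply, ite_smul]
  have hW0 : W 0 = 0 := by simp [hW]
  have hW4 : ∀ i, W (W (W (W (sr i)))) = sr i := by
    intro i
    apply Wt_inter hA (x := e i) _ (s.e_mem i) (he i)
    have := hWt _ _ (hWt _ _ (hWt _ _ (hWt _ _ (s.e_mem i))))
    rwa [h4] at this
  have hwne : ∀ i, w i ≠ 0 := by
    intro i h0
    have := hW4 i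
    rw [hWsr, h0, hW0, hW0, hW0] at this
    exact sr_ne i this.symm
  have hwroot : ∀ i, bf A (w i) (w i) = 2 := fun i =>
    s.Wt_root hA gen (hwne i) (hw i) (hne0 _ (he i))
  -- positivity
  obtain ⟨d, hd⟩ := (s.mem_Hst_iff hA gen).mp hy
  have hμd : ∀ i, μ i = ∑ k, d k * ((A k i : ℤ) : F) := by
    intro i
    have h1 := hμ i
    rw [← hd, s.span_lie_e, ← sub_eq_zero, ← sub_smul] at h1
    exact (sub_eq_zero.mp ((smul_eq_zero.mp h1).resolve_right (he i))).symm
  have hφ : ∀ i, ∑ k, ((w i k : ℤ) : F) * μ k = μ i := by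
    intro i
    have h1 : ⁅y, θ (e i)⁆ = μ i • θ (e i) := by
      conv_lhs => rw [← hyf]
      rw [← hlie, hμ, hsm]
    rw [← hd, SerreSys.span_lie_Wt _ _ (hw i), ← sub_eq_zero, ← sub_smul] at h1
    have h2 := sub_eq_zero.mp ((smul_eq_zero.mp h1).resolve_right (hne0 _ (he i)))
    rw [← h2]
    simp_rw [hμd, mulVec, dotProduct]
    push_cast
    simp_rw [Finset.mul_sum]
    rw [Finset.sum_comm]
    exact Finset.sum_congr rfl fun i _ => Finset.sum_congr rfl fun k _ => by ring
  have hφl : ∀ i, ∑ k, ((w i k : ℤ) : ℚ) * l (μ k) = l (μ i) := by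
    intro i
    rw [← hφ i, map_sum]
    refine Finset.sum_congr rfl fun k _ => ?_
    rw [← zsmul_eq_mul, ← zsmul_eq_mul, map_zsmul]
  have hwpos : ∀ i, 0 ≤ w i := by
    intro i
    rcases nonneg_or_nonpos hA (hwroot i) with h0 | h0
    · exact h0
    · exfalso
      have h1 := hφl i
      have h2 : ∑ k, ((w i k : ℤ) : ℚ) * l (μ k) ≤ 0 := by
        apply Finset.sum_nonpos
        intro k _
        have h3 : w i k ≤ 0 := h0 k
        have h4 : ((w i k : ℤ) : ℚ) ≤ 0 := by exact_mod_cast h3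
        exact mul_nonpos_of_nonpos_of_nonneg h4 (hl k).le
      have := hl i
      linarith
  have hwht : ∀ i, 1 ≤ ht (w i) := fun i => by
    have := ht_pos (hwpos i) (hwne i); omega
  have hWpos : ∀ v, 0 ≤ v → 0 ≤ W v := by
    intro v hv
    exact Finset.sum_nonneg fun i _ => smul_nonneg (hv i) (hwpos i)
  have hWht : ∀ v, 0 ≤ v → ht v ≤ ht (W v) := by
    intro v hv
    have : ht (W v) = ∑ i, v i * ht (w i) := by
      simp only [hW, ht, Finset.sum_apply, Pi.smul_apply, smul_eq_mul]
      rw [Finset.sum_comm]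
      simp_rw [Finset.mul_sum]
    rw [this, ht]
    apply Finset.sum_le_sum
    intro i _
    exact le_mul_of_one_le_right (hv i) (hwht i)
  have hπ : ∀ i, ∃ k, w i = sr k := by
    intro i
    apply eq_sr_of_ht_one (hwpos i)
    have p1 := hwpos i
    have a1 := hWht _ p1
    have a2 := hWht _ (hWpos _ p1)
    have a3 := hWht _ (hWpos _ (hWpos _ p1))
    have a4 := hW4 i
    rw [hWsr] at a4
    rw [a4, ht_sr] at a3
    have := hwht i
    omega
  choose π hπ using hπ
  have hππ : ∀ i, π (π (π (π i))) = i := by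
    intro i
    have := hW4 i
    rw [hWsr, hπ, hWsr, hπ, hWsr, hπ, hWsr, hπ] at this
    exact sr_inj this
  have hπinj : Function.Injective π := by
    intro i j hij
    rw [← hππ i, hij, hππ]
  -- images of generators
  have hθe : ∀ i, ∃ c : F, θ (e i) = c • e (π i) := by
    intro i
    have h1 := hw i
    rw [hπ i, s.Wt_nonneg hA gen (sr_nonneg _) (sr_ne _)] at h1
    exact Ns_sr h1
  choose c hc using hθe
  have hc0 : ∀ i, c i ≠ 0 := by
    intro i h0
    apply hne0 _ (he i)
    rw [hc, h0, zero_smul]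
  have hee : ∀ i j, A i j = -1 → ⁅e i, e j⁆ ≠ 0 := by
    intro i j hij h0
    have hne : i ≠ j := by rintro rfl; rw [hA.diag] at hij; omega
    have : ⁅f i, ⁅e i, e j⁆⁆ = e j := by
      rw [leibniz_lie, s.fe, s.fe0 i j hne, lie_zero, neg_lie, s.he, hij]; simp
    rw [h0, lie_zero] at this
    exact he j this.symm
  have hbr : ∀ i j, ⁅e (π i), e (π j)⁆ = 0 ↔ ⁅e i, e j⁆ = 0 := by
    intro i j
    have h1 : θ ⁅e i, e j⁆ = (c i * c j) • ⁅e (π i), e (π j)⁆ := by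
      rw [hlie, hc, hc, smul_lie, lie_smul, smul_smul]
    constructor
    · intro h0
      rw [h0, smul_zero] at h1
      by_contra hne
      exact hne0 _ hne h1
    · intro h0
      rw [h0] at h1
      have h00 : θ (0 : S) = 0 := map_zero (θ : S →ₗ[F] S)
      rw [h00] at h1
      exact (smul_eq_zero.mp h1.symm).resolve_left (mul_ne_zero (hc0 i) (hc0 j))
  have hAπ : ∀ i j, A (π i) (π j) = A i j := by
    intro i j
    by_cases hij : i = j
    · subst hij; rw [hA.diag, hA.diag]
    · have hij' : π i ≠ π j := fun hh => hij (hπinj hh)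
      rcases hA.off i j hij with h1 | h1 <;> rcases hA.off _ _ hij' with h2 | h2
      · rw [h1, h2]
      · exact absurd ((hbr i j).mpr (s.ee0 i j h1)) (hee _ _ h2)
      · exact absurd ((hbr i j).mp (s.ee0 _ _ h2)) (hee _ _ h1)
      · rw [h1, h2]
  have hπbij : Function.Bijective π := Finite.injective_iff_bijective.mp hπinj
  have hrπ : (fun i => r (π i)) = r := by
    apply mulVec_inj hA
    ext i
    rw [hr i, ← hr (π i), mulVec, mulVec, dotProduct, dotProduct,
      ← (Equiv.ofBijective π hπbij).sum_comp (fun k => A (π i) k * r k)]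
    refine Finset.sum_congr rfl fun j _ => ?_
    rw [Equiv.ofBijective_apply, hAπ]
  have hid : ∀ i, π i = i := fun i => hri (congrFun hrπ i)
  have hθe : ∀ i, θ (e i) = c i • e i := fun i => by rw [hc, hid]
  refine ⟨fun i => ?_, fun i => ⟨c i, hθe i⟩⟩
  obtain ⟨d, hd⟩ := (s.mem_Hst_iff hA gen).mp ((hst _).mp (hhm i))
  have hz : (fun k => d k - if k = i then 1 else 0) = 0 := by
    apply cast_ker hA
    intro j
    have h1 : ⁅θ (h i), θ (e j)⁆ = θ ⁅h i, e j⁆ := (hlie _ _).symm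
    rw [s.he, hsm, hθe, ← hd, lie_smul, s.span_lie_e, smul_smul, smul_smul, ← sub_eq_zero,
      ← sub_smul] at h1
    have h2 := sub_eq_zero.mp ((smul_eq_zero.mp h1).resolve_right (he j))
    rw [mul_comm] at h2
    have h3 := mul_right_cancel₀ (hc0 j) h2
    simp [sub_mul, Finset.sum_sub_distrib, h3]
  rw [← hd]
  have : ∀ k, d k = if k = i then 1 else 0 := fun k => sub_eq_zero.mp (congrFun hz k)
  simp [this]

theorem SerreSys.exists_diag (hA : SLPD A) (s : SerreSys F A h e f)
    (gen : LieSubalgebra.lieSpan F S (Set.range e ∪ Set.range f) = ⊤) (he : ∀ i, e i ≠ 0)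
    (r : ι → ℤ) (hr : ∀ i, (A *ᵥ r) i = 1) (hri : Function.Injective r)
    (θ : S ≃ₗ⁅F⁆ S) (h4 : ∀ x, θ (θ (θ (θ x))) = x) (hst : ∀ z, z ∈ Hst F A h ↔ θ z ∈ Hst F A h)
    (hcent : ∀ z, (∀ x ∈ Hst F A h, θ x = x → ⁅x, z⁆ = 0) → z ∈ Hst F A h) :
    ∃ h' e' f' : ι → S, SerreSys F A h' e' f' ∧
      LieSubalgebra.lieSpan F S (Set.range e' ∪ Set.range f') = ⊤ ∧ (∀ i, e' i ≠ 0) ∧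
      (∀ i, θ (h' i) = h' i) ∧ ∀ i, ∃ c : F, θ (e' i) = c • e' i := by
  have li := s.linInd hA he
  have hf := s.f_ne_of hA (fun i => li.ne_zero i)
  let L : (ι → F) →ₗ[F] S := Fintype.linearCombination F h
  have hL : ∀ c, L c = ∑ i, c i • h i := fun c => Fintype.linearCombination_apply F h c
  let V : Submodule F (ι → F) :=
    LinearMap.ker ((θ : S →ₗ[F] S).comp L - L)
  have hV : ∀ c, c ∈ V ↔ θ (L c) = L c := by
    intro c
    show ((θ : S →ₗ[F] S).comp L - L) c = 0 ↔ _
    rw [LinearMap.sub_apply, sub_eq_zero]; rfl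
  let R := {v : ι → ℤ // bf A v v = 2}
  have : Finite R := (finite_roots hA).to_subtype
  let ℓ : R → Module.Dual F V := fun v =>
    (∑ i, (((A *ᵥ v.1) i : ℤ) : F) • LinearMap.proj i : (ι → F) →ₗ[F] F).comp V.subtype
  have hℓ : ∀ v c, ℓ v c = ∑ i, c.1 i * (((A *ᵥ v.1) i : ℤ) : F) := by
    intro v c
    simp [ℓ, mul_comm]
  obtain ⟨c, hc⟩ := Module.Dual.exists_forall_ne_zero_of_forall_exists ℓ (by
    intro v
    by_contra hcon
    push Not at hcon
    obtain ⟨x, hx, hx0⟩ := s.Wt_ne hA he hf v.2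
    have hxw := s.Tot_le _ hx
    have hxH : x ∈ Hst F A h := by
      apply hcent
      intro y hy hyθ
      obtain ⟨c, rfl⟩ := (s.mem_Hst_iff hA gen).mp hy
      rw [SerreSys.span_lie_Wt _ c hxw]
      have hcV : c ∈ V := by rw [hV, hL]; exact hyθ
      have h1 := hcon ⟨c, hcV⟩
      rw [hℓ] at h1
      simp only at h1
      rw [h1, zero_smul]
    have := Wt_inter hA hxw hxH hx0
    have h2 := v.2
    rw [this, bf_zero_left] at h2
    omega)
  obtain ⟨l, hl⟩ := Module.Dual.exists_forall_ne_zero_of_forall_exists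
    (K := ℚ) (M := Module.Dual ℚ F) (fun v : R => Module.Dual.eval ℚ F (ℓ v c)) (by
      intro v
      by_contra hcon
      push Not at hcon
      exact hc v ((Module.forall_dual_apply_eq_zero_iff ℚ _).mp hcon))
  let φ : (ι → ℤ) →+ ℚ :=
    { toFun := fun v => l (∑ i, c.1 i * (((A *ᵥ v) i : ℤ) : F))
      map_zero' := by simp
      map_add' := by
        intro u v
        rw [← map_add]
        congr 1
        rw [← Finset.sum_add_distrib]
        refine Finset.sum_congr rfl fun i _ => ?_
        rw [mulVec_add, Pi.add_apply]; push_cast; ring }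
  obtain ⟨g, hg, hg0⟩ := exists_dom hA r hr φ
  have hgr : ∀ i, bf A (g i) (g i) = 2 := fun i => by rw [hg, hA.diag]
  have hgpos : ∀ i, 0 < l (∑ k, c.1 k * (((A *ᵥ g i) k : ℤ) : F)) := by
    intro i
    refine lt_of_le_of_ne (hg0 i) (Ne.symm ?_)
    have := hl ⟨g i, hgr i⟩
    rw [Module.Dual.eval_apply, hℓ] at this
    exact this
  obtain ⟨e', f', s', gen', h1, he', hH⟩ := s.rebase hA gen he g hg
  have hy : L c.1 ∈ Hst F A h := (s.mem_Hst_iff hA gen).mpr ⟨c.1, (hL _).symm⟩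
  obtain ⟨p, q⟩ := s'.diag_of_dom hA gen' he' r hr hri θ h4
    (by intro z; rw [hH, hH]; exact hst z) (L c.1) ((hH _).mpr hy) ((hV _).mp c.2)
    (fun i => ∑ k, c.1 k * (((A *ᵥ g i) k : ℤ) : F))
    (by intro i; rw [hL, SerreSys.span_lie_Wt _ _ (h1 i)]) l hgpos
  exact ⟨_, e', f', s', gen', he', p, q⟩

end P5
end E8P

set_option linter.unusedSectionVars false
namespace E8P
open Matrix

section e8lat

/-- The highest root of E8. -/
def e8a : Fin 8 → ℤ := ![2, 3, 4, 6, 5, 4, 3, 2]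

/-- The inverse of the Cartan matrix of E8. -/
def e8B : Matrix (Fin 8) (Fin 8) ℤ :=
  !![4, 5, 7, 10, 8, 6, 4, 2;
     5, 8, 10, 15, 12, 9, 6, 3;
     7, 10, 14, 20, 16, 12, 8, 4;
     10, 15, 20, 30, 24, 18, 12, 6;
     8, 12, 16, 24, 20, 15, 10, 5;
     6, 9, 12, 18, 15, 12, 8, 4;
     4, 6, 8, 12, 10, 8, 6, 3;
     2, 3, 4, 6, 5, 4, 3, 2]

lemma e8_AB (n : Fin 8 → ℤ) : CartanMatrix.E₈ *ᵥ (e8B *ᵥ n) = n := by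
  ext i
  fin_cases i <;> simp [CartanMatrix.E₈, e8B, mulVec, dotProduct, Fin.sum_univ_eight] <;> ring

lemma e8_BA (n : Fin 8 → ℤ) : e8B *ᵥ (CartanMatrix.E₈ *ᵥ n) = n :=
  mulVec_inj e8_slpd (e8_AB _)

lemma e8_pair (n v : Fin 8 → ℤ) : bf CartanMatrix.E₈ (e8B *ᵥ n) v = n ⬝ᵥ v := by
  rw [bf_comm e8_slpd, bf, e8_AB, dotProduct_comm]

lemma e8a_norm : bf CartanMatrix.E₈ e8a e8a = 2 := by
  have := e8_bf e8a
  simp [e8a] at this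
  simp [e8a]
  omega

lemma e8_dominant {u : Fin 8 → ℤ} (hu : bf CartanMatrix.E₈ u u = 2)
    (hd : ∀ i, 0 ≤ bf CartanMatrix.E₈ (sr i) u) : u = e8a := by
  set d := CartanMatrix.E₈ *ᵥ u with hdd
  have hd0 : ∀ i, 0 ≤ d i := fun i => by rw [hdd, ← bf_sr_left]; exact hd i
  have hud : u = e8B *ᵥ d := (e8_BA u).symm
  have h1 : u ⬝ᵥ d = 2 := hu
  have c0 := hd0 0
  have c1 := hd0 1
  have c2 := hd0 2
  have c3 := hd0 3
  have c4 := hd0 4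
  have c5 := hd0 5
  have c6 := hd0 6
  have c7 := hd0 7
  have hS : ∀ i, 2 * (d 0 + d 1 + d 2 + d 3 + d 4 + d 5 + d 6 + d 7) ≤ u i := by
    intro i
    rw [hud]
    fin_cases i <;> simp [e8B, mulVec, dotProduct, Fin.sum_univ_eight] <;> linarith
  generalize hs : d 0 + d 1 + d 2 + d 3 + d 4 + d 5 + d 6 + d 7 = D at hS
  have hD : 2 * D * D ≤ 2 := by
    have hq := h1
    rw [dotProduct, Fin.sum_univ_eight] at hq
    have hm : ∀ i, 2 * D * d i ≤ u i * d i := fun i => mul_le_mul_of_nonneg_right (hS i) (hd0 i)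
    have := hm 0
    have := hm 1
    have := hm 2
    have := hm 3
    have := hm 4
    have := hm 5
    have := hm 6
    have := hm 7
    rw [show 2 * D * D = 2 * D * d 0 + 2 * D * d 1 + 2 * D * d 2 + 2 * D * d 3 + 2 * D * d 4 +
      2 * D * d 5 + 2 * D * d 6 + 2 * D * d 7 by nth_rewrite 2 [← hs]; ring]
    linarith
  have hD1 : D ≤ 1 := by nlinarith
  have hD0 : D ≠ 0 := by
    rintro rfl
    have hdz : d = 0 := by
      ext i
      fin_cases i <;> simp <;> omega
    rw [hdz, dotProduct_zero] at h1
    omega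
  have h7 : d 0 = 0 ∧ d 1 = 0 ∧ d 2 = 0 ∧ d 3 = 0 ∧ d 4 = 0 ∧ d 5 = 0 ∧ d 6 = 0 := by
    have hq : u ⬝ᵥ d = d ⬝ᵥ (e8B *ᵥ d) := by rw [← hud, dotProduct_comm]
    rw [h1] at hq
    simp [e8B, mulVec, dotProduct, Fin.sum_univ_eight] at hq
    have hDD : D = 1 := by omega
    rw [hDD] at hs
    have hcase : ∀ x y z : ℤ, 0 ≤ x → 0 ≤ y → x + y = 1 → True := fun _ _ _ _ _ _ => trivial
    have k0 : d 0 = 0 ∨ d 0 = 1 := by omega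
    have k1 : d 1 = 0 ∨ d 1 = 1 := by omega
    have k2 : d 2 = 0 ∨ d 2 = 1 := by omega
    have k3 : d 3 = 0 ∨ d 3 = 1 := by omega
    have k4 : d 4 = 0 ∨ d 4 = 1 := by omega
    have k5 : d 5 = 0 ∨ d 5 = 1 := by omega
    have k6 : d 6 = 0 ∨ d 6 = 1 := by omega
    refine ⟨?_, ?_, ?_, ?_, ?_, ?_, ?_⟩
    · rcases k0 with k | k
      · exact k
      · rw [k, show d 1 = 0 by omega, show d 2 = 0 by omega, show d 3 = 0 by omega, show d 4 = 0 by omega, show d 5 = 0 by omega, show d 6 = 0 by omega, show d 7 = 0 by omega] at hq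
        norm_num at hq
    · rcases k1 with k | k
      · exact k
      · rw [k, show d 0 = 0 by omega, show d 2 = 0 by omega, show d 3 = 0 by omega, show d 4 = 0 by omega, show d 5 = 0 by omega, show d 6 = 0 by omega, show d 7 = 0 by omega] at hq
        norm_num at hq
    · rcases k2 with k | k
      · exact k
      · rw [k, show d 0 = 0 by omega, show d 1 = 0 by omega, show d 3 = 0 by omega, show d 4 = 0 by omega, show d 5 = 0 by omega, show d 6 = 0 by omega, show d 7 = 0 by omega] at hq
        norm_num at hq
    · rcases k3 with k | k
      · exact k
      · rw [k, show d 0 = 0 by omega, show d 1 = 0 by omega, show d 2 = 0 by omega, show d 4 = 0 by omega, show d 5 = 0 by omega, show d 6 = 0 by omega, show d 7 = 0 by omega] at hq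
        norm_num at hq
    · rcases k4 with k | k
      · exact k
      · rw [k, show d 0 = 0 by omega, show d 1 = 0 by omega, show d 2 = 0 by omega, show d 3 = 0 by omega, show d 5 = 0 by omega, show d 6 = 0 by omega, show d 7 = 0 by omega] at hq
        norm_num at hq
    · rcases k5 with k | k
      · exact k
      · rw [k, show d 0 = 0 by omega, show d 1 = 0 by omega, show d 2 = 0 by omega, show d 3 = 0 by omega, show d 4 = 0 by omega, show d 6 = 0 by omega, show d 7 = 0 by omega] at hq
        norm_num at hq
    · rcases k6 with k | k
      · exact k
      · rw [k, show d 0 = 0 by omega, show d 1 = 0 by omega, show d 2 = 0 by omega, show d 3 = 0 by omega, show d 4 = 0 by omega, show d 5 = 0 by omega, show d 7 = 0 by omega] at hq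
        norm_num at hq
  obtain ⟨d0, d1, d2, d3, d4, d5, d6⟩ := h7
  have d7 : d 7 = 1 := by omega
  rw [hud]
  ext i
  fin_cases i <;> simp [e8B, e8a, mulVec, dotProduct, Fin.sum_univ_eight, d0, d1, d2, d3, d4, d5, d6, d7]

lemma e8_le_high {v : Fin 8 → ℤ} (h0 : 0 ≤ v) (hv : bf CartanMatrix.E₈ v v = 2) : v ≤ e8a := by
  set T : Set (Fin 8 → ℤ) := {u | bf CartanMatrix.E₈ u u = 2 ∧ v ≤ u} with hT
  have hfin : T.Finite := (finite_roots e8_slpd).subset fun u hu => hu.1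
  obtain ⟨u, hu, hmax⟩ := Set.exists_max_image T ht hfin ⟨v, hv, le_refl v⟩
  have : u = e8a := by
    apply e8_dominant hu.1
    intro i
    by_contra hneg
    push Not at hneg
    have h2 := neg_two_le_bf e8_slpd (sr_norm e8_slpd i) hu.1
    have h3 : bf CartanMatrix.E₈ (sr i) u ≠ -2 := by
      intro h
      have h4 := eq_neg_of_bf_two e8_slpd (sr_norm e8_slpd i) hu.1 h.le
      have h5 := congrFun h4 i
      have h6 := h0.trans hu.2 i
      simp [sr] at h5
      simp at h6
      omega
    have h4 : bf CartanMatrix.E₈ (sr i) u = -1 := by omega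
    have h5 : u + sr i ∈ T := by
      refine ⟨?_, hu.2.trans (le_add_of_nonneg_right (sr_nonneg i))⟩
      rw [bf_add_sq e8_slpd, bf_comm e8_slpd u (sr i), h4, hu.1, sr_norm e8_slpd]
      norm_num
    have h6 := hmax _ h5
    rw [ht_add, ht_sr] at h6
    omega
  rw [← this]
  exact hu.2

/-- Combinatorial heart: Kac coordinates of an automorphism of order four. -/
lemma e8_combin (t : Fin 8 → ℤ) (ht0 : ∀ i, 0 ≤ t i) (hta : t ⬝ᵥ e8a ≤ 4) (hne : t ≠ 0)
    (hne2 : ¬ ∀ i, 2 ∣ t i)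
    (hc : ∀ n : Fin 8 → ℤ, (∀ v, bf CartanMatrix.E₈ v v = 2 → 4 ∣ t ⬝ᵥ v → n ⬝ᵥ v = 0) → n = 0) :
    t = Pi.single 2 1 ∨ t = Pi.single 5 1 := by
  -- reduce the criterion to positive roots
  have hc' : ∀ n : Fin 8 → ℤ, (∀ v, 0 ≤ v → v ≤ e8a → (t ⬝ᵥ v = 0 ∨ t ⬝ᵥ v = 4 ∧ t ⬝ᵥ e8a = 4) →
      n ⬝ᵥ v = 0) → n = 0 := by
    intro n hn
    apply hc
    have key : ∀ v, 0 ≤ v → bf CartanMatrix.E₈ v v = 2 → 4 ∣ t ⬝ᵥ v → n ⬝ᵥ v = 0 := by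
      intro v h0 hv h4
      have hle := e8_le_high h0 hv
      apply hn v h0 hle
      have h1 : 0 ≤ t ⬝ᵥ v := Finset.sum_nonneg fun i _ => mul_nonneg (ht0 i) (h0 i)
      have h2 : t ⬝ᵥ v ≤ t ⬝ᵥ e8a :=
        Finset.sum_le_sum fun i _ => mul_le_mul_of_nonneg_left (hle i) (ht0 i)
      omega
    intro v hv h4
    rcases nonneg_or_nonpos e8_slpd hv with h0 | h0
    · exact key v h0 hv h4
    · have := key (-v) (by simpa using h0) (by simpa [bf_neg_left, bf_neg_right] using hv)
        (by rw [dotProduct_neg]; exact (dvd_neg).mpr h4)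
      rw [dotProduct_neg] at this
      omega
  have hzero : ∀ v : Fin 8 → ℤ, 0 ≤ v → t ⬝ᵥ v = 0 → ∀ j, 0 < t j → v j = 0 := by
    intro v h0 h j hj
    have := (Finset.sum_eq_zero_iff_of_nonneg (fun i _ => mul_nonneg (ht0 i) (h0 i))).mp h j
      (Finset.mem_univ j)
    rcases mul_eq_zero.mp this with h | h
    · omega
    · exact h
  have hfour : ∀ v : Fin 8 → ℤ, v ≤ e8a → t ⬝ᵥ v = 4 → t ⬝ᵥ e8a = 4 → ∀ j, 0 < t j →
      v j = e8a j := by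
    intro v h0 h h4 j hj
    have := hzero (e8a - v) (by simpa using h0) (by rw [dotProduct_sub]; omega) j hj
    simp at this
    omega
  have heq : ∃ j, 0 < t j := by
    by_contra hcon
    push Not at hcon
    exact hne (funext fun i => le_antisymm (hcon i) (ht0 i))
  obtain ⟨j, hj⟩ := heq
  have hsum : t ⬝ᵥ e8a = 4 := by
    by_contra hlt
    have := hc' (sr j) (by
      intro v h0 hle hcase
      have h1 : t ⬝ᵥ v = 0 := by
        rcases hcase with h | h
        · exact h
        · exact absurd h.2 hlt
      have := hzero v h0 h1 j hj
      simpa [sr] using this)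
    exact sr_ne j this
  have huniq : ∀ k, 0 < t k → k = j := by
    intro k hk
    by_contra hkj
    have := hc' (e8a k • sr j - e8a j • sr k) (by
      intro v h0 hle hcase
      rw [sub_dotProduct, smul_dotProduct, smul_dotProduct]
      simp only [sr, single_one_dotProduct, smul_eq_mul]
      rcases hcase with h | h
      · rw [hzero v h0 h j hj, hzero v h0 h k hk]; ring
      · rw [hfour v hle h.1 h.2 j hj, hfour v hle h.1 h.2 k hk]; ring)
    have h2 := congrFun this j
    simp [sr, Pi.single_apply, hkj, Ne.symm hkj] at h2
    revert h2
    fin_cases k <;> simp [e8a]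
  have ht : ∀ i, i ≠ j → t i = 0 := by
    intro i hij
    by_contra h
    exact hij (huniq i (lt_of_le_of_ne (ht0 i) (Ne.symm h)))
  have hts : t = Pi.single j (t j) := by
    ext i
    by_cases hij : i = j
    · subst hij; simp
    · rw [ht i hij]; simp [hij]
  have hja : t j * e8a j = 4 := by
    rw [hts, single_dotProduct] at hsum
    exact hsum
  have hodd : ¬ 2 ∣ t j := by
    intro h2
    apply hne2
    intro i
    by_cases hij : i = j
    · subst hij; exact h2
    · rw [ht i hij]; exact dvd_zero 2
  fin_cases j <;> simp [e8a] at hja hodd hts ⊢ <;> try omega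
  · left; rw [hts]; congr 1
  · right; rw [hts]; congr 1

end e8lat
end E8P

set_option linter.unusedSectionVars false
namespace E8P
open Matrix

section P6
variable {ι : Type} [Fintype ι] [DecidableEq ι] {F : Type} [Field F] [CharZero F]
  {S : Type} [LieRing S] [LieAlgebra F S] {A : Matrix ι ι ℤ} {h e f : ι → S}

lemma theta_Ns (θ : S ≃ₗ⁅F⁆ S) {ζ : F} (hζ : ζ ≠ 0) (t : ι → ℤ)
    (hθ : ∀ i, θ (e i) = ζ ^ (t i) • e i) (v : ι → ℤ) :
    ∀ x ∈ Ns F e v, θ x = ζ ^ (t ⬝ᵥ v) • x := by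
  have hsm : ∀ (c : F) x, θ (c • x) = c • θ x := fun c x => map_smul (θ : S →ₗ[F] S) c x
  have hadd : ∀ x y, θ (x + y) = θ x + θ y := fun x y => map_add (θ : S →ₗ[F] S) x y
  have h00 : θ (0 : S) = 0 := map_zero (θ : S →ₗ[F] S)
  apply Ns_induction
  · rw [h00, smul_zero]
  · intro x y hx hy; rw [hadd, hx, hy, smul_add]
  · intro c x hx; rw [hsm, hx, smul_comm]
  · intro x m
    induction m with
    | base i => rw [hθ]; simp [sr]
    | step i m ih =>
      rw [LieEquiv.map_lie, hθ, ih, smul_lie, lie_smul, smul_smul, dotProduct_add, ← zpow_add₀ hζ]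
      congr 2
      simp [sr, add_comm]

lemma SerreSys.theta_f (hA : SLPD A) (s : SerreSys F A h e f)
    (gen : LieSubalgebra.lieSpan F S (Set.range e ∪ Set.range f) = ⊤) (he : ∀ i, e i ≠ 0)
    (θ : S ≃ₗ⁅F⁆ S) (hh : ∀ i, θ (h i) = h i) {c : ι → F} (hc : ∀ i, c i ≠ 0)
    (hθ : ∀ i, θ (e i) = c i • e i) (i : ι) : θ (f i) = (c i)⁻¹ • f i := by
  have hsm : ∀ (c : F) x, θ (c • x) = c • θ x := fun c x => map_smul (θ : S →ₗ[F] S) c x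
  have h1 : θ (f i) ∈ Wt F A h (-sr i) := by
    intro j
    conv_lhs => rw [← hh j]
    rw [← LieEquiv.map_lie, s.f_mem i j, hsm]
  rw [s.Wt_nonpos hA gen (by simpa using sr_nonneg i) (by simpa using sr_ne i), neg_neg] at h1
  obtain ⟨d, hd⟩ := Ns_sr h1
  have h2 : θ ⁅e i, f i⁆ = h i := by rw [s.ef, hh]
  rw [LieEquiv.map_lie, hθ, hd, smul_lie, lie_smul, s.ef, smul_smul] at h2
  have h3 : (c i * d - 1) • h i = 0 := by rw [sub_smul, h2, one_smul, sub_self]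
  have h4 := (smul_eq_zero.mp h3).resolve_right ((s.linInd hA he).ne_zero i)
  rw [hd, eq_inv_of_mul_eq_one_right (sub_eq_zero.mp h4)]

/-- The action on weight spaces of an automorphism fixing the Cartan subalgebra. -/
theorem SerreSys.theta_Wt (hA : SLPD A) (s : SerreSys F A h e f)
    (gen : LieSubalgebra.lieSpan F S (Set.range e ∪ Set.range f) = ⊤) (he : ∀ i, e i ≠ 0)
    (θ : S ≃ₗ⁅F⁆ S) (hh : ∀ i, θ (h i) = h i) {ζ : F} (hζ : ζ ≠ 0) (t : ι → ℤ)
    (hθ : ∀ i, θ (e i) = ζ ^ (t i) • e i) (v : ι → ℤ) :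
    ∀ x ∈ Wt F A h v, θ x = ζ ^ (t ⬝ᵥ v) • x := by
  intro x hx
  have hsm : ∀ (c : F) x, θ (c • x) = c • θ x := fun c x => map_smul (θ : S →ₗ[F] S) c x
  have h00 : θ (0 : S) = 0 := map_zero (θ : S →ₗ[F] S)
  by_cases hx0 : x = 0
  · rw [hx0, h00, smul_zero]
  by_cases hv : v = 0
  · subst hv
    obtain ⟨c, rfl⟩ := (s.mem_Hst_iff hA gen).mp hx
    have : θ (∑ i, c i • h i) = ∑ i, θ (c i • h i) := map_sum (θ : S →ₗ[F] S) _ _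
    rw [this]
    simp [hsm, hh]
  rcases nonneg_or_nonpos hA (s.Wt_root hA gen hv hx hx0) with h0 | h0
  · rw [s.Wt_nonneg hA gen h0 hv] at hx
    exact theta_Ns θ hζ t hθ v x hx
  · rw [s.Wt_nonpos hA gen h0 hv] at hx
    have := theta_Ns (e := f) θ hζ (-t) (fun i => by
      rw [s.theta_f hA gen he θ hh (fun i => zpow_ne_zero (t i) hζ) hθ i, Pi.neg_apply, _root_.zpow_neg])
      (-v) x hx
    rwa [neg_dotProduct_neg] at this

lemma SerreSys.ext_Wt (s : SerreSys F A h e f)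
    (gen : LieSubalgebra.lieSpan F S (Set.range e ∪ Set.range f) = ⊤) (α β : S →ₗ[F] S)
    (hab : ∀ v, ∀ x ∈ Wt F A h v, α x = β x) (x : S) : α x = β x := by
  obtain ⟨t, y, hy, rfl⟩ := s.decomp gen x
  rw [map_sum, map_sum]
  exact Finset.sum_congr rfl fun v _ => hab v _ (s.Tot_le v (hy v))

lemma fourth_root {ζ c : F} (hζ : ζ ^ 2 = -1) (hc : c ^ 4 = 1) : ∃ n : ℤ, c = ζ ^ n := by
  have h1 : (c - 1) * (c + 1) * ((c - ζ) * (c + ζ)) = 0 := by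
    linear_combination hc - (c ^ 2 - 1) * hζ
  have h3 : ζ ^ 3 = -ζ := by rw [pow_succ, hζ]; ring
  rcases mul_eq_zero.mp h1 with h | h <;> rcases mul_eq_zero.mp h with h | h
  · exact ⟨0, by rw [zpow_zero]; exact sub_eq_zero.mp h⟩
  · refine ⟨2, ?_⟩
    rw [show (2 : ℤ) = ((2 : ℕ) : ℤ) by rfl, zpow_natCast, hζ]; linear_combination h
  · exact ⟨1, by rw [zpow_one]; exact sub_eq_zero.mp h⟩
  · refine ⟨3, ?_⟩
    rw [show (3 : ℤ) = ((3 : ℕ) : ℤ) by rfl, zpow_natCast, h3]; linear_combination h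

lemma zpow_four {ζ : F} (hζ : ζ ^ 2 = -1) (n : ℤ) : ζ ^ (4 * n) = 1 := by
  rw [_root_.zpow_mul, show (4 : ℤ) = ((4 : ℕ) : ℤ) by rfl, zpow_natCast,
    show ζ ^ 4 = (ζ ^ 2) ^ 2 by ring, hζ]
  simp

lemma zeta_ne {ζ : F} (hζ : ζ ^ 2 = -1) : ζ ≠ 0 := by
  rintro rfl; norm_num at hζ

lemma four_dvd {ζ : F} (hζ : ζ ^ 2 = -1) {n : ℤ} (hn : ζ ^ n = 1) : 4 ∣ n := by
  have hz := zeta_ne hζ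
  have h1 : ζ ^ (n % 4) = 1 := by
    rw [← hn]
    conv_rhs => rw [← Int.emod_add_mul_ediv n 4]
    rw [zpow_add₀ hz, zpow_four hζ, mul_one]
  have h2 := Int.emod_nonneg n (show (4 : ℤ) ≠ 0 by norm_num)
  have h3 := Int.emod_lt_of_pos n (show (0 : ℤ) < 4 by norm_num)
  apply Int.dvd_of_emod_eq_zero
  generalize n % 4 = m at *
  interval_cases m
  · rfl
  · exfalso
    rw [zpow_one] at h1
    rw [h1] at hζ; norm_num at hζ
  · exfalso
    rw [show (2 : ℤ) = ((2 : ℕ) : ℤ) by rfl, zpow_natCast, hζ] at h1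
    norm_num at h1
  · exfalso
    rw [show (3 : ℤ) = ((3 : ℕ) : ℤ) by rfl, zpow_natCast, pow_succ, hζ] at h1
    have : ζ = -1 := by linear_combination -h1
    rw [this] at hζ; norm_num at hζ

end P6

section P6e8
variable {F : Type} [Field F] [CharZero F] {S : Type} [LieRing S] [LieAlgebra F S]
  {h e f : Fin 8 → S}


lemma e8r (i : Fin 8) : (CartanMatrix.E₈ *ᵥ (e8B *ᵥ 1)) i = 1 := by rw [e8_AB]; rfl

lemma e8r_inj : Function.Injective (e8B *ᵥ (1 : Fin 8 → ℤ)) := by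
  have : e8B *ᵥ (1 : Fin 8 → ℤ) = ![46, 68, 91, 135, 110, 84, 57, 29] := by
    ext i; fin_cases i <;> simp [e8B, mulVec, dotProduct, Fin.sum_univ_eight]
  rw [this]
  decide

theorem e8_reduce (s : SerreSys F CartanMatrix.E₈ h e f)
    (gen : LieSubalgebra.lieSpan F S (Set.range e ∪ Set.range f) = ⊤) (he : ∀ i, e i ≠ 0)
    (θ : S ≃ₗ⁅F⁆ S) (h4 : ∀ x, θ (θ (θ (θ x))) = x) (hh : ∀ i, θ (h i) = h i)
    (hc : ∀ i, ∃ c : F, θ (e i) = c • e i) {ζ : F} (hζ : ζ ^ 2 = -1) :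
    ∃ (h' e' f' : Fin 8 → S) (t : Fin 8 → ℤ), SerreSys F CartanMatrix.E₈ h' e' f' ∧
      LieSubalgebra.lieSpan F S (Set.range e' ∪ Set.range f') = ⊤ ∧ (∀ i, e' i ≠ 0) ∧
      (∀ i, θ (h' i) = h' i) ∧ (∀ i, θ (e' i) = ζ ^ (t i) • e' i) ∧ (∀ i, 0 ≤ t i) ∧
      t ⬝ᵥ e8a ≤ 4 := by
  have hz := zeta_ne hζ
  have hsm : ∀ (c : F) x, θ (c • x) = c • θ x := fun c x => map_smul (θ : S →ₗ[F] S) c x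
  have hx : ∀ i, ∃ n : ℤ, θ (e i) = ζ ^ n • e i := by
    intro i
    obtain ⟨c, hc⟩ := hc i
    have h1 := h4 (e i)
    simp only [hc, hsm] at h1
    have h2 : (c ^ 4 - 1) • e i = 0 := by
      rw [sub_smul, one_smul]
      nth_rewrite 2 [← h1]
      rw [smul_smul, smul_smul, smul_smul, ← sub_smul]
      ring_nf; simp
    obtain ⟨n, hn⟩ := fourth_root hζ (sub_eq_zero.mp ((smul_eq_zero.mp h2).resolve_right (he i)))
    exact ⟨n, by rw [hc, hn]⟩
  choose x hx using hx
  have hact := s.theta_Wt e8_slpd gen he θ hh hz x hx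
  let P : (Fin 8 → ℤ) → Prop := fun X => ∀ v, ∀ y ∈ Wt F CartanMatrix.E₈ h v, θ y = ζ ^ (bf CartanMatrix.E₈ X v) • y
  have hP0 : P (e8B *ᵥ x) := by
    intro v y hy
    rw [hact v y hy, e8_pair]
  -- minimal representative
  obtain ⟨X, hX, hmin⟩ : ∃ X, P X ∧ ∀ Y, P Y → bf CartanMatrix.E₈ X X ≤ bf CartanMatrix.E₈ Y Y := by
    have hne : {n : ℕ | ∃ X, P X ∧ bf CartanMatrix.E₈ X X = n}.Nonempty :=
      ⟨(bf CartanMatrix.E₈ (e8B *ᵥ x) (e8B *ᵥ x)).toNat, _, hP0, (Int.toNat_of_nonneg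
        (bf_self_nonneg e8_slpd _)).symm⟩
    obtain ⟨X, hX, hXn⟩ := Nat.sInf_mem hne
    refine ⟨X, hX, fun Y hY => ?_⟩
    rw [hXn]
    have h1 := Int.toNat_of_nonneg (bf_self_nonneg e8_slpd Y)
    have := Nat.sInf_le (show (bf CartanMatrix.E₈ Y Y).toNat ∈ {n : ℕ | ∃ X, P X ∧ bf CartanMatrix.E₈ X X = n} from
      ⟨Y, hY, h1.symm⟩)
    omega
  have hle : ∀ α, bf CartanMatrix.E₈ α α = 2 → bf CartanMatrix.E₈ X α ≤ 4 := by
    intro α hα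
    have hP : P (X - (4 : ℤ) • α) := by
      intro v y hy
      rw [hX v y hy, bf_sub_left, bf_smul_left, zpow_sub₀ hz, zpow_four hζ, div_one]
    have := hmin _ hP
    rw [bf_sub_sq e8_slpd, bf_smul_right, bf_smul_right, bf_smul_left, hα] at this
    omega
  let φ : (Fin 8 → ℤ) →+ ℚ :=
    { toFun := fun v => ((bf CartanMatrix.E₈ X v : ℤ) : ℚ)
      map_zero' := by simp [bf_zero_right]
      map_add' := by intro u v; rw [bf_add_right]; push_cast; rfl }
  obtain ⟨g, hg, hg0⟩ := exists_dom e8_slpd _ e8r φ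
  obtain ⟨e', f', s', gen', h1, he', hH⟩ := s.rebase e8_slpd gen he g hg
  refine ⟨_, e', f', fun i => bf CartanMatrix.E₈ X (g i), s', gen', he', ?_, ?_, ?_, ?_⟩
  · intro i
    have : hvec F h (g i) ∈ Wt F CartanMatrix.E₈ h 0 := (s.mem_Hst_iff e8_slpd gen).mpr ⟨_, rfl⟩
    have := hX 0 _ this
    rw [this, bf_zero_right]; simp
  · intro i; exact hX _ _ (h1 i)
  · intro i
    have h2 : (0 : ℚ) ≤ ((bf CartanMatrix.E₈ X (g i) : ℤ) : ℚ) := hg0 i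
    exact_mod_cast h2
  · have hb : ∀ u, bf CartanMatrix.E₈ (∑ i, e8a i • g i) u = ∑ i, e8a i * bf CartanMatrix.E₈ (g i) u := by
      intro u
      rw [bf_sum_left]
      exact Finset.sum_congr rfl fun i _ => bf_smul_left _ _ _
    have hroot : bf CartanMatrix.E₈ (∑ i, e8a i • g i) (∑ i, e8a i • g i) = 2 := by
      rw [hb, ← e8a_norm, bf, dotProduct]
      refine Finset.sum_congr rfl fun i _ => ?_
      rw [bf_comm e8_slpd, hb, mulVec, dotProduct]
      congr 1
      refine Finset.sum_congr rfl fun j _ => ?_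
      rw [hg, e8_slpd.symm, mul_comm]
    have := hle _ hroot
    rw [bf_comm e8_slpd, hb] at this
    rw [dotProduct]
    refine le_trans (le_of_eq (Finset.sum_congr rfl fun i _ => ?_)) this
    rw [bf_comm e8_slpd, mul_comm]

/-- Kac coordinates. -/
theorem e8_kac (s : SerreSys F CartanMatrix.E₈ h e f)
    (gen : LieSubalgebra.lieSpan F S (Set.range e ∪ Set.range f) = ⊤) (he : ∀ i, e i ≠ 0)
    (θ : S ≃ₗ⁅F⁆ S) (hh : ∀ i, θ (h i) = h i) {ζ : F} (hζ : ζ ^ 2 = -1) (t : Fin 8 → ℤ)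
    (ht : ∀ i, θ (e i) = ζ ^ (t i) • e i) (ht0 : ∀ i, 0 ≤ t i) (hta : t ⬝ᵥ e8a ≤ 4)
    (h2 : ¬ ∀ x, θ (θ x) = x)
    (hcen : ∀ y, θ y = y → (∀ z, θ z = z → ⁅y, z⁆ = 0) → y = 0) :
    t = Pi.single 2 1 ∨ t = Pi.single 5 1 := by
  have hz := zeta_ne hζ
  have hsm : ∀ (c : F) x, θ (c • x) = c • θ x := fun c x => map_smul (θ : S →ₗ[F] S) c x
  have hact := s.theta_Wt e8_slpd gen he θ hh hz t ht
  have li := s.linInd e8_slpd he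
  have hno2 : ¬ ∀ i, 2 ∣ t i := by
    intro hd
    apply h2
    intro x
    refine s.ext_Wt gen ((θ : S →ₗ[F] S).comp (θ : S →ₗ[F] S)) LinearMap.id ?_ x
    intro v x hx
    show θ (θ x) = x
    rw [hact v x hx, hsm, hact v x hx, smul_smul, ← zpow_add₀ hz]
    have : 2 ∣ t ⬝ᵥ v := Finset.dvd_sum fun i _ => Dvd.dvd.mul_right (hd i) _
    obtain ⟨k, hk⟩ := this
    rw [hk, show 2 * k + 2 * k = 4 * k by ring, zpow_four hζ, one_smul]
  apply e8_combin t ht0 hta _ hno2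
  · intro n hn
    have hY : hvec F h (e8B *ᵥ n) = 0 := by
      apply hcen
      · have h0 : hvec F h (e8B *ᵥ n) ∈ Wt F CartanMatrix.E₈ h 0 := (s.mem_Hst_iff e8_slpd gen).mpr ⟨_, rfl⟩
        rw [hact 0 _ h0]; simp
      · intro z hzf
        obtain ⟨T, y, hy, rfl⟩ := s.decomp gen z
        have key := comp_mem (h := h) e8_slpd (LinearMap.ker ((θ : S →ₗ[F] S) - LinearMap.id)) (by
          intro i x hx
          have hx' : θ x = x := sub_eq_zero.mp hx
          refine sub_eq_zero.mpr ?_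
          show θ ⁅h i, x⁆ = ⁅h i, x⁆
          rw [LieEquiv.map_lie, hh, hx']) T y (fun v _ => s.Tot_le v (hy v))
          (LinearMap.mem_ker.mpr (sub_eq_zero.mpr hzf))
        rw [lie_sum]
        refine Finset.sum_eq_zero fun v hv => ?_
        have hyv := s.Tot_le v (hy v)
        rw [hvec_lie _ hyv, e8_pair]
        by_cases hy0 : y v = 0
        · rw [hy0, smul_zero]
        · have h1 : θ (y v) = y v := sub_eq_zero.mp (key v hv)
          rw [hact v _ hyv] at h1
          have h3 : (ζ ^ (t ⬝ᵥ v) - 1) • y v = 0 := by rw [sub_smul, h1, one_smul, sub_self]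
          have h4 := four_dvd hζ (sub_eq_zero.mp ((smul_eq_zero.mp h3).resolve_right hy0))
          by_cases hv0 : v = 0
          · rw [hv0]; simp
          · rw [hn v (s.Wt_root e8_slpd gen hv0 hyv hy0) h4]; simp
    by_contra hn0
    refine hvec_ne li ?_ hY
    intro h0
    apply hn0
    rw [← e8_AB n, h0, mulVec_zero]
  · rintro rfl
    exact hno2 fun i => dvd_zero 2

end P6e8
end E8P

set_option linter.unusedSectionVars false
namespace E8P
open Matrix

section P7
variable {ι : Type} [Fintype ι] [DecidableEq ι] {F : Type} [Field F] [CharZero F]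
  {S : Type} [LieRing S] [LieAlgebra F S] {A : Matrix ι ι ℤ} {h e f : ι → S}
variable {κ : Type} [Fintype κ] [DecidableEq κ] {A' : Matrix κ κ ℤ}

lemma hvec_sum (n : κ → ℤ) (w : κ → (ι → ℤ)) :
    hvec F h (∑ a, n a • w a) = ∑ a, (n a : F) • hvec F h (w a) := by
  simp only [← hvec_zsmul]
  simp only [hvec]
  rw [Finset.sum_comm]
  refine Finset.sum_congr rfl fun i _ => ?_
  rw [← Finset.sum_smul]
  congr 1
  simp

lemma bf_sum_right' (u : ι → ℤ) (n : κ → ℤ) (w : κ → (ι → ℤ)) :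
    bf A u (∑ a, n a • w a) = ∑ a, bf A u (w a) * n a := by
  rw [bf, mulVec_sum, dotProduct_sum]
  refine Finset.sum_congr rfl fun a _ => ?_
  rw [mulVec_smul, dotProduct_smul, bf, smul_eq_mul, mul_comm]

/-- A regular subalgebra of maximal rank is given by the Serre presentation. -/
theorem SerreSys.sub_equiv (hA : SLPD A) (s : SerreSys F A h e f)
    (gen : LieSubalgebra.lieSpan F S (Set.range e ∪ Set.range f) = ⊤) (he : ∀ i, e i ≠ 0)
    (hf : ∀ i, f i ≠ 0)
    (hA' : SLPD A') (w : κ → (ι → ℤ)) (hw : ∀ a b, bf A (w a) (w b) = A' a b)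
    (K : LieSubalgebra F S) (P : (ι → ℤ) → Prop)
    (hKw : ∀ v, P v → ∀ x ∈ Wt F A h v, x ∈ K)
    (hKP : ∀ v, ∀ x ∈ Wt F A h v, x ∈ K → x ≠ 0 → P v) (hP0 : P 0)
    (hPw : ∀ a, P (w a)) (hPw' : ∀ a, P (-w a))
    (hex : ∀ v, bf A v v = 2 → P v → ∃ n : κ → ℤ, v = ∑ a, n a • w a)
    (hspan : ∀ i, ∃ c : κ → F, h i = ∑ a, c a • hvec F h (w a)) :
    Nonempty (A'.ToLieAlgebra F ≃ₗ⁅F⁆ K) := by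
  obtain ⟨e', f', s', he', hf'⟩ := s.newsys hA gen hA' w hw
  have li := s.linInd hA he
  have hne : ∀ a, hvec F h (w a) ≠ 0 := fun a => hvec_ne li (by
    intro h0; have := hw a a; rw [h0, bf_zero_left, hA'.diag] at this; omega)
  have li' := s'.linInd hA' (s'.e_ne_of hA' hne)
  obtain ⟨φ, h1, h2, h3⟩ := exists_lift hA' s'
  have inj : Function.Injective φ := by
    apply serreSys_std.injective_of_linInd hA' gen_std
    simpa only [h1] using li'
  have hhK : ∀ i, h i ∈ K := fun i => hKw 0 hP0 _ (s.h_mem i)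
  have hle : φ.range ≤ K := by
    rintro _ ⟨x, rfl⟩
    have hx : x ∈ LieSubalgebra.lieSpan F (A'.ToLieAlgebra F)
      (Set.range (sE F A') ∪ Set.range (sF F A')) := by rw [gen_std]; trivial
    have : LieSubalgebra.lieSpan F (A'.ToLieAlgebra F)
      (Set.range (sE F A') ∪ Set.range (sF F A')) ≤ K.comap φ := by
      rw [LieSubalgebra.lieSpan_le]
      rintro _ (⟨i, rfl⟩ | ⟨i, rfl⟩)
      · show φ _ ∈ K
        rw [h2]; exact hKw _ (hPw i) _ (he' i)
      · show φ _ ∈ K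
        rw [h3]; exact hKw _ (hPw' i) _ (hf' i)
    exact this hx
  have hHr : ∀ i, h i ∈ φ.range := by
    intro i
    obtain ⟨c, hc⟩ := hspan i
    rw [hc]
    refine sum_mem fun a _ => ?_
    exact φ.range.smul_mem _ ⟨sH F A' a, h1 a⟩
  have hWr : ∀ v, P v → ∀ x ∈ Wt F A h v, x ∈ φ.range := by
    intro v hv x hx
    by_cases hx0 : x = 0
    · rw [hx0]; exact zero_mem _
    by_cases hv0 : v = 0
    · subst hv0
      obtain ⟨c, rfl⟩ := (s.mem_Hst_iff hA gen).mp hx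
      exact sum_mem fun a _ => φ.range.smul_mem _ (hHr a)
    have hv2 := s.Wt_root hA gen hv0 hx hx0
    obtain ⟨n, hn⟩ := hex v hv2 hv
    have key : ∀ a, bf A (w a) v = (A' *ᵥ n) a := by
      intro a
      rw [hn, bf_sum_right', mulVec, dotProduct]
      simp only [hw]
    have hn2 : bf A' n n = 2 := by
      rw [← hv2]
      conv_rhs => rw [hn, bf_comm hA, bf_sum_right', ← hn]
      rw [bf, dotProduct]
      refine Finset.sum_congr rfl fun a _ => ?_
      rw [← key, bf_comm hA, mul_comm]
    have hEne : ∀ i, sE F A' i ≠ 0 := fun i h0 => by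
      have := h2 i; rw [h0] at this
      exact s'.e_ne_of hA' hne i (by rw [← this]; exact map_zero (φ : A'.ToLieAlgebra F →ₗ[F] S))
    have hFne : ∀ i, sF F A' i ≠ 0 := fun i h0 => by
      have := h3 i; rw [h0] at this
      exact s'.f_ne_of hA' hne i (by rw [← this]; exact map_zero (φ : A'.ToLieAlgebra F →ₗ[F] S))
    obtain ⟨z, hz, hz0⟩ := serreSys_std.Wt_ne hA' hEne hFne hn2
    have hz' := serreSys_std.Tot_le n hz
    have hφz : φ z ∈ Wt F A h v := by
      intro i
      obtain ⟨c, hc⟩ := hspan i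
      obtain ⟨g, hg, hg0⟩ := s.Wt_ne hA he hf hv2
      have hg := s.Tot_le v hg
      have e1 : ∀ y : S, (∀ a, ⁅hvec F h (w a), y⁆ = ((bf A (w a) v : ℤ) : F) • y) →
          ⁅h i, y⁆ = (∑ a, c a * ((bf A (w a) v : ℤ) : F)) • y := by
        intro y hy
        rw [hc, sum_lie, Finset.sum_smul]
        refine Finset.sum_congr rfl fun a _ => ?_
        rw [smul_lie, hy, smul_smul]
      have e2 := e1 g (fun a => hvec_lie _ hg)
      rw [hg i] at e2
      rw [e1 (φ z)]
      · congr 1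
        have : ((((A *ᵥ v) i : ℤ) : F) - (∑ a, c a * ((bf A (w a) v : ℤ) : F))) • g = 0 := by
          rw [sub_smul, e2, sub_self]
        exact (sub_eq_zero.mp ((smul_eq_zero.mp this).resolve_right hg0)).symm
      · intro a
        rw [← h1 a, ← LieHom.map_lie, hz' a, key]
        exact map_smul (φ : A'.ToLieAlgebra F →ₗ[F] S) _ _
    have hφ0 : φ z ≠ 0 := fun h0 => hz0 (inj (by rw [h0]; exact (map_zero (φ : A'.ToLieAlgebra F →ₗ[F] S)).symm))
    obtain ⟨g, hg, hg1⟩ := s.Wt_dim hA gen hv2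
    obtain ⟨c, hc⟩ := hg1 _ hφz
    obtain ⟨d, hd⟩ := hg1 _ hx
    have hc0 : c ≠ 0 := by rintro rfl; rw [zero_smul] at hc; exact hφ0 hc
    have : x = (d * c⁻¹) • φ z := by
      rw [hc, smul_smul, mul_assoc, inv_mul_cancel₀ hc0, mul_one, hd]
    rw [this]
    exact φ.range.smul_mem _ ⟨z, rfl⟩
  have hge : K ≤ φ.range := by
    intro z hz
    obtain ⟨T, y, hy, rfl⟩ := s.decomp gen z
    have key := comp_mem (h := h) hA K.toSubmodule (fun i x hx => K.lie_mem (hhK i) hx) T y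
      (fun v _ => s.Tot_le v (hy v)) hz
    refine sum_mem fun v hv => ?_
    by_cases h0 : y v = 0
    · rw [h0]; exact zero_mem _
    · exact hWr v (hKP v _ (s.Tot_le v (hy v)) (key v hv) h0) _ (s.Tot_le v (hy v))
  have hEq : φ.range = K := le_antisymm hle hge
  exact ⟨(LieEquiv.ofInjective φ inj).trans (LieEquiv.ofEq _ _ (by rw [hEq]))⟩

end P7
end E8P

set_option linter.unusedSectionVars false
namespace E8P
open Matrix

section P7b

lemma slpd_gram {ι κ : Type} [Fintype ι] [DecidableEq ι] [Fintype κ] [DecidableEq κ]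
    {A : Matrix ι ι ℤ} {A' : Matrix κ κ ℤ} (hA : SLPD A) (w : κ → (ι → ℤ))
    (hw : ∀ a b, bf A (w a) (w b) = A' a b) (diag : ∀ a, A' a a = 2)
    (off : ∀ a b, a ≠ b → A' a b = 0 ∨ A' a b = -1)
    (ind : ∀ n : κ → ℤ, ∑ a, n a • w a = 0 → n = 0) : SLPD A' where
  symm i j := by rw [← hw, ← hw, bf_comm hA]
  diag := diag
  off := off
  pos n hn := by
    have h1 := hA.pos (∑ a, n a • w a) (fun h0 => hn (ind n h0))
    rw [bf_sum_right'] at h1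
    rw [bf, dotProduct]
    convert h1 using 2 with a
    rw [bf_comm hA, bf_sum_right', mul_comm, mulVec, dotProduct]
    simp only [hw]

/-- Cartan matrix of type A. -/
def cA (n : ℕ) : Matrix (Fin n) (Fin n) ℤ := fun i j =>
  if i = j then 2 else if i.val + 1 = j.val ∨ j.val + 1 = i.val then -1 else 0

/-- Cartan matrix of type D5. -/
def cD : Matrix (Fin 5) (Fin 5) ℤ :=
  !![2, -1, 0, 0, 0; -1, 2, -1, 0, 0; 0, -1, 2, -1, -1; 0, 0, -1, 2, 0; 0, 0, -1, 0, 2]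

/-- Block Cartan matrix A1 + A7. -/
def cI : Matrix (Fin 1 ⊕ Fin 7) (Fin 1 ⊕ Fin 7) ℤ := fromBlocks (cA 1) 0 0 (cA 7)

/-- Block Cartan matrix A3 + D5. -/
def cII : Matrix (Fin 3 ⊕ Fin 5) (Fin 3 ⊕ Fin 5) ℤ := fromBlocks (cA 3) 0 0 cD

/-- Simple roots of A1 + A7. -/
def wI : Fin 1 ⊕ Fin 7 → (Fin 8 → ℤ) :=
  Sum.elim ![sr 0] ![sr 1, sr 3, sr 4, sr 5, sr 6, sr 7, -e8a]

/-- Simple roots of A3 + D5. -/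
def wII : Fin 3 ⊕ Fin 5 → (Fin 8 → ℤ) :=
  Sum.elim ![sr 6, sr 7, -e8a] ![sr 0, sr 2, sr 3, sr 1, sr 4]

lemma gramI : ∀ a b, bf CartanMatrix.E₈ (wI a) (wI b) = cI a b := by
  rintro (a | a) (b | b) <;> fin_cases a <;> fin_cases b <;> decide

lemma gramII : ∀ a b, bf CartanMatrix.E₈ (wII a) (wII b) = cII a b := by
  rintro (a | a) (b | b) <;> fin_cases a <;> fin_cases b <;> decide

lemma sumI (n : Fin 1 ⊕ Fin 7 → ℤ) : ∑ a, n a • wI a =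
    ![n (.inl 0) - 2 * n (.inr 6), n (.inr 0) - 3 * n (.inr 6), - 4 * n (.inr 6),
      n (.inr 1) - 6 * n (.inr 6), n (.inr 2) - 5 * n (.inr 6), n (.inr 3) - 4 * n (.inr 6),
      n (.inr 4) - 3 * n (.inr 6), n (.inr 5) - 2 * n (.inr 6)] := by
  ext i
  fin_cases i <;> simp [Fin.sum_univ_succ, wI, sr, e8a] <;> ring

lemma sumII (n : Fin 3 ⊕ Fin 5 → ℤ) : ∑ a, n a • wII a =
    ![n (.inr 0) - 2 * n (.inl 2), n (.inr 3) - 3 * n (.inl 2), n (.inr 1) - 4 * n (.inl 2),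
      n (.inr 2) - 6 * n (.inl 2), n (.inr 4) - 5 * n (.inl 2), - 4 * n (.inl 2),
      n (.inl 0) - 3 * n (.inl 2), n (.inl 1) - 2 * n (.inl 2)] := by
  ext i
  fin_cases i <;> simp [Fin.sum_univ_succ, wII, sr, e8a] <;> ring

lemma slpdI : SLPD cI := by
  refine slpd_gram e8_slpd wI gramI ?_ ?_ ?_
  · rintro (a | a) <;> simp [cI, cA]
  · have : ∀ a b, a = b ∨ cI a b = 0 ∨ cI a b = -1 := by
      rintro (a | a) (b | b) <;> revert a b <;> decide
    exact fun a b hab => (this a b).resolve_left hab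
  · intro n hn
    rw [sumI] at hn
    have := fun i => congrFun hn i
    simp [Fin.forall_fin_succ] at this
    ext a
    rcases a with a | a <;> fin_cases a <;> simp <;> omega

lemma slpdII : SLPD cII := by
  refine slpd_gram e8_slpd wII gramII ?_ ?_ ?_
  · decide
  · have : ∀ a b, a = b ∨ cII a b = 0 ∨ cII a b = -1 := by
      rintro (a | a) (b | b) <;> revert a b <;> decide
    exact fun a b hab => (this a b).resolve_left hab
  · intro n hn
    rw [sumII] at hn
    have := fun i => congrFun hn i
    simp [Fin.forall_fin_succ] at this
    ext a
    rcases a with a | a <;> fin_cases a <;> simp <;> omega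

variable {F : Type} [Field F] [CharZero F]
  {S : Type} [LieRing S] [LieAlgebra F S] {h e f : Fin 8 → S}

/-- Fixed subalgebra for a Kac coordinate concentrated at one node. -/
theorem e8_fix_equiv {κ : Type} [Fintype κ] [DecidableEq κ] {A' : Matrix κ κ ℤ} (hA' : SLPD A')
    (w : κ → (Fin 8 → ℤ)) (hw : ∀ a b, bf CartanMatrix.E₈ (w a) (w b) = A' a b) (j : Fin 8)
    (hj : ∀ a, 4 ∣ w a j)
    (hex : ∀ v : Fin 8 → ℤ, 4 ∣ v j → ∃ n : κ → ℤ, v = ∑ a, n a • w a)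
    (s : SerreSys F CartanMatrix.E₈ h e f)
    (gen : LieSubalgebra.lieSpan F S (Set.range e ∪ Set.range f) = ⊤) (he : ∀ i, e i ≠ 0)
    (θ : S ≃ₗ⁅F⁆ S) (hh : ∀ i, θ (h i) = h i) {ζ : F} (hζ : ζ ^ 2 = -1)
    (t : Fin 8 → ℤ) (ht : ∀ i, θ (e i) = ζ ^ (t i) • e i) (htj : t = Pi.single j 1)
    (K : LieSubalgebra F S) (hK : ∀ x, x ∈ K ↔ θ x = x) :
    Nonempty (A'.ToLieAlgebra F ≃ₗ⁅F⁆ K) := by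
  have hz := zeta_ne hζ
  have hact := s.theta_Wt e8_slpd gen he θ hh hz t ht
  have li := s.linInd e8_slpd he
  have htv : ∀ v, t ⬝ᵥ v = v j := fun v => by rw [htj, single_one_dotProduct]
  refine s.sub_equiv e8_slpd gen he (s.f_ne_of e8_slpd fun i => li.ne_zero i) hA' w hw K
    (fun v => 4 ∣ v j) ?_ ?_ (dvd_zero 4) hj (fun a => (dvd_neg (α := ℤ)).mpr (hj a)) (fun v _ => hex v) ?_
  · rintro v ⟨k, hk⟩ x hx
    rw [hK, hact v x hx, htv, hk, zpow_four hζ, one_smul]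
  · intro v x hx hxK hx0
    rw [hK, hact v x hx, htv] at hxK
    have h3 : (ζ ^ (v j) - 1) • x = 0 := by rw [sub_smul, hxK, one_smul, sub_self]
    exact four_dvd hζ (sub_eq_zero.mp ((smul_eq_zero.mp h3).resolve_right hx0))
  · intro i
    obtain ⟨n, hn⟩ := hex ((4 : ℤ) • sr i) ⟨sr i j, rfl⟩
    refine ⟨fun a => (4 : F)⁻¹ * (n a : F), ?_⟩
    have h1 : hvec F h ((4 : ℤ) • sr i) = ∑ a, (n a : F) • hvec F h (w a) := by
      rw [hn, hvec_sum]
    rw [hvec_zsmul, hvec_sr] at h1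
    simp only [mul_smul]
    rw [← Finset.smul_sum, ← h1, smul_smul]
    simp

theorem e8_fix_I (s : SerreSys F CartanMatrix.E₈ h e f)
    (gen : LieSubalgebra.lieSpan F S (Set.range e ∪ Set.range f) = ⊤) (he : ∀ i, e i ≠ 0)
    (θ : S ≃ₗ⁅F⁆ S) (hh : ∀ i, θ (h i) = h i) {ζ : F} (hζ : ζ ^ 2 = -1)
    (t : Fin 8 → ℤ) (ht : ∀ i, θ (e i) = ζ ^ (t i) • e i) (htj : t = Pi.single 2 1)
    (K : LieSubalgebra F S) (hK : ∀ x, x ∈ K ↔ θ x = x) :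
    Nonempty (cI.ToLieAlgebra F ≃ₗ⁅F⁆ K) := by
  refine e8_fix_equiv slpdI wI gramI 2 (by decide) ?_ s gen he θ hh hζ t ht htj K hK
  rintro v ⟨k, hk⟩
  refine ⟨Sum.elim ![v 0 - 2 * k] ![v 1 - 3 * k, v 3 - 6 * k, v 4 - 5 * k, v 5 - 4 * k,
    v 6 - 3 * k, v 7 - 2 * k, -k], ?_⟩
  rw [sumI]
  ext i
  fin_cases i <;> simp [hk]

theorem e8_fix_II (s : SerreSys F CartanMatrix.E₈ h e f)
    (gen : LieSubalgebra.lieSpan F S (Set.range e ∪ Set.range f) = ⊤) (he : ∀ i, e i ≠ 0)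
    (θ : S ≃ₗ⁅F⁆ S) (hh : ∀ i, θ (h i) = h i) {ζ : F} (hζ : ζ ^ 2 = -1)
    (t : Fin 8 → ℤ) (ht : ∀ i, θ (e i) = ζ ^ (t i) • e i) (htj : t = Pi.single 5 1)
    (K : LieSubalgebra F S) (hK : ∀ x, x ∈ K ↔ θ x = x) :
    Nonempty (cII.ToLieAlgebra F ≃ₗ⁅F⁆ K) := by
  refine e8_fix_equiv slpdII wII gramII 5 (by decide) ?_ s gen he θ hh hζ t ht htj K hK
  rintro v ⟨k, hk⟩
  refine ⟨Sum.elim ![v 6 - 3 * k, v 7 - 2 * k, -k] ![v 0 - 2 * k, v 2 - 4 * k, v 3 - 6 * k,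
    v 1 - 3 * k, v 4 - 5 * k], ?_⟩
  rw [sumII]
  ext i
  fin_cases i <;> simp [hk]

end P7b
end E8P

set_option linter.unusedSectionVars false
namespace E8P
open Matrix

/-- Product -/
lemma SerreSys.toSub {ι : Type} [Fintype ι] [DecidableEq ι] {F : Type} [Field F] [CharZero F]
  {S : Type} [LieRing S] [LieAlgebra F S] {A : Matrix ι ι ℤ} {h e f : ι → S}
  (s : SerreSys F A h e f) (K : LieSubalgebra F S) (hK : ∀ i, h i ∈ K) (eK : ∀ i, e i ∈ K) (fK : ∀ i, f i ∈ K)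
  : SerreSys F A (fun i => (⟨h i, hK i⟩ : K)) (fun i => (⟨e i, eK i⟩ : K)) (fun i => (⟨f i, fK i⟩ : K)) where
  hh i j := Subtype.ext (s.hh i j)
  ef i := Subtype.ext (s.ef i)
  ef0 i j hij := Subtype.ext (s.ef0 i j hij)
  he i j := Subtype.ext (s.he i j)
  hf i j := Subtype.ext (s.hf i j)
  ee0 i j hij := Subtype.ext (s.ee0 i j hij)
  ee1 i j hij := Subtype.ext (s.ee1 i j hij)
  ff0 i j hij := Subtype.ext (s.ff0 i j hij)
  ff1 i j hij := Subtype.ext (s.ff1 i j hij)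

lemma gen_toSub {F : Type} [Field F] 
  {S : Type} [LieRing S] [LieAlgebra F S] {ι : Type} {e f : ι → S}  (K : LieSubalgebra F S)
  (eK : ∀ i, e i ∈ K) (fK : ∀ i, f i ∈ K)
  (hg : K ≤ LieSubalgebra.lieSpan F S (Set.range e ∪ Set.range f)) :
  LieSubalgebra.lieSpan F K (Set.range (fun i => (⟨e i, eK i⟩ : K)) ∪ Set.range (fun i => (⟨f i, fK i⟩ : K))) = ⊤ := by
  set B := LieSubalgebra.lieSpan F K (Set.range (fun i => (⟨e i, eK i⟩ : K)) ∪ Set.range (fun i => (⟨f i, fK i⟩ : K))) with hB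
  have h1 : LieSubalgebra.lieSpan F S (Set.range e ∪ Set.range f) ≤ B.map K.incl := by
    rw [LieSubalgebra.lieSpan_le]
    rintro _ (⟨i, rfl⟩ | ⟨i, rfl⟩)
    · exact ⟨⟨e i, eK i⟩, LieSubalgebra.subset_lieSpan (Or.inl ⟨i, rfl⟩), rfl⟩
    · exact ⟨⟨f i, fK i⟩, LieSubalgebra.subset_lieSpan (Or.inr ⟨i, rfl⟩), rfl⟩
  rw [eq_top_iff]
  rintro ⟨x, hx⟩ _
  obtain ⟨y, hy, hxy⟩ := h1 (hg hx)
  have : y = ⟨x, hx⟩ := Subtype.ext hxy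
  rw [← this]; exact hy

section prod
variable {F : Type} [Field F] [CharZero F] {ι κ : Type} [Fintype ι] [DecidableEq ι] [Fintype κ] [DecidableEq κ]
  {S T : Type} [LieRing S] [LieAlgebra F S] [LieRing T] [LieAlgebra F T] {A : Matrix ι ι ℤ} {B : Matrix κ κ ℤ}
  {h e f : ι → S} {h' e' f' : κ → T}

/-- combine two families in a product -/
def comb (x : ι → S) (y : κ → T) : ι ⊕ κ → S × T := Sum.elim (fun i => (x i, 0)) (fun j => (0, y j))

lemma plie (x y : S × T) : ⁅x, y⁆ = (⁅x.1, y.1⁆, ⁅x.2, y.2⁆) := rfl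

lemma SerreSys.prod (s : SerreSys F A h e f) (s' : SerreSys F B h' e' f') :
    SerreSys F (fromBlocks A 0 0 B) (comb h h') (comb e e') (comb f f') where
  hh := by rintro (i | i) (j | j) <;> simp [comb, plie, s.hh, s'.hh]
  ef := by rintro (i | i) <;> simp [comb, plie, s.ef, s'.ef]
  ef0 := by
    rintro (i | i) (j | j) hij
    · simp [comb, plie, s.ef0 i j (fun h => hij (by rw [h]))]
    · simp [comb, plie]
    · simp [comb, plie]
    · simp [comb, plie, s'.ef0 i j (fun h => hij (by rw [h]))]
  he := by rintro (i | i) (j | j) <;> simp [comb, plie, s.he, s'.he]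
  hf := by rintro (i | i) (j | j) <;> simp [comb, plie, s.hf, s'.hf]
  ee0 := by
    rintro (i | i) (j | j) hij
    · simp [comb, plie, s.ee0 i j (by simpa using hij)]
    · simp [comb, plie]
    · simp [comb, plie]
    · simp [comb, plie, s'.ee0 i j (by simpa using hij)]
  ee1 := by
    rintro (i | i) (j | j) hij
    · simp [comb, plie, s.ee1 i j (by simpa using hij)]
    · simp [comb, plie]
    · simp [comb, plie]
    · simp [comb, plie, s'.ee1 i j (by simpa using hij)]
  ff0 := by
    rintro (i | i) (j | j) hij
    · simp [comb, plie, s.ff0 i j (by simpa using hij)]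
    · simp [comb, plie]
    · simp [comb, plie]
    · simp [comb, plie, s'.ff0 i j (by simpa using hij)]
  ff1 := by
    rintro (i | i) (j | j) hij
    · simp [comb, plie, s.ff1 i j (by simpa using hij)]
    · simp [comb, plie]
    · simp [comb, plie]
    · simp [comb, plie, s'.ff1 i j (by simpa using hij)]

/-- left inclusion -/
def plinl (F S T : Type) [Field F] [LieRing S] [LieAlgebra F S] [LieRing T] [LieAlgebra F T] :
    S →ₗ⁅F⁆ S × T :=
  { LinearMap.inl F S T with map_lie' := fun {x y} => Prod.ext rfl (lie_zero (0 : T)).symm }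

/-- right inclusion -/
def plinr (F S T : Type) [Field F] [LieRing S] [LieAlgebra F S] [LieRing T] [LieAlgebra F T] :
    T →ₗ⁅F⁆ S × T :=
  { LinearMap.inr F S T with map_lie' := fun {x y} => Prod.ext (lie_zero (0 : S)).symm rfl }

lemma gen_prod (g : LieSubalgebra.lieSpan F S (Set.range e ∪ Set.range f) = ⊤)
    (g' : LieSubalgebra.lieSpan F T (Set.range e' ∪ Set.range f') = ⊤) :
    LieSubalgebra.lieSpan F (S × T) (Set.range (comb e e') ∪ Set.range (comb f f')) = ⊤ := by
  set D := LieSubalgebra.lieSpan F (S × T) (Set.range (comb e e') ∪ Set.range (comb f f')) with hD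
  have h1 : (⊤ : LieSubalgebra F S) ≤ D.comap (plinl F S T) := by
    rw [← g, LieSubalgebra.lieSpan_le]
    rintro _ (⟨i, rfl⟩ | ⟨i, rfl⟩)
    · exact LieSubalgebra.subset_lieSpan (Or.inl ⟨.inl i, rfl⟩)
    · exact LieSubalgebra.subset_lieSpan (Or.inr ⟨.inl i, rfl⟩)
  have h2 : (⊤ : LieSubalgebra F T) ≤ D.comap (plinr F S T) := by
    rw [← g', LieSubalgebra.lieSpan_le]
    rintro _ (⟨i, rfl⟩ | ⟨i, rfl⟩)
    · exact LieSubalgebra.subset_lieSpan (Or.inl ⟨.inr i, rfl⟩)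
    · exact LieSubalgebra.subset_lieSpan (Or.inr ⟨.inr i, rfl⟩)
  rw [eq_top_iff]
  rintro ⟨x, y⟩ _
  have a1 : ((x, 0) : S × T) ∈ D := h1 (x := x) trivial
  have a2 : ((0, y) : S × T) ∈ D := h2 (x := y) trivial
  have := D.add_mem a1 a2
  simpa using this

theorem prod_equiv (hAB : SLPD (fromBlocks A 0 0 B)) (s : SerreSys F A h e f) (s' : SerreSys F B h' e' f')
    (g : LieSubalgebra.lieSpan F S (Set.range e ∪ Set.range f) = ⊤)
    (g' : LieSubalgebra.lieSpan F T (Set.range e' ∪ Set.range f') = ⊤)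
    (hne : ∀ i, e i ≠ 0) (hne' : ∀ i, e' i ≠ 0) :
    Nonempty ((fromBlocks A 0 0 B).ToLieAlgebra F ≃ₗ⁅F⁆ S × T) := by
  refine serre_equiv hAB (s.prod s') (gen_prod g g') ((s.prod s').linInd hAB ?_)
  rintro (i | i) h0
  · exact hne i (congrArg Prod.fst h0)
  · exact hne' i (congrArg Prod.snd h0)
end prod

end E8P

set_option linter.unusedSectionVars false
namespace E8P
open Matrix

section slsys
attribute [local instance] LieRing.ofAssociativeRing

variable {F : Type} [Field F] [CharZero F] {ι I : Type} [Fintype ι] [DecidableEq ι]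
  [Fintype I] [DecidableEq I]

lemma lie_tr (x y : Matrix I I F) : ⁅xᵀ, yᵀ⁆ = -(⁅x, y⁆ᵀ) := by
  rw [LieRing.of_associative_ring_bracket, LieRing.of_associative_ring_bracket, transpose_sub,
    transpose_mul, transpose_mul, neg_sub]

lemma mat_sys {A : Matrix ι ι ℤ} (e : ι → Matrix I I F) (d : ι → I → F)
    (ef : ∀ i, ⁅e i, (e i)ᵀ⁆ = diagonal (d i)) (ef0 : ∀ i j, i ≠ j → ⁅e i, (e j)ᵀ⁆ = 0)
    (he : ∀ i j, ⁅diagonal (d i), e j⁆ = ((A i j : ℤ) : F) • e j)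
    (ee0 : ∀ i j, A i j = 0 → ⁅e i, e j⁆ = 0)
    (ee1 : ∀ i j, A i j = -1 → ⁅e i, ⁅e i, e j⁆⁆ = 0) :
    SerreSys F A (fun i => diagonal (d i)) e (fun i => (e i)ᵀ) where
  hh i j := by
    rw [LieRing.of_associative_ring_bracket, diagonal_mul_diagonal', diagonal_mul_diagonal',
      sub_eq_zero]
    congr 1
    exact mul_comm _ _
  ef := ef
  ef0 := ef0
  he := he
  hf i j := by
    have := lie_tr (diagonal (d i)) (e j)
    rw [he, diagonal_transpose, transpose_smul] at this
    rw [this, neg_smul]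
  ee0 := ee0
  ee1 := ee1
  ff0 i j hij := by rw [lie_tr, ee0 i j hij]; simp
  ff1 i j hij := by
    rw [lie_tr, lie_neg, lie_tr, ee1 i j hij]; simp

lemma lie_single (a b c d : I) : ⁅(single a b 1 : Matrix I I F), (single c d 1 : Matrix I I F)⁆ =
    (if b = c then single a d 1 else 0) - (if d = a then single c b 1 else 0) := by
  rw [LieRing.of_associative_ring_bracket]
  congr 1
  · split_ifs with hb
    · subst hb; rw [single_mul_single_same, mul_one]
    · rw [single_mul_single_of_ne _ _ _ _ hb]
  · split_ifs with hb
    · subst hb; rw [single_mul_single_same, mul_one]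
    · rw [single_mul_single_of_ne _ _ _ _ hb]

lemma lie_diag_single (v : I → F) (a b : I) : ⁅diagonal v, (single a b 1 : Matrix I I F)⁆ =
    (v a - v b) • single a b 1 := by
  rw [LieRing.of_associative_ring_bracket]
  ext i j
  rw [Matrix.sub_apply, diagonal_mul, mul_diagonal, Matrix.smul_apply, single_apply]
  split_ifs with h
  · rw [h.1, h.2]; simp
  · simp

/-- Simple root vectors of sl. -/
def slE (F : Type) [Field F] (n : ℕ) (i : Fin n) : Matrix (Fin (n + 1)) (Fin (n + 1)) F :=
  single i.castSucc i.succ 1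

/-- Simple coroots of sl. -/
def slD (F : Type) [Field F] (n : ℕ) (i : Fin n) : Fin (n + 1) → F :=
  Pi.single i.castSucc 1 - Pi.single i.succ 1

lemma slE_tr (n : ℕ) (i : Fin n) : (slE F n i)ᵀ = single i.succ i.castSucc 1 := by
  rw [slE, transpose_single]

lemma sl_sys (n : ℕ) : SerreSys F (cA n) (fun i => diagonal (slD F n i)) (slE F n)
    (fun i => (slE F n i)ᵀ) := by
  refine mat_sys (slE F n) (slD F n) ?_ ?_ ?_ ?_ ?_
  · intro i
    rw [slE_tr, slE, lie_single, if_pos rfl, if_pos rfl, slD, ← diagonal_single, ← diagonal_single,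
      diagonal_sub]
    rfl
  · intro i j hij
    rw [slE_tr, slE, lie_single, if_neg (fun h => hij (Fin.succ_injective _ h)),
      if_neg (fun h => hij (Fin.castSucc_injective _ h).symm), sub_zero]
  · intro i j
    rw [slE, lie_diag_single]
    congr 1
    simp only [slD, Pi.sub_apply, Pi.single_apply, cA, Fin.ext_iff, Fin.val_castSucc, Fin.val_succ]
    split_ifs <;> first | omega | norm_num
  · intro i j hij
    rw [slE, slE, lie_single]
    simp only [cA, Fin.ext_iff] at hij
    rw [if_neg, if_neg, sub_zero]
    · simp only [Fin.ext_iff, Fin.val_castSucc, Fin.val_succ]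
      split_ifs at hij <;> omega
    · simp only [Fin.ext_iff, Fin.val_castSucc, Fin.val_succ]
      split_ifs at hij <;> omega
  · intro i j hij
    rw [slE, slE, lie_single]
    simp only [cA, Fin.ext_iff] at hij
    rw [lie_sub]
    split_ifs with h1 h2 h2 <;> simp only [lie_single, lie_zero, sub_zero, zero_sub] <;>
      simp only [Fin.ext_iff, Fin.val_castSucc, Fin.val_succ] at h1 h2 ⊢ <;>
      split_ifs <;> first | omega | simp

lemma slE_mem (n : ℕ) (i : Fin n) : slE F n i ∈ LieAlgebra.SpecialLinear.sl (Fin (n + 1)) F := by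
  show Matrix.trace (slE F n i) = 0
  rw [slE, trace_single_eq_of_ne]
  exact (Fin.castSucc_lt_succ).ne

lemma slF_mem (n : ℕ) (i : Fin n) : (slE F n i)ᵀ ∈ LieAlgebra.SpecialLinear.sl (Fin (n + 1)) F := by
  show Matrix.trace (slE F n i)ᵀ = 0
  rw [trace_transpose]
  exact slE_mem n i

lemma slH_mem (n : ℕ) (i : Fin n) :
    diagonal (slD F n i) ∈ LieAlgebra.SpecialLinear.sl (Fin (n + 1)) F := by
  show Matrix.trace (diagonal (slD F n i)) = 0
  rw [trace_diagonal]
  simp [slD]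

lemma sl_gen (n : ℕ) : LieAlgebra.SpecialLinear.sl (Fin (n + 1)) F ≤
    LieSubalgebra.lieSpan F _ (Set.range (slE F n) ∪ Set.range (fun i => (slE F n i)ᵀ)) := by
  set B := LieSubalgebra.lieSpan F _ (Set.range (slE F n) ∪ Set.range (fun i => (slE F n i)ᵀ)) with hB
  have hE : ∀ i, slE F n i ∈ B := fun i => LieSubalgebra.subset_lieSpan (Or.inl ⟨i, rfl⟩)
  have hF : ∀ i, (slE F n i)ᵀ ∈ B := fun i => LieSubalgebra.subset_lieSpan (Or.inr ⟨i, rfl⟩)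
  have key : ∀ (k : ℕ) (a b : Fin (n + 1)), b.val = a.val + k + 1 →
      (single a b 1 : Matrix _ _ F) ∈ B ∧ (single b a 1 : Matrix _ _ F) ∈ B := by
    intro k
    induction k with
    | zero =>
      intro a b hab
      have ha : a = Fin.castSucc ⟨a.val, by omega⟩ := rfl
      have hb : b = Fin.succ ⟨a.val, by omega⟩ := Fin.ext (by simpa using hab)
      have h1 := hE ⟨a.val, by omega⟩
      have h2 := hF ⟨a.val, by omega⟩
      rw [slE_tr, ← ha, ← hb] at h2
      rw [slE, ← ha, ← hb] at h1
      exact ⟨h1, h2⟩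
    | succ k ih =>
      intro a b hab
      let c : Fin n := ⟨a.val + k + 1, by omega⟩
      have hb : b = c.succ := Fin.ext (by simp [c]; omega)
      obtain ⟨h1, h2⟩ := ih a c.castSucc (by simp [c])
      have hac : ¬ (c.succ = a) := by
        rw [Fin.ext_iff]; simp [c]; omega
      have hac' : ¬ (a = c.succ) := fun h => hac h.symm
      constructor
      · have := B.lie_mem h1 (hE c)
        rw [slE, lie_single, if_pos rfl, if_neg hac, sub_zero, ← hb] at this
        exact this
      · have := B.lie_mem (hF c) h2
        rw [slE_tr, lie_single, if_pos rfl, if_neg hac', sub_zero, ← hb] at this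
        exact this
  have hab : ∀ a b : Fin (n + 1), a ≠ b → (single a b 1 : Matrix _ _ F) ∈ B := by
    intro a b hab
    rcases lt_or_gt_of_ne (fun h => hab (Fin.ext h)) with h | h
    · exact (key (b.val - a.val - 1) a b (by omega)).1
    · exact (key (a.val - b.val - 1) b a (by omega)).2
  have hd : ∀ a b : Fin (n + 1),
      (single a b 1 - (if a = b then single 0 0 1 else 0) : Matrix _ _ F) ∈ B := by
    intro a b
    split_ifs with h
    · subst h
      by_cases h0 : a = 0
      · rw [h0, sub_self]; exact zero_mem _
      · have := B.lie_mem (hab a 0 h0) (hab 0 a (Ne.symm h0))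
        rwa [lie_single, if_pos rfl, if_pos rfl] at this
    · rw [sub_zero]; exact hab a b h
  intro M hM
  have hM0 : ∑ a, M a a = 0 := hM
  have : M = ∑ a, ∑ b, M a b • (single a b 1 - (if a = b then single 0 0 1 else 0) : Matrix _ _ F) := by
    simp only [smul_sub, Finset.sum_sub_distrib, smul_ite, smul_zero, Finset.sum_ite_eq,
      Finset.mem_univ, if_true]
    rw [← Finset.sum_smul, hM0, zero_smul, sub_zero]
    conv_lhs => rw [matrix_eq_sum_single M]
    simp [smul_single]
  rw [this]
  exact sum_mem fun a _ => sum_mem fun b _ => B.smul_mem _ (hd a b)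

lemma slE_ne (n : ℕ) (i : Fin n) : slE F n i ≠ 0 := by
  intro h
  have := congrFun (congrFun h i.castSucc) i.succ
  simp [slE] at this

end slsys
end E8P

set_option linter.unusedSectionVars false
namespace E8P
open Matrix

section sosys
attribute [local instance] LieRing.ofAssociativeRing

variable {F : Type} [Field F] [CharZero F]

/-- Elementary elements of the split orthogonal algebra. -/
def dX (F : Type) [Field F] (a b : Fin 5 ⊕ Fin 5) : Matrix (Fin 5 ⊕ Fin 5) (Fin 5 ⊕ Fin 5) F :=
  single a b 1 - single b.swap a.swap 1

lemma dX_tr (a b : Fin 5 ⊕ Fin 5) : (dX F a b)ᵀ = dX F b a := by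
  rw [dX, transpose_sub, transpose_single, transpose_single, dX]

lemma dX_swap (a b : Fin 5 ⊕ Fin 5) : dX F b.swap a.swap = -dX F a b := by
  rw [dX, dX, Sum.swap_swap, Sum.swap_swap, neg_sub]

lemma dX_self (a : Fin 5 ⊕ Fin 5) : dX F a a.swap = 0 := by
  rw [dX, Sum.swap_swap, sub_self]

lemma swap_eq_iff' (a b : Fin 5 ⊕ Fin 5) : a.swap = b.swap ↔ a = b :=
  ⟨fun h => by rw [← Sum.swap_swap a, h, Sum.swap_swap], fun h => by rw [h]⟩

lemma lie_dX (a b c d : Fin 5 ⊕ Fin 5) : ⁅dX F a b, dX F c d⁆ =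
    (if b = c then dX F a d else 0) - (if d = a then dX F c b else 0)
      - (if b = d.swap then dX F a c.swap else 0) + (if a.swap = c then dX F d.swap b else 0) := by
  simp only [dX, lie_sub, sub_lie, lie_single, Sum.swap_swap, swap_eq_iff']
  have e1 : (c.swap = a) = (a.swap = c) := propext
    ⟨fun h => by rw [← h, Sum.swap_swap], fun h => by rw [← h, Sum.swap_swap]⟩
  have e2 : (d = b.swap) = (b = d.swap) := propext
    ⟨fun h => by rw [h, Sum.swap_swap], fun h => by rw [h, Sum.swap_swap]⟩
  have e3 : (a = d) = (d = a) := propext eq_comm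
  have e4 : (c = b) = (b = c) := propext eq_comm
  simp only [e1, e2, e3, e4]
  split_ifs <;> abel

lemma lie_diag_dX (v : Fin 5 ⊕ Fin 5 → F) (hv : ∀ a, v a.swap = -v a) (a b : Fin 5 ⊕ Fin 5) :
    ⁅diagonal v, dX F a b⁆ = (v a - v b) • dX F a b := by
  rw [dX, lie_sub, lie_diag_single, lie_diag_single, hv, hv, smul_sub]
  congr 2
  ring

/-- First indices of the simple root vectors. -/
def dA : Fin 5 → Fin 5 ⊕ Fin 5 := ![.inl 0, .inl 1, .inl 2, .inl 3, .inl 3]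

/-- Second indices of the simple root vectors. -/
def dB : Fin 5 → Fin 5 ⊕ Fin 5 := ![.inl 1, .inl 2, .inl 3, .inl 4, .inr 4]

/-- Simple root vectors. -/
def dE (F : Type) [Field F] (i : Fin 5) : Matrix (Fin 5 ⊕ Fin 5) (Fin 5 ⊕ Fin 5) F :=
  dX F (dA i) (dB i)

/-- Simple coroots. -/
def dD (F : Type) [Field F] (i : Fin 5) (a : Fin 5 ⊕ Fin 5) : F :=
  (((if a = dA i then 1 else 0) - (if a = (dA i).swap then 1 else 0)
    - (if a = dB i then 1 else 0) + (if a = (dB i).swap then 1 else 0) : ℤ) : F)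

lemma dD_cartan : ∀ i j : Fin 5, ((if dA j = dA i then 1 else 0) - (if dA j = (dA i).swap then 1 else 0)
    - (if dA j = dB i then 1 else 0) + (if dA j = (dB i).swap then 1 else 0) : ℤ) -
    ((if dB j = dA i then 1 else 0) - (if dB j = (dA i).swap then 1 else 0)
    - (if dB j = dB i then 1 else 0) + (if dB j = (dB i).swap then 1 else 0) : ℤ) = cD i j := by
  intro i j
  fin_cases i <;> fin_cases j <;> decide

lemma dD_swap (i : Fin 5) (a : Fin 5 ⊕ Fin 5) : dD F i a.swap = - dD F i a := by
  have e1 : ∀ c : Fin 5 ⊕ Fin 5, (a.swap = c) = (a = c.swap) := fun c => propext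
    ⟨fun h => by rw [← h, Sum.swap_swap], fun h => by rw [h, Sum.swap_swap]⟩
  simp only [dD, e1, Sum.swap_swap]
  push_cast
  ring

lemma so_sys : SerreSys F cD (fun i => diagonal (dD F i)) (dE F) (fun i => (dE F i)ᵀ) := by
  have hz : ∀ a b : Fin 5 ⊕ Fin 5, b = a.swap → dX F a b = 0 := by
    rintro a b rfl; exact dX_self a
  refine mat_sys (dE F) (dD F) ?_ ?_ ?_ ?_ ?_
  · intro i
    have h1 : ∀ i, dA i ≠ (dB i) ∧ dB i ≠ (dA i).swap ∧ (dA i).swap ≠ dB i := by decide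
    rw [dE, dX_tr, lie_dX, if_pos rfl, if_pos rfl, if_neg (h1 i).2.1, if_neg (h1 i).2.2]
    ext a b
    simp only [dX, Matrix.sub_apply, Matrix.add_apply, Matrix.zero_apply, single_apply, diagonal_apply, dD]
    by_cases hab : a = b
    · subst hab
      simp only [and_self, if_true, eq_comm (b := a)]
      push_cast
      ring
    · rw [if_neg hab]
      have : ∀ c, ¬ (c = a ∧ c = b) := fun c h => hab (h.1.symm.trans h.2)
      simp [this]
  · intro i j hij
    have h1 : ∀ i j, i = j ∨ (dB i ≠ dB j ∧ (dA j = dA i → dB i = (dB j).swap) ∧ dB i ≠ (dA j).swap ∧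
        (dA i).swap ≠ dB j) := by decide
    obtain ⟨p1, p2, p3, p4⟩ := (h1 i j).resolve_left hij
    rw [dE, dE, dX_tr, lie_dX, if_neg p1, if_neg p3, if_neg p4]
    split_ifs with h
    · rw [hz _ _ (p2 h)]; simp
    · simp
  · intro i j
    rw [dE, lie_diag_dX _ (dD_swap i), ← dD_cartan]
    simp only [dD]
    push_cast
    rfl
  · intro i j hij
    have h1 : ∀ i j, cD i j ≠ 0 ∨ (dB i ≠ dA j ∧ dB j ≠ dA i ∧
        (dB i = (dB j).swap → (dA i) = dA j) ∧ (dA i).swap ≠ dA j) := by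
      intro i j; fin_cases i <;> fin_cases j <;> decide
    obtain ⟨p1, p2, p3, p4⟩ := (h1 i j).resolve_left (fun h => h hij)
    rw [dE, dE, lie_dX, if_neg p1, if_neg p2, if_neg p4]
    split_ifs with h
    · rw [hz _ _ (by rw [p3 h])]; simp
    · simp
  · intro i j hij
    fin_cases i <;> fin_cases j <;> first
      | (exfalso; revert hij; decide)
      | simp [dE, dA, dB, lie_dX]

/-- Membership in the split orthogonal algebra. -/
lemma mem_typeD (M : Matrix (Fin 5 ⊕ Fin 5) (Fin 5 ⊕ Fin 5) F) :
    M ∈ LieAlgebra.Orthogonal.typeD (Fin 5) F ↔ ∀ a b, M b.swap a.swap = - M a b := by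
  have hJ1 : ∀ (N : Matrix (Fin 5 ⊕ Fin 5) (Fin 5 ⊕ Fin 5) F) a b,
      (LieAlgebra.Orthogonal.JD (Fin 5) F * N) a b = N a.swap b := by
    intro N a b
    rw [mul_apply, Finset.sum_eq_single a.swap]
    · rcases a with a | a <;> simp [LieAlgebra.Orthogonal.JD]
    · rintro c - hc
      have : LieAlgebra.Orthogonal.JD (Fin 5) F a c = 0 := by
        rcases a with a | a <;> rcases c with c | c <;> simp [LieAlgebra.Orthogonal.JD, one_apply] at hc ⊢
        · exact fun h => hc h.symm
        · exact fun h => hc h.symm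
      rw [this, zero_mul]
    · simp
  have hJ2 : ∀ (N : Matrix (Fin 5 ⊕ Fin 5) (Fin 5 ⊕ Fin 5) F) a b,
      (N * LieAlgebra.Orthogonal.JD (Fin 5) F) a b = N a b.swap := by
    intro N a b
    rw [mul_apply, Finset.sum_eq_single b.swap]
    · rcases b with a | a <;> simp [LieAlgebra.Orthogonal.JD]
    · rintro c - hc
      have : LieAlgebra.Orthogonal.JD (Fin 5) F c b = 0 := by
        rcases b with a | a <;> rcases c with c | c <;> simp [LieAlgebra.Orthogonal.JD, one_apply] at hc ⊢
        · exact hc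
        · exact hc
      rw [this, mul_zero]
    · simp
  rw [LieAlgebra.Orthogonal.typeD, mem_skewAdjointMatricesLieSubalgebra,
    mem_skewAdjointMatricesSubmodule]
  show Mᵀ * _ = _ * (-M) ↔ _
  constructor
  · intro h a b
    have := congrFun (congrFun h a.swap) b
    rw [hJ1, hJ2, Sum.swap_swap, transpose_apply] at this
    exact this
  · intro h
    ext a b
    rw [hJ1, hJ2, transpose_apply]
    have := h a.swap b
    rw [Sum.swap_swap] at this
    exact this

lemma dX_mem (a b : Fin 5 ⊕ Fin 5) : dX F a b ∈ LieAlgebra.Orthogonal.typeD (Fin 5) F := by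
  rw [mem_typeD]
  intro c d
  have e1 : ∀ a c : Fin 5 ⊕ Fin 5, (a = c.swap) = (a.swap = c) := fun a c => propext
    ⟨fun h => by rw [h, Sum.swap_swap], fun h => by rw [← h, Sum.swap_swap]⟩
  simp only [dX, Matrix.sub_apply, single_apply, swap_eq_iff', e1, and_comm, Sum.swap_swap]
  ring

end sosys
end E8P

set_option linter.unusedSectionVars false
namespace E8P
open Matrix

section sogen
attribute [local instance] LieRing.ofAssociativeRing

variable {F : Type} [Field F] [CharZero F]

/-- Negative transpose. -/
def negTr (F I : Type) [Field F] [CharZero F] [Fintype I] [DecidableEq I] : Matrix I I F →ₗ⁅F⁆ Matrix I I F where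
  toFun x := -xᵀ
  map_add' x y := by rw [transpose_add, neg_add]
  map_smul' c x := by rw [transpose_smul, RingHom.id_apply, smul_neg]
  map_lie' {x y} := by rw [neg_lie, lie_neg, neg_neg, lie_tr]

lemma so_gen : LieAlgebra.Orthogonal.typeD (Fin 5) F ≤
    LieSubalgebra.lieSpan F _ (Set.range (dE F) ∪ Set.range (fun i => (dE F i)ᵀ)) := by
  set B := LieSubalgebra.lieSpan F _ (Set.range (dE F) ∪ Set.range (fun i => (dE F i)ᵀ)) with hB
  have hE : ∀ i, dE F i ∈ B := fun i => LieSubalgebra.subset_lieSpan (Or.inl ⟨i, rfl⟩)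
  have hF : ∀ i, (dE F i)ᵀ ∈ B := fun i => LieSubalgebra.subset_lieSpan (Or.inr ⟨i, rfl⟩)
  have htr : ∀ x ∈ B, xᵀ ∈ B := by
    intro x hx
    have : B ≤ B.comap (negTr F _) := by
      rw [hB, LieSubalgebra.lieSpan_le]
      rintro _ (⟨i, rfl⟩ | ⟨i, rfl⟩)
      · exact neg_mem (hF i)
      · show -((dE F i)ᵀᵀ) ∈ B
        rw [transpose_transpose]
        exact neg_mem (hE i)
    have h1 : -xᵀ ∈ B := this hx
    simpa using neg_mem h1
  have hT : ∀ a b, dX F a b ∈ B → dX F b a ∈ B := fun a b h => by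
    rw [← dX_tr]; exact htr _ h
  have hs1 : ∀ i : Fin 4, dX F (.inl i.castSucc) (.inl i.succ) ∈ B := by
    intro i
    have := hE i.castSucc
    fin_cases i <;> exact this
  have key : ∀ (k : ℕ) (a b : Fin 5), b.val = a.val + k + 1 → dX F (.inl a) (.inl b) ∈ B := by
    intro k
    induction k with
    | zero =>
      intro a b hab
      have ha : a = Fin.castSucc (⟨a.val, by omega⟩ : Fin 4) := rfl
      have hb : b = Fin.succ (⟨a.val, by omega⟩ : Fin 4) := Fin.ext (by simpa using hab)
      have h1 := hs1 ⟨a.val, by omega⟩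
      rwa [← ha, ← hb] at h1
    | succ k ih =>
      intro a b hab
      let c : Fin 4 := ⟨a.val + k + 1, by omega⟩
      have hb : b = c.succ := Fin.ext (by simp [c]; omega)
      have h1 := ih a c.castSucc (by simp [c])
      have hac : ¬ (c.succ = a) := by
        rw [Fin.ext_iff]; simp [c]; omega
      have := B.lie_mem h1 (hs1 c)
      rw [lie_dX] at this
      have hba : ¬ (b = a) := by rw [hb]; exact hac
      simpa [hac, hba, ← hb] using this
  have hLL : ∀ a b : Fin 5, a ≠ b → dX F (.inl a) (.inl b) ∈ B := by
    intro a b hab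
    rcases lt_or_gt_of_ne (fun h => hab (Fin.ext h)) with h | h
    · exact key (b.val - a.val - 1) a b (by omega)
    · exact hT _ _ (key (a.val - b.val - 1) b a (by omega))
  have hsw : ∀ a b : Fin 5, dX F (.inl a) (.inr b) ∈ B → dX F (.inl b) (.inr a) ∈ B := by
    intro a b h
    have := dX_swap (F := F) (.inl a) (.inr b)
    simp only [Sum.swap_inl, Sum.swap_inr] at this
    rw [this]; exact neg_mem h
  have h4 : ∀ a : Fin 5, a ≠ 4 → dX F (.inl a) (.inr 4) ∈ B := by
    intro a ha
    have h34 : dX F (.inl 3) (.inr 4) ∈ B := hE 4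
    by_cases h3 : a = 3
    · rw [h3]; exact h34
    · have := B.lie_mem (hLL a 3 h3) h34
      rw [lie_dX] at this
      simpa using this
  have hLR : ∀ a b : Fin 5, a ≠ b → dX F (.inl a) (.inr b) ∈ B := by
    intro a b hab
    by_cases hb : b = 4
    · rw [hb] at hab ⊢; exact h4 a hab
    by_cases ha : a = 4
    · rw [ha]; exact hsw _ _ (h4 b hb)
    have := B.lie_mem (hLL a 4 ha) (hsw _ _ (h4 b hb))
    rw [lie_dX] at this
    simpa [Ne.symm hb] using this
  have hdiag : ∀ a : Fin 5, dX F (.inl a) (.inl a) ∈ B := by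
    intro a
    obtain ⟨b, hb⟩ : ∃ b : Fin 5, a ≠ b := by
      by_cases h : a = 0
      · exact ⟨1, by rw [h]; decide⟩
      · exact ⟨0, h⟩
    have h1 := B.lie_mem (hLL a b hb) (hLL b a hb.symm)
    have h2 := B.lie_mem (hLR a b hb) (hT _ _ (hLR a b hb))
    rw [lie_dX] at h1 h2
    have e := dX_swap (F := F) (.inl b) (.inl b)
    simp only [Sum.swap_inl] at e
    simp [e, hb, hb.symm] at h1 h2
    have h3 := B.smul_mem (2 : F)⁻¹ (B.add_mem h1 h2)
    have h5 : (2 : F)⁻¹ • (dX F (.inl a) (.inl a) - dX F (.inl b) (.inl b) +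
        (dX F (.inl a) (.inl a) + dX F (.inl b) (.inl b))) = dX F (.inl a) (.inl a) := by
      rw [show (dX F (.inl a) (.inl a) - dX F (.inl b) (.inl b) +
        (dX F (.inl a) (.inl a) + dX F (.inl b) (.inl b))) = (2 : F) • dX F (.inl a) (.inl a) by
          rw [two_smul]; abel]
      simp
    rwa [h5] at h3
  have hLL' : ∀ a b : Fin 5, dX F (.inl a) (.inl b) ∈ B := fun a b => by
    by_cases hab : a = b
    · rw [hab]; exact hdiag b
    · exact hLL a b hab
  have hLR' : ∀ a b : Fin 5, dX F (.inl a) (.inr b) ∈ B := fun a b => by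
    by_cases hab : a = b
    · have := dX_self (F := F) (.inl b)
      rw [Sum.swap_inl] at this
      rw [hab, this]; exact zero_mem _
    · exact hLR a b hab
  have hall : ∀ a b, dX F a b ∈ B := by
    rintro (a | a) (b | b)
    · exact hLL' a b
    · exact hLR' a b
    · exact hT _ _ (hLR' b a)
    · have := dX_swap (F := F) (.inl b) (.inl a)
      simp only [Sum.swap_inl] at this
      rw [this]; exact neg_mem (hLL' b a)
  intro M hM
  rw [mem_typeD] at hM
  have e1 : M = ∑ a, ∑ b, M a b • (single a b 1 : Matrix _ _ F) := by
    conv_lhs => rw [matrix_eq_sum_single M]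
    simp [smul_single]
  have e2 : -M = ∑ a, ∑ b, M a b • (single b.swap a.swap 1 : Matrix _ _ F) := by
    have hsum : ∀ g : (Fin 5 ⊕ Fin 5) → Matrix (Fin 5 ⊕ Fin 5) (Fin 5 ⊕ Fin 5) F,
        ∑ a, g a = ∑ a : Fin 5 ⊕ Fin 5, g a.swap := fun g =>
      (Equiv.sum_comp (Equiv.sumComm (Fin 5) (Fin 5)) g).symm
    have e0 : ∑ a, ∑ b, M a b • (single b.swap a.swap 1 : Matrix _ _ F) =
        ∑ a, ∑ b, M b.swap a.swap • (single a b 1 : Matrix _ _ F) := by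
      rw [Finset.sum_comm, hsum]
      refine Finset.sum_congr rfl fun a _ => ?_
      rw [hsum]
      refine Finset.sum_congr rfl fun b _ => ?_
      rw [Sum.swap_swap, Sum.swap_swap]
    rw [e0]
    conv_lhs => rw [e1]
    simp only [hM, neg_smul, Finset.sum_neg_distrib]
  have e3 : M = (2 : F)⁻¹ • ∑ a, ∑ b, M a b • dX F a b := by
    simp only [dX, smul_sub, Finset.sum_sub_distrib]
    rw [← e1, ← e2, smul_neg, sub_neg_eq_add, ← add_smul,
      show ((2 : F)⁻¹ + 2⁻¹) = 1 by norm_num, one_smul]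
  rw [e3]
  exact B.smul_mem _ (sum_mem fun a _ => sum_mem fun b _ => B.smul_mem _ (hall a b))

lemma dE_ne (i : Fin 5) : dE F i ≠ 0 := by
  intro h
  have h0 := congrFun (congrFun h (dA i)) (dB i)
  have hd : ∀ i, ¬ ((dB i).swap = dA i ∧ (dA i).swap = dB i) := by decide
  rw [dE, dX, Matrix.sub_apply, single_apply_same, single_apply, if_neg (hd i)] at h0
  simp at h0

lemma dE_mem (i : Fin 5) : dE F i ∈ LieAlgebra.Orthogonal.typeD (Fin 5) F := dX_mem _ _

lemma dF_mem (i : Fin 5) : (dE F i)ᵀ ∈ LieAlgebra.Orthogonal.typeD (Fin 5) F := by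
  rw [dE, dX_tr]; exact dX_mem _ _

lemma dH_mem (i : Fin 5) : diagonal (dD F i) ∈ LieAlgebra.Orthogonal.typeD (Fin 5) F := by
  have : ⁅dE F i, (dE F i)ᵀ⁆ = diagonal (dD F i) := (so_sys (F := F)).ef i
  rw [← this]
  exact LieSubalgebra.lie_mem _ (dE_mem i) (dF_mem i)

end sogen
end E8P

set_option linter.unusedSectionVars false
namespace E8P
open Matrix

section transport
variable {F : Type} [Field F] [CharZero F] {ι : Type} [Fintype ι] [DecidableEq ι]
  {S T : Type} [LieRing S] [LieAlgebra F S] [LieRing T] [LieAlgebra F T]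
  {A : Matrix ι ι ℤ} {h e f : ι → S}

lemma SerreSys.mapEquiv (s : SerreSys F A h e f) (g : S ≃ₗ⁅F⁆ T) :
    SerreSys F A (fun i => g (h i)) (fun i => g (e i)) (fun i => g (f i)) := by
  have hs : ∀ (c : F) x, g (c • x) = c • g x := fun c x => map_smul (g : S →ₗ[F] T) c x
  have h0 : g 0 = 0 := map_zero (g : S →ₗ[F] T)
  constructor
  · intro i j; rw [← LieEquiv.map_lie, s.hh, h0]
  · intro i; rw [← LieEquiv.map_lie, s.ef]
  · intro i j hij; rw [← LieEquiv.map_lie, s.ef0 i j hij, h0]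
  · intro i j; rw [← LieEquiv.map_lie, s.he, hs]
  · intro i j; rw [← LieEquiv.map_lie, s.hf, hs]
  · intro i j hij; rw [← LieEquiv.map_lie, s.ee0 i j hij, h0]
  · intro i j hij; rw [← LieEquiv.map_lie, ← LieEquiv.map_lie, s.ee1 i j hij, h0]
  · intro i j hij; rw [← LieEquiv.map_lie, s.ff0 i j hij, h0]
  · intro i j hij; rw [← LieEquiv.map_lie, ← LieEquiv.map_lie, s.ff1 i j hij, h0]

lemma gen_mapEquiv (gen : LieSubalgebra.lieSpan F S (Set.range e ∪ Set.range f) = ⊤)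
    (g : S ≃ₗ⁅F⁆ T) :
    LieSubalgebra.lieSpan F T (Set.range (fun i => g (e i)) ∪ Set.range (fun i => g (f i))) = ⊤ := by
  set B := LieSubalgebra.lieSpan F T
    (Set.range (fun i => g (e i)) ∪ Set.range (fun i => g (f i))) with hB
  have h1 : LieSubalgebra.lieSpan F S (Set.range e ∪ Set.range f) ≤ B.comap (g : S →ₗ⁅F⁆ T) := by
    rw [LieSubalgebra.lieSpan_le]
    rintro _ (⟨i, rfl⟩ | ⟨i, rfl⟩)
    · exact LieSubalgebra.subset_lieSpan (Or.inl ⟨i, rfl⟩)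
    · exact LieSubalgebra.subset_lieSpan (Or.inr ⟨i, rfl⟩)
  rw [gen] at h1
  rw [eq_top_iff]
  intro x _
  have h2 : g (g.symm x) ∈ B := h1 (LieSubalgebra.mem_top (g.symm x))
  rwa [LieEquiv.apply_symm_apply] at h2

lemma equiv_ne_zero (g : S ≃ₗ⁅F⁆ T) {x : S} (hx : x ≠ 0) : g x ≠ 0 := by
  intro h
  apply hx
  exact g.injective (h.trans (map_zero (g : S →ₗ[F] T)).symm)

end transport

section models
attribute [local instance] LieRing.ofAssociativeRing
variable (F : Type) [Field F] [CharZero F]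

lemma model_I : Nonempty (cI.ToLieAlgebra F ≃ₗ⁅F⁆
    (↥(LieAlgebra.SpecialLinear.sl (Fin 2) F) × ↥(LieAlgebra.SpecialLinear.sl (Fin 8) F))) :=
  prod_equiv slpdI ((sl_sys 1).toSub _ (slH_mem 1) (slE_mem 1) (slF_mem 1))
    ((sl_sys 7).toSub _ (slH_mem 7) (slE_mem 7) (slF_mem 7))
    (gen_toSub _ (slE_mem 1) (slF_mem 1) (sl_gen 1))
    (gen_toSub _ (slE_mem 7) (slF_mem 7) (sl_gen 7))
    (fun i h => slE_ne 1 i (congrArg Subtype.val h))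
    (fun i h => slE_ne 7 i (congrArg Subtype.val h))

lemma so_equiv {ζ : F} (hζ : ζ ^ 2 = -1) :
    Nonempty (↥(LieAlgebra.Orthogonal.typeD (Fin 5) F) ≃ₗ⁅F⁆ ↥(LieAlgebra.Orthogonal.so (Fin 10) F)) := by
  letI : Invertible (2 : F) := invertibleOfNonzero two_ne_zero
  have hi : ζ * ζ = -1 := by rw [← hζ]; ring
  refine ⟨((LieAlgebra.Orthogonal.typeDEquivSo' (Fin 5) F).trans
    (LieAlgebra.Orthogonal.soIndefiniteEquiv (Fin 5) (Fin 5) F hi)).trans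
    (LieEquiv.ofSubalgebras _ _ (Matrix.reindexLieEquiv (finSumFinEquiv : Fin 5 ⊕ Fin 5 ≃ Fin 10)) ?_)⟩
  ext M
  rw [LieSubalgebra.mem_map, LieAlgebra.Orthogonal.mem_so]
  constructor
  · rintro ⟨N, hN, rfl⟩
    rw [LieAlgebra.Orthogonal.mem_so] at hN
    ext i j
    exact congrFun (congrFun hN _) _
  · intro hM
    refine ⟨Matrix.reindex finSumFinEquiv.symm finSumFinEquiv.symm M, ?_, ?_⟩
    · rw [LieAlgebra.Orthogonal.mem_so]
      ext i j
      exact congrFun (congrFun hM _) _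
    · ext i j
      show M _ _ = M i j
      simp

lemma model_II {ζ : F} (hζ : ζ ^ 2 = -1) : Nonempty (cII.ToLieAlgebra F ≃ₗ⁅F⁆
    (↥(LieAlgebra.SpecialLinear.sl (Fin 4) F) × ↥(LieAlgebra.Orthogonal.so (Fin 10) F))) := by
  obtain ⟨g⟩ := so_equiv F hζ
  exact prod_equiv slpdII ((sl_sys 3).toSub _ (slH_mem 3) (slE_mem 3) (slF_mem 3))
    ((so_sys.toSub _ dH_mem dE_mem dF_mem).mapEquiv g)
    (gen_toSub _ (slE_mem 3) (slF_mem 3) (sl_gen 3))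
    (gen_mapEquiv (gen_toSub _ dE_mem dF_mem so_gen) g)
    (fun i h => slE_ne 3 i (congrArg Subtype.val h))
    (fun i => equiv_ne_zero g (fun h => dE_ne i (congrArg Subtype.val h)))

lemma finrank_sl (n : ℕ) :
    Module.finrank F ↥(LieAlgebra.SpecialLinear.sl (Fin (n + 1)) F) + 1 = (n + 1) * (n + 1) := by
  have h1 := LinearMap.finrank_range_add_finrank_ker (Matrix.traceLinearMap (Fin (n + 1)) F F)
  have h2 : LinearMap.range (Matrix.traceLinearMap (Fin (n + 1)) F F) = ⊤ := by
    rw [LinearMap.range_eq_top]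
    intro c
    exact ⟨Matrix.single 0 0 c, by simp⟩
  rw [h2, finrank_top, Module.finrank_self, Module.finrank_matrix] at h1
  simp at h1
  rw [add_comm]
  exact h1

lemma finrank_so : Module.finrank F ↥(LieAlgebra.Orthogonal.so (Fin 10) F) = 45 := by
  let P := {p : Fin 10 × Fin 10 // p.1 < p.2}
  have hc : Fintype.card P = 45 := by decide
  have hm : ∀ M : ↥(LieAlgebra.Orthogonal.so (Fin 10) F), ∀ i j, M.1 j i = - M.1 i j := fun M i j =>
    congrFun (congrFun ((LieAlgebra.Orthogonal.mem_so _ _ M.1).mp M.2) i) j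
  have φ : ↥(LieAlgebra.Orthogonal.so (Fin 10) F) ≃ₗ[F] (P → F) :=
    LinearEquiv.ofBijective
      ({ toFun := fun M p => M.1 p.1.1 p.1.2
         map_add' := fun _ _ => rfl
         map_smul' := fun _ _ => rfl } : ↥(LieAlgebra.Orthogonal.so (Fin 10) F) →ₗ[F] (P → F)) (by
      constructor
      · intro M N hMN
        have h1 : ∀ i j : Fin 10, i < j → M.1 i j = N.1 i j := fun i j hij =>
          congrFun hMN ⟨(i, j), hij⟩
        apply Subtype.ext
        ext i j
        rcases lt_trichotomy i j with h | h | h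
        · exact h1 i j h
        · subst h
          rw [self_eq_neg.mp (hm M i i), self_eq_neg.mp (hm N i i)]
        · rw [hm M j i, hm N j i, h1 j i h]
      · intro v
        refine ⟨⟨Matrix.of fun i j => if h : i < j then v ⟨(i, j), h⟩ else
          if h : j < i then - v ⟨(j, i), h⟩ else 0, ?_⟩, ?_⟩
        · rw [LieAlgebra.Orthogonal.mem_so]
          ext i j
          simp only [transpose_apply, of_apply, Matrix.neg_apply]
          rcases lt_trichotomy i j with h | h | h
          · simp [h, h.le]
          · subst h; simp
          · simp [h, h.le, not_lt.mpr h.le]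
        · ext p
          show (if h : p.1.1 < p.1.2 then v ⟨(p.1.1, p.1.2), h⟩ else _) = v p
          rw [dif_pos p.2])
  rw [φ.finrank_eq, Module.finrank_fintype_fun_eq_card, hc]

lemma finrank_I : Module.finrank F
    (↥(LieAlgebra.SpecialLinear.sl (Fin 2) F) × ↥(LieAlgebra.SpecialLinear.sl (Fin 8) F)) = 66 := by
  have h1 : Module.finrank F ↥(LieAlgebra.SpecialLinear.sl (Fin 2) F) + 1 = 4 := finrank_sl F 1
  have h2 : Module.finrank F ↥(LieAlgebra.SpecialLinear.sl (Fin 8) F) + 1 = 64 := finrank_sl F 7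
  rw [Module.finrank_prod]
  omega

lemma finrank_II : Module.finrank F
    (↥(LieAlgebra.SpecialLinear.sl (Fin 4) F) × ↥(LieAlgebra.Orthogonal.so (Fin 10) F)) = 60 := by
  have h1 : Module.finrank F ↥(LieAlgebra.SpecialLinear.sl (Fin 4) F) + 1 = 16 := finrank_sl F 3
  rw [Module.finrank_prod, finrank_so]
  omega

end models
end E8P

set_option linter.unusedSectionVars false
namespace E8P
open Matrix

theorem main_abstract {F : Type} [Field F] [IsAlgClosed F] [CharZero F] {S : Type} [LieRing S]
    [LieAlgebra F S] {h e f : Fin 8 → S} (s : SerreSys F CartanMatrix.E₈ h e f)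
    (gen : LieSubalgebra.lieSpan F S (Set.range e ∪ Set.range f) = ⊤) (he : ∀ i, e i ≠ 0)
    (θ : S ≃ₗ⁅F⁆ S) (h4 : ∀ x, θ (θ (θ (θ x))) = x) (h2 : ¬ ∀ x, θ (θ x) = x)
    (K : LieSubalgebra F S) (hK : ∀ x, x ∈ K ↔ θ x = x) [LieAlgebra.HasTrivialRadical F K]
    {ζ : F} (hζ : ζ ^ 2 = -1) :
    Nonempty (cI.ToLieAlgebra F ≃ₗ⁅F⁆ K) ∨ Nonempty (cII.ToLieAlgebra F ≃ₗ⁅F⁆ K) := by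
  haveI := s.finite e8_slpd gen
  haveI := s.isKilling e8_slpd gen he
  haveI : LieAlgebra.IsKilling F K := inferInstance
  obtain ⟨c, hc, hcst, hcent⟩ := exists_stable θ h4 K hK
  haveI := hc
  haveI := s.hst_cartan e8_slpd gen
  obtain ⟨g, hg⟩ := cartan_conj (Hst F CartanMatrix.E₈ h) c
  have s' := s.mapEquiv g
  have gen' := gen_mapEquiv gen g
  have he' : ∀ i, g (e i) ≠ 0 := fun i => equiv_ne_zero g (he i)
  have hH : ∀ z, z ∈ Hst F CartanMatrix.E₈ (fun i => g (h i)) ↔ z ∈ c := by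
    intro z
    rw [s'.mem_Hst_iff e8_slpd gen']
    have h1 := hg (g.symm z)
    rw [LieEquiv.apply_symm_apply, s.mem_Hst_iff e8_slpd gen] at h1
    rw [← h1]
    refine exists_congr fun a => ?_
    have h3 : ∑ i, a i • g (h i) = g (∑ i, a i • h i) := by
      refine Eq.trans ?_ (map_sum (g : S →ₗ[F] S) (fun i => a i • h i) Finset.univ).symm
      exact Finset.sum_congr rfl fun i _ => (map_smul (g : S →ₗ[F] S) (a i) (h i)).symm
    rw [h3]
    constructor
    · intro h5; rw [← h5, LieEquiv.symm_apply_apply]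
    · intro h5; rw [h5, LieEquiv.apply_symm_apply]
  obtain ⟨h₁, e₁, f₁, s₁, gen₁, he₁, hh₁, hc₁⟩ := s'.exists_diag e8_slpd gen' he' _ e8r e8r_inj θ h4
    (fun z => by rw [hH, hH]; exact hcst z)
    (fun z hz => by rw [hH]; exact hcent z fun x hx => hz x ((hH x).mpr hx))
  obtain ⟨h₂, e₂, f₂, t, s₂, gen₂, he₂, hh₂, ht, ht0, hta⟩ := e8_reduce s₁ gen₁ he₁ θ h4 hh₁ hc₁ hζ
  have hcen : ∀ y, θ y = y → (∀ z, θ z = z → ⁅y, z⁆ = 0) → y = 0 := by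
    intro y hy hz
    have h1 : (⟨y, (hK y).mpr hy⟩ : K) ∈ LieAlgebra.center F K := by
      rw [LieModule.mem_maxTrivSubmodule]
      rintro ⟨x, hx⟩
      apply Subtype.ext
      show ⁅x, y⁆ = 0
      rw [← lie_skew, hz x ((hK x).mp hx), neg_zero]
    rw [LieAlgebra.center_eq_bot, LieSubmodule.mem_bot] at h1
    exact congrArg Subtype.val h1
  rcases e8_kac s₂ gen₂ he₂ θ hh₂ hζ t ht ht0 hta h2 hcen with htj | htj
  · exact Or.inl (e8_fix_I s₂ gen₂ he₂ θ hh₂ hζ t ht htj K hK)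
  · exact Or.inr (e8_fix_II s₂ gen₂ he₂ θ hh₂ hζ t ht htj K hK)

end E8P

theorem stmt4 (F : Type) [Field F] [IsAlgClosed F] [CharZero F]
    (θ : ↥(lieAut F (LieAlgebra.e₈ F))) (h4 : orderOf θ = 4)
    (hss : LieAlgebra.IsSemisimple F ↥(fixedSubalgebra θ)) :
    (Nonempty (↥(fixedSubalgebra θ) ≃ₗ⁅F⁆
        (↥(LieAlgebra.SpecialLinear.sl (Fin 2) F) × ↥(LieAlgebra.SpecialLinear.sl (Fin 8) F))) ∧
      Module.finrank F ↥(fixedSubalgebra θ) = 66) ∨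
    (Nonempty (↥(fixedSubalgebra θ) ≃ₗ⁅F⁆
        (↥(LieAlgebra.SpecialLinear.sl (Fin 4) F) × ↥(LieAlgebra.Orthogonal.so (Fin 10) F))) ∧
      Module.finrank F ↥(fixedSubalgebra θ) = 60) := by
  obtain ⟨ζ, hζ⟩ := IsAlgClosed.exists_pow_nat_eq (-1 : F) (n := 2) (by norm_num)
  have hnt : Nontrivial (LieAlgebra.e₈ F) := by
    by_contra hn
    rw [not_nontrivial_iff_subsingleton] at hn
    have : θ = 1 := Subtype.ext (LinearEquiv.ext fun x => Subsingleton.elim _ _)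
    rw [this, orderOf_one] at h4
    norm_num at h4
  let θ' : LieAlgebra.e₈ F ≃ₗ⁅F⁆ LieAlgebra.e₈ F :=
    { (θ : LieAlgebra.e₈ F ≃ₗ[F] LieAlgebra.e₈ F) with
      map_lie' := fun {x y} => θ.2 x y }
  have hθ : ∀ x, θ' x = (θ : LieAlgebra.e₈ F ≃ₗ[F] LieAlgebra.e₈ F) x := fun x => rfl
  have hp4 : ∀ x, θ' (θ' (θ' (θ' x))) = x := by
    intro x
    have h1 : θ ^ 4 = 1 := by rw [← h4]; exact pow_orderOf_eq_one θ
    have h2 : θ * (θ * (θ * θ)) = 1 := by rw [← h1]; simp only [pow_succ, pow_zero, one_mul, mul_assoc]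
    exact LinearEquiv.congr_fun (congrArg Subtype.val h2) x
  have hp2 : ¬ ∀ x, θ' (θ' x) = x := by
    intro h
    have h1 : θ ^ 2 = 1 := by
      rw [pow_two]
      exact Subtype.ext (LinearEquiv.ext h)
    have h2 := orderOf_dvd_of_pow_eq_one h1
    rw [h4] at h2
    norm_num at h2
  have hK : ∀ x, x ∈ fixedSubalgebra θ ↔ θ' x = x := fun x => Iff.rfl
  haveI : LieAlgebra.HasTrivialRadical F ↥(fixedSubalgebra θ) := inferInstance
  rcases E8P.main_abstract E8P.serreSys_std E8P.gen_std (E8P.e8_e_ne hnt) θ' hp4 hp2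
    (fixedSubalgebra θ) hK hζ with hφ | hφ
  · obtain ⟨φ⟩ := hφ
    obtain ⟨ψ⟩ := E8P.model_I F
    refine Or.inl ⟨⟨φ.symm.trans ψ⟩, ?_⟩
    rw [← E8P.finrank_I F]
    exact (φ.symm.trans ψ).toLinearEquiv.finrank_eq
  · obtain ⟨φ⟩ := hφ
    obtain ⟨ψ⟩ := E8P.model_II F hζ
    refine Or.inr ⟨⟨φ.symm.trans ψ⟩, ?_⟩
    rw [← E8P.finrank_II F]
    exact (φ.symm.trans ψ).toLinearEquiv.finrank_eq
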